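/- Fix a real ε with 0 < ε < 10⁻² and set κ = 1/2 − ε. Then there exists a threshold N₀ (depending only on ε) such that for every natural number N ≥ N₀ satisfying |N − R²| ≤ 16·e^{2(log N)^κ} for some R ∈ ℕ, the set {(m,n) ∈ ℤ² : m² − n² = N and |n| ≤ 6·N^{1/4}·(log N)^{κ/4}} has at most 20 elements. -/

import Mathlib

open Finset in
/-- The divided difference of `f` at the set of nodes `S`. -/
noncomputable def dividedDiff (S : Finset ℕ) (f : ℕ → ℝ) : ℝ :=
  ∑ i ∈ S, f i / ∏ m ∈ S.erase i, ((i : ℝ) - m)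

namespace dividedDiff

open Finset

theorem mul_sub_left {S : Finset ℕ} {a : ℕ} (ha : a ∈ S) (g : ℕ → ℝ) :
    dividedDiff S (fun x => ((x : ℝ) - a) * g x) = dividedDiff (S.erase a) g := by
  unfold dividedDiff
  rw [← Finset.add_sum_erase S _ ha]
  simp only [sub_self, zero_mul, zero_div, zero_add]
  refine Finset.sum_congr rfl fun i hi => ?_
  have hia : i ≠ a := Finset.ne_of_mem_erase hi
  have h1 : a ∈ S.erase i := Finset.mem_erase.2 ⟨hia.symm, ha⟩
  rw [← Finset.mul_prod_erase _ _ h1, Finset.erase_right_comm]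
  have : (i : ℝ) - a ≠ 0 := sub_ne_zero.2 (by exact_mod_cast hia)
  rw [mul_div_mul_left _ _ this]

theorem add (S : Finset ℕ) (f g : ℕ → ℝ) :
    dividedDiff S (fun x => f x + g x) = dividedDiff S f + dividedDiff S g := by
  simp [dividedDiff, add_div, Finset.sum_add_distrib]

theorem sub (S : Finset ℕ) (f g : ℕ → ℝ) :
    dividedDiff S (fun x => f x - g x) = dividedDiff S f - dividedDiff S g := by
  simp [dividedDiff, sub_div, Finset.sum_sub_distrib]

theorem const_mul (S : Finset ℕ) (c : ℝ) (f : ℕ → ℝ) :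
    dividedDiff S (fun x => c * f x) = c * dividedDiff S f := by
  simp [dividedDiff, mul_div_assoc, Finset.mul_sum]

theorem one_of_card_eq_one {S : Finset ℕ} (h : S.card = 1) : dividedDiff S (fun _ => 1) = 1 := by
  obtain ⟨a, rfl⟩ := Finset.card_eq_one.1 h
  simp [dividedDiff]

theorem one_of_one_lt_card {S : Finset ℕ} (h : 1 < S.card) : dividedDiff S (fun _ => 1) = 0 := by
  induction hn : S.card generalizing S with
  | zero => omega
  | succ n ih =>
    obtain ⟨a, ha, b, hb, hab⟩ := Finset.one_lt_card.1 h
    have hne : (b : ℝ) - a ≠ 0 := sub_ne_zero.2 (by exact_mod_cast hab.symm)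
    have e : ((b : ℝ) - a) * dividedDiff S (fun _ => 1)
        = dividedDiff (S.erase a) (fun _ => 1) - dividedDiff (S.erase b) (fun _ => 1) := by
      rw [← mul_sub_left ha, ← mul_sub_left hb, ← const_mul, ← sub]
      congr 1
      funext x
      ring
    have ca : (S.erase a).card = n := by rw [Finset.card_erase_of_mem ha]; omega
    have cb : (S.erase b).card = n := by rw [Finset.card_erase_of_mem hb]; omega
    have : dividedDiff (S.erase a) (fun _ => 1) = dividedDiff (S.erase b) (fun _ => 1) := by
      rcases Nat.lt_or_ge 1 n with h1 | h1
      · rw [ih (by omega) ca, ih (by omega) cb]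
      · rw [one_of_card_eq_one (by omega), one_of_card_eq_one (by omega)]
    rw [this, sub_self] at e
    exact (mul_eq_zero.1 e).resolve_left hne

theorem abs_pow_mul_le {Z : ℕ} (m : ℕ) {S : Finset ℕ} {j : ℕ} (hS : S.card = j + 1)
    (hZ : ∀ i ∈ S, i ≤ Z) :
    |dividedDiff S (fun x => (x : ℝ) ^ m)| * (Z : ℝ) ^ j ≤ m.choose j * (Z : ℝ) ^ m := by
  induction m generalizing S j with
  | zero =>
    rcases Nat.eq_zero_or_pos j with rfl | hj
    · simp [one_of_card_eq_one hS]
    · simp [one_of_one_lt_card (S := S) (by omega)]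
  | succ m ih =>
    obtain ⟨a, ha⟩ : S.Nonempty := Finset.card_pos.1 (by omega)
    have e : dividedDiff S (fun x => (x : ℝ) ^ (m + 1)) =
        a * dividedDiff S (fun x => (x : ℝ) ^ m) + dividedDiff (S.erase a) (fun x => (x : ℝ) ^ m) := by
      rw [← mul_sub_left ha, ← const_mul, ← add]
      congr 1
      funext x
      ring
    have haZ : (a : ℝ) ≤ Z := by exact_mod_cast hZ a ha
    have h1 := ih hS hZ
    have hfirst : |(a : ℝ) * dividedDiff S (fun x => (x : ℝ) ^ m)| * (Z : ℝ) ^ j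
        ≤ m.choose j * (Z : ℝ) ^ (m + 1) := by
      rw [abs_mul, Nat.abs_cast, mul_assoc]
      calc (a : ℝ) * (|dividedDiff S (fun x => (x : ℝ) ^ m)| * (Z : ℝ) ^ j)
          ≤ Z * (m.choose j * (Z : ℝ) ^ m) := by gcongr
        _ = _ := by ring
    rcases Nat.eq_zero_or_pos j with rfl | hj
    · have : S.erase a = ∅ := by
        rw [← Finset.card_eq_zero, Finset.card_erase_of_mem ha]; omega
      rw [e, this]
      simpa [dividedDiff] using hfirst
    · obtain ⟨j, rfl⟩ : ∃ i, j = i + 1 := ⟨j - 1, by omega⟩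
      have h2 := ih (S := S.erase a) (j := j) (by rw [Finset.card_erase_of_mem ha]; omega)
        (fun i hi => hZ i (Finset.mem_of_mem_erase hi))
      rw [e]
      calc _ ≤ (|(a : ℝ) * dividedDiff S (fun x => (x : ℝ) ^ m)|
            + |dividedDiff (S.erase a) (fun x => (x : ℝ) ^ m)|) * (Z : ℝ) ^ (j + 1) := by
            gcongr; exact abs_add_le _ _
        _ = |(a : ℝ) * dividedDiff S (fun x => (x : ℝ) ^ m)| * (Z : ℝ) ^ (j + 1)
            + Z * (|dividedDiff (S.erase a) (fun x => (x : ℝ) ^ m)| * (Z : ℝ) ^ j) := by ring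
        _ ≤ m.choose (j + 1) * (Z : ℝ) ^ (m + 1) + Z * (m.choose j * (Z : ℝ) ^ m) := by gcongr
        _ = _ := by rw [Nat.choose_succ_succ]; push_cast; ring

theorem abs_le_card_mul {S : Finset ℕ} {g : ℕ → ℝ} {M : ℝ} (hM : ∀ i ∈ S, |g i| ≤ M) :
    |dividedDiff S g| ≤ S.card * M := by
  unfold dividedDiff
  refine (Finset.abs_sum_le_sum_abs _ _).trans ?_
  rw [← nsmul_eq_mul, ← Finset.sum_const]
  refine Finset.sum_le_sum fun i hi => ?_
  rw [abs_div]
  have : 1 ≤ |∏ m ∈ S.erase i, ((i : ℝ) - m)| := by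
    have hne : (∏ m ∈ S.erase i, ((i : ℤ) - m)) ≠ 0 :=
      Finset.prod_ne_zero_iff.2 fun m hm =>
        sub_ne_zero.2 (by exact_mod_cast (Finset.ne_of_mem_erase hm).symm)
    have := Int.one_le_abs hne
    have h2 : (1 : ℝ) ≤ ((|∏ m ∈ S.erase i, ((i : ℤ) - m)| : ℤ) : ℝ) := by exact_mod_cast this
    simpa using h2
  exact (div_le_self (abs_nonneg _) this).trans (hM i hi)

/-- Divided differences of `x ^ k * exp (c x)`; the order of the difference is gained exponentially. -/
theorem abs_pow_mul_exp_le {Z k j : ℕ} (c : ℝ) {S : Finset ℕ} (hS : S.card = j + 1)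
    (hZ : ∀ i ∈ S, i ≤ Z) :
    |dividedDiff S (fun x => (x : ℝ) ^ k * Real.exp (c * x))| * (Z : ℝ) ^ j ≤
      (2 * Z) ^ k * Real.exp (k - j) * Real.exp (2 * Real.exp 1 * |c| * Z) := by
  have hs : HasSum (fun m : ℕ => c ^ m / m.factorial * dividedDiff S (fun x => (x : ℝ) ^ (m + k)))
      (dividedDiff S (fun x => (x : ℝ) ^ k * Real.exp (c * x))) := by
    have h1 : ∀ i ∈ S, HasSum (fun m : ℕ => (i : ℝ) ^ k * ((c * i) ^ m / m.factorial) /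
        ∏ m ∈ S.erase i, ((i : ℝ) - m))
        ((i : ℝ) ^ k * Real.exp (c * i) / ∏ m ∈ S.erase i, ((i : ℝ) - m)) := by
      intro i _
      have := NormedSpace.expSeries_div_hasSum_exp (𝔸 := ℝ) (c * i)
      rw [← Real.exp_eq_exp_ℝ] at this
      exact (this.mul_left _).div_const _
    have h2 : (fun m : ℕ => c ^ m / m.factorial * dividedDiff S (fun x => (x : ℝ) ^ (m + k))) =
        fun m : ℕ => ∑ i ∈ S, (i : ℝ) ^ k * ((c * i) ^ m / m.factorial) /
          ∏ m ∈ S.erase i, ((i : ℝ) - m) := by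
      funext m
      rw [dividedDiff, Finset.mul_sum]
      refine Finset.sum_congr rfl fun i _ => ?_
      rw [mul_pow, pow_add]
      ring
    rw [h2]
    exact hasSum_sum h1
  have hg : HasSum (fun m : ℕ => (2 * Z : ℝ) ^ k * Real.exp (k - j) *
      ((2 * Real.exp 1 * |c| * Z) ^ m / m.factorial))
      ((2 * Z) ^ k * Real.exp (k - j) * Real.exp (2 * Real.exp 1 * |c| * Z)) := by
    have := NormedSpace.expSeries_div_hasSum_exp (𝔸 := ℝ) (2 * Real.exp 1 * |c| * Z)
    rw [← Real.exp_eq_exp_ℝ] at this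
    exact this.mul_left _
  have := (hs.mul_right ((Z : ℝ) ^ j)).norm_le_of_bounded hg fun m => by
    rw [Real.norm_eq_abs, abs_mul, abs_mul, abs_div, abs_pow, abs_pow, Nat.abs_cast, Nat.abs_cast,
      mul_assoc]
    have hch : (((m + k).choose j : ℕ) : ℝ) ≤ 2 ^ (m + k) * Real.exp (m + k - j) := by
      rcases Nat.lt_or_ge (m + k) j with hlt | hge
      · rw [Nat.choose_eq_zero_of_lt hlt]
        simpa using by positivity
      · have h1 : (((m + k).choose j : ℕ) : ℝ) ≤ 2 ^ (m + k) := by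
          exact_mod_cast Nat.choose_le_two_pow _ _
        have h2 : (1 : ℝ) ≤ Real.exp (m + k - j) := by
          refine Real.one_le_exp ?_
          have : (j : ℝ) ≤ m + k := by exact_mod_cast hge
          linarith
        nlinarith [show (0 : ℝ) < 2 ^ (m + k) by positivity]
    calc |c| ^ m / m.factorial * (|dividedDiff S (fun x => (x : ℝ) ^ (m + k))| * (Z : ℝ) ^ j)
        ≤ |c| ^ m / m.factorial * ((2 ^ (m + k) * Real.exp (m + k - j)) * (Z : ℝ) ^ (m + k)) := by
          refine mul_le_mul_of_nonneg_left ?_ (by positivity)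
          exact (abs_pow_mul_le (m + k) hS hZ).trans (by gcongr)
      _ = _ := by
          rw [show (m + k - j : ℝ) = m * 1 + (k - j) by ring, Real.exp_add, Real.exp_nat_mul]
          simp only [mul_pow, pow_add]
          ring
  rwa [Real.norm_eq_abs, abs_mul, abs_pow, Nat.abs_cast] at this

end dividedDiff

theorem norm_det_le_prod {𝕜 ι : Type*} [NormedField 𝕜] [Fintype ι] [DecidableEq ι]
    (A : Matrix ι ι 𝕜) (b : ι → ℝ) (h : ∀ i j, ‖A i j‖ ≤ b j) :
    ‖A.det‖ ≤ (Fintype.card ι).factorial * ∏ j, b j := by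
  rw [Matrix.det_apply]
  refine (norm_sum_le _ _).trans ?_
  calc _ ≤ ∑ σ : Equiv.Perm ι, ∏ j, b j := by
        refine Finset.sum_le_sum fun σ _ => ?_
        have : ‖Equiv.Perm.sign σ • ∏ i, A (σ i) i‖ = ∏ i, ‖A (σ i) i‖ := by
          rcases Int.units_eq_one_or (Equiv.Perm.sign σ) with h | h <;> simp [h, norm_prod]
        rw [this]
        exact Finset.prod_le_prod (fun _ _ => norm_nonneg _) fun j _ => h _ _
    _ = _ := by simp [Fintype.card_perm]

theorem sum_range_cast_id (n : ℕ) : ∑ i ∈ Finset.range n, (i : ℝ) = n * (n - 1) / 2 := by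
  induction n with
  | zero => simp
  | succ n ih =>
    rw [Finset.sum_range_succ, ih]
    push_cast
    ring

open Finset in
/-- Interpolation determinants are small if divided differences of their rows are. -/
theorem abs_interpolation_det_le {n Z : ℕ} (hZ0 : 0 < Z) (ζ : Fin n → ℕ)
    (hζ : Function.Injective ζ) (hZ : ∀ j, ζ j ≤ Z) (F : Fin n → ℕ → ℝ) {B : ℝ}
    (hF : ∀ i, ∀ S ⊆ Finset.univ.image ζ, ∀ j : ℕ, S.card = j + 1 →
      |dividedDiff S (F i)| * (Z : ℝ) ^ j ≤ B * Real.exp (-j)) :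
    |(Matrix.of fun i j => F i (ζ j)).det| ≤
      n.factorial * (B ^ n * Real.exp (-(n * (n - 1) / 2))) := by
  have hZ0' : (0 : ℝ) < Z := by exact_mod_cast hZ0
  have hne : ∀ {i j : Fin n}, i ≠ j → (ζ i : ℝ) - ζ j ≠ 0 := fun h =>
    sub_ne_zero.2 (by exact_mod_cast hζ.ne h)
  set M : Matrix (Fin n) (Fin n) ℝ := Matrix.of fun i j => F i (ζ j) with hM
  set U : Matrix (Fin n) (Fin n) ℝ := Matrix.of fun i j =>
    if i ≤ j then (∏ m ∈ (Finset.Iic j).erase i, ((ζ i : ℝ) - ζ m))⁻¹ else 0 with hU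
  have hMU : ∀ i j, (M * U) i j = dividedDiff ((Finset.Iic j).image ζ) (F i) := by
    intro i j
    rw [Matrix.mul_apply, dividedDiff, Finset.sum_image hζ.injOn, ← Finset.sum_subset
      (Finset.subset_univ (Finset.Iic j))]
    · refine Finset.sum_congr rfl fun l hl => ?_
      rw [← Finset.image_erase hζ, Finset.prod_image hζ.injOn]
      simp [hM, hU, Finset.mem_Iic.1 hl, div_eq_mul_inv]
    · intro l _ hl
      simp [hU, mt Finset.mem_Iic.2 hl]
  have hUdet : U.det = ∏ j, (∏ m ∈ (Finset.Iic j).erase j, ((ζ j : ℝ) - ζ m))⁻¹ := by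
    rw [Matrix.det_of_isUpperTriangular]
    · simp [hU]
    · intro i j hij
      have : ¬ i ≤ j := not_le.2 hij
      simp [hU, this]
  have hUne : U.det ≠ 0 := by
    rw [hUdet]
    exact Finset.prod_ne_zero_iff.2 fun j _ => inv_ne_zero (Finset.prod_ne_zero_iff.2 fun m hm =>
      hne (Finset.ne_of_mem_erase hm).symm)
  have hUinv : |U.det|⁻¹ ≤ ∏ j : Fin n, (Z : ℝ) ^ (j : ℕ) := by
    rw [hUdet, Finset.abs_prod, ← Finset.prod_inv_distrib]
    refine Finset.prod_le_prod (fun _ _ => by positivity) fun j _ => ?_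
    rw [abs_inv, inv_inv, Finset.abs_prod]
    have : ((Finset.Iic j).erase j).card = (j : ℕ) := by
      rw [Finset.card_erase_of_mem (by simp)]
      simp
    rw [← this, ← Finset.prod_const]
    refine Finset.prod_le_prod (fun _ _ => abs_nonneg _) fun m _ => ?_
    have h1 : (ζ j : ℝ) ≤ Z := by exact_mod_cast hZ j
    have h2 : (ζ m : ℝ) ≤ Z := by exact_mod_cast hZ m
    have h3 : (0 : ℝ) ≤ ζ j := by positivity
    have h4 : (0 : ℝ) ≤ ζ m := by positivity
    exact abs_le.2 ⟨by linarith, by linarith⟩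
  have hMUdet : |(M * U).det| ≤ n.factorial * ∏ j : Fin n, (B * Real.exp (-(j : ℕ)) / (Z : ℝ) ^ (j : ℕ)) := by
    have := norm_det_le_prod (M * U)
      (fun j : Fin n => B * Real.exp (-(j : ℕ)) / (Z : ℝ) ^ (j : ℕ)) fun i j => ?_
    · simpa using this
    rw [Real.norm_eq_abs, hMU, le_div_iff₀ (by positivity)]
    refine hF i _ (Finset.image_subset_image (Finset.subset_univ _)) j ?_
    rw [Finset.card_image_of_injective _ hζ]
    simp
  have hdet : |M.det| = |(M * U).det| * |U.det|⁻¹ := by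
    rw [Matrix.det_mul, abs_mul, mul_inv_cancel_right₀ (abs_ne_zero.2 hUne)]
  rw [hdet]
  calc _ ≤ (n.factorial * ∏ j : Fin n, (B * Real.exp (-(j : ℕ)) / (Z : ℝ) ^ (j : ℕ))) *
        ∏ j : Fin n, (Z : ℝ) ^ (j : ℕ) := by
        refine mul_le_mul hMUdet hUinv (by positivity) ((abs_nonneg _).trans hMUdet)
    _ = n.factorial * ∏ j : Fin n, (B * Real.exp (-(j : ℕ))) := by
        rw [mul_assoc, ← Finset.prod_mul_distrib]
        congr 1
        exact Finset.prod_congr rfl fun j _ => div_mul_cancel₀ _ (by positivity)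
    _ = _ := by
        rw [Finset.prod_mul_distrib, ← Real.exp_sum, Fin.sum_univ_eq_sum_range
          (fun j => -(j : ℝ)) n, Finset.sum_neg_distrib]
        rw [sum_range_cast_id]
        simp

open Polynomial in
theorem coeff_prod_sum_of_natDegree_le {R ι : Type*} [CommRing R] (s : Finset ι) (f : ι → R[X])
    (d : ι → ℕ) (h : ∀ i ∈ s, (f i).natDegree ≤ d i) :
    (∏ i ∈ s, f i).coeff (∑ i ∈ s, d i) = ∏ i ∈ s, (f i).coeff (d i) := by
  classical
  induction s using Finset.induction_on with
  | empty => simp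
  | insert a s ha ih =>
    rw [Finset.prod_insert ha, Finset.sum_insert ha, Finset.prod_insert ha,
      coeff_mul_add_eq_of_natDegree_le (h a (by simp)), ih fun i hi => h i (by simp [hi])]
    exact (natDegree_prod_le _ _).trans (Finset.sum_le_sum fun i hi => h i (by simp [hi]))

open Polynomial in
/-- A nonzero exponential polynomial does not vanish at all points of a large enough box. -/
theorem exists_expPoly_ne_zero {F : Type*} [Field F] [CharZero F] {β γ : F} (hβ : β ≠ 0)
    (hγ : γ ≠ 0) {T K R S q : ℕ} (hinj : ∀ l < T, ∀ l' < T, β ^ l = β ^ l' → l = l')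
    (hRS : T * K ≤ R * S) (hRq : R ≤ q) (p : Fin T → F[X]) (hdeg : ∀ l, (p l).natDegree < K)
    (hp : p ≠ 0) :
    ∃ r < T + R, ∃ s < S,
      ∑ l, (p l).eval ((r + s * q : ℕ) : F) * (β ^ r * γ ^ s) ^ (l : ℕ) ≠ 0 := by
  classical
  by_contra! hvan
  set I : Finset (Fin T) := Finset.univ.filter fun l => p l ≠ 0 with hI
  obtain ⟨l₀, hl₀⟩ : ∃ l, p l ≠ 0 := by
    by_contra! h
    exact hp (funext h)
  set t := I.card with ht
  have ht0 : 0 < t := Finset.card_pos.2 ⟨l₀, by simp [hI, hl₀]⟩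
  have htT : t ≤ T := by simpa using Finset.card_le_univ I
  set e := I.orderEmbOfFin ht.symm with he
  have hpe : ∀ i, p (e i) ≠ 0 := fun i => by
    have : e i ∈ I := I.orderEmbOfFin_mem ht.symm i
    exact (Finset.mem_filter.1 this).2
  set M : Matrix (Fin t) (Fin t) F[X] := Matrix.of fun r i =>
    C (β ^ ((e i : ℕ) * r)) * (p (e i)).comp (X + C ((r : ℕ) : F)) with hM
  set d : Fin t → ℕ := fun i => (p (e i)).natDegree with hd
  have hMdeg : ∀ r i, (M r i).natDegree ≤ d i := fun r i => by
    refine (natDegree_C_mul_le _ _).trans ?_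
    exact (natDegree_comp (p := p (e i)) (q := X + C ((r : ℕ) : F))).le.trans
      (by rw [natDegree_X_add_C, mul_one])
  have hMcoeff : ∀ r i, (M r i).coeff (d i) = (p (e i)).leadingCoeff * (β ^ (e i : ℕ)) ^ (r : ℕ) := by
    intro r i
    have h1 : ((p (e i)).comp (X + C ((r : ℕ) : F))).coeff (d i) = (p (e i)).leadingCoeff := by
      have := coeff_comp_degree_mul_degree (p := p (e i)) (q := X + C ((r : ℕ) : F))
        (by rw [natDegree_X_add_C]; exact one_ne_zero)
      rw [natDegree_X_add_C, mul_one] at this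
      rw [hd, this, leadingCoeff_X_add_C, one_pow, mul_one]
    rw [hM, Matrix.of_apply, coeff_C_mul, h1, pow_mul, mul_comm]
  have hcoeff : M.det.coeff (∑ i, d i) ≠ 0 := by
    have h1 : M.det.coeff (∑ i, d i) =
        (Matrix.of fun r i : Fin t => (p (e i)).leadingCoeff * (β ^ (e i : ℕ)) ^ (r : ℕ)).det := by
      rw [Matrix.det_apply, Matrix.det_apply, finsetSum_coeff]
      refine Finset.sum_congr rfl fun σ _ => ?_
      have h2 := coeff_prod_sum_of_natDegree_le Finset.univ (fun i => M (σ i) i) d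
        fun i _ => hMdeg _ _
      rw [Units.smul_def, Units.smul_def, coeff_smul, h2]
      simp only [hMcoeff, Matrix.of_apply]
    have h3 : (Matrix.of fun r i : Fin t => (p (e i)).leadingCoeff * (β ^ (e i : ℕ)) ^ (r : ℕ)).det =
        (∏ i, (p (e i)).leadingCoeff) * (Matrix.vandermonde fun i => β ^ (e i : ℕ)).det := by
      rw [← Matrix.det_transpose (Matrix.vandermonde _), ← Matrix.det_mul_row]
      rfl
    rw [h1, h3]
    refine mul_ne_zero (Finset.prod_ne_zero_iff.2 fun i _ => leadingCoeff_ne_zero.2 (hpe i)) ?_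
    refine Matrix.det_vandermonde_ne_zero_iff.2 fun i j hij => ?_
    exact e.injective (Fin.ext (hinj _ (e i).2 _ (e j).2 hij))
  have hdegdet : M.det.natDegree ≤ ∑ i, d i := by
    rw [Matrix.det_apply]
    refine natDegree_sum_le_of_forall_le _ _ fun σ _ => ?_
    rw [Units.smul_def]
    refine (natDegree_smul_le _ _).trans ?_
    exact (natDegree_prod_le _ _).trans (Finset.sum_le_sum fun i _ => hMdeg _ _)
  have hdlt : ∑ i, d i < R * S := by
    calc ∑ i, d i < ∑ _i : Fin t, K := Finset.sum_lt_sum_of_nonempty ⟨⟨0, ht0⟩, by simp⟩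
          fun i _ => hdeg _
      _ = t * K := by simp
      _ ≤ T * K := Nat.mul_le_mul_right _ htT
      _ ≤ R * S := hRS
  have hzero : M.det = 0 := by
    refine eq_zero_of_natDegree_lt_card_of_eval_eq_zero M.det
      (f := fun x : Fin R × Fin S => (((x.1 : ℕ) + (x.2 : ℕ) * q : ℕ) : F)) ?_ ?_ ?_
    · rintro ⟨r, s⟩ ⟨r', s'⟩ h
      have h' : (r : ℕ) + s * q = r' + s' * q :=
        Nat.cast_injective (R := F) h
      have hr : (r : ℕ) < q := r.2.trans_le hRq
      have hr' : (r' : ℕ) < q := r'.2.trans_le hRq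
      have h1 := congrArg (· % q) h'
      have h2 := congrArg (· / q) h'
      have hq : 0 < q := by omega
      simp [Nat.add_mul_mod_self_right, Nat.mod_eq_of_lt hr, Nat.mod_eq_of_lt hr'] at h1
      simp [Nat.add_mul_div_right _ _ hq, Nat.div_eq_of_lt hr, Nat.div_eq_of_lt hr'] at h2
      exact Prod.ext (Fin.ext h1) (Fin.ext h2)
    · rintro ⟨r, s⟩
      change (evalRingHom _) M.det = 0
      rw [RingHom.map_det]
      refine Matrix.exists_mulVec_eq_zero_iff.1
        ⟨fun i => (β ^ (r : ℕ) * γ ^ (s : ℕ)) ^ (e i : ℕ), ?_, ?_⟩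
      · intro h
        have := congrFun h ⟨0, ht0⟩
        simp [hβ, hγ] at this
      · funext r₁
        have h1 := hvan (r + r₁) (by omega) s s.2
        have h2 : ∑ l, (p l).eval (((r + r₁ : ℕ) + s * q : ℕ) : F) *
            (β ^ ((r : ℕ) + r₁) * γ ^ (s : ℕ)) ^ (l : ℕ) =
            ∑ l ∈ I, (p l).eval (((r + r₁ : ℕ) + s * q : ℕ) : F) *
            (β ^ ((r : ℕ) + r₁) * γ ^ (s : ℕ)) ^ (l : ℕ) := by
          refine (Finset.sum_subset (Finset.subset_univ _) fun l _ hl => ?_).symm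
          have : p l = 0 := by simpa [hI] using hl
          simp [this]
        rw [h2, ← Finset.image_orderEmbOfFin_univ I ht.symm, Finset.sum_image e.injective.injOn] at h1
        simp only [Matrix.mulVec, dotProduct, Pi.zero_apply]
        rw [← h1]
        refine Finset.sum_congr rfl fun i _ => ?_
        simp only [RingHom.mapMatrix_apply, Matrix.map_apply, hM, Matrix.of_apply, coe_evalRingHom,
          eval_mul, eval_C, eval_comp, eval_add, eval_X]
        have : (((r : ℕ) + (s : ℕ) * q : ℕ) : F) + ((r₁ : ℕ) : F)
          = (((r + r₁ : ℕ) + s * q : ℕ) : F) := by push_cast; ring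
        rw [this, pow_add, pow_mul]
        ring
    · simpa using lt_of_le_of_lt hdegdet hdlt
  exact hcoeff (by rw [hzero, coeff_zero])

/-- A matrix with linearly independent rows has a nonzero maximal minor. -/
theorem exists_submatrix_det_ne_zero {F ι κ : Type*} [Field F] [Fintype ι] [DecidableEq ι]
    [Fintype κ] (M : Matrix ι κ F)
    (h : ∀ v : ι → F, (∀ j, ∑ i, v i * M i j = 0) → v = 0) :
    ∃ f : ι → κ, (M.submatrix id f).det ≠ 0 := by
  set s : Set (ι → F) := Set.range fun j i => M i j with hs
  have hspan : Submodule.span F s = ⊤ := by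
    by_contra hne
    obtain ⟨φ, hφ, hker⟩ := Submodule.exists_le_ker_of_lt_top _ (lt_top_iff_ne_top.2 hne)
    refine hφ (LinearMap.pi_ext' fun i => LinearMap.ext_ring ?_)
    have h0 := h (fun i => φ (Pi.single i 1)) fun j => by
      have : φ (fun i => M i j) = 0 := hker (Submodule.subset_span ⟨j, rfl⟩)
      rw [LinearMap.pi_apply_eq_sum_univ] at this
      rw [← this]
      refine Finset.sum_congr rfl fun i _ => ?_
      rw [smul_eq_mul, mul_comm]
      congr 2
      funext k
      simp [Pi.single_apply, eq_comm]
    simpa using congrFun h0 i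
  obtain ⟨f, hf, -, hli⟩ := Submodule.exists_fun_fin_finrank_span_eq F s
  have hcard : Module.finrank F (Submodule.span F s) = Fintype.card ι := by
    rw [hspan, finrank_top, Module.finrank_fintype_fun_eq_card]
  let e : ι ≃ Fin (Module.finrank F (Submodule.span F s)) :=
    (Fintype.equivFin ι).trans (finCongr hcard.symm)
  choose g hg using hf
  refine ⟨g ∘ e, ?_⟩
  have hli' : LinearIndependent F fun i => (M.submatrix id (g ∘ e)).transpose i := by
    have : (fun i => (M.submatrix id (g ∘ e)).transpose i) = f ∘ e := by
      funext i
      exact hg (e i)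
    rw [this]
    exact hli.comp _ e.injective
  rw [← Matrix.det_transpose]
  exact ((Matrix.isUnit_iff_isUnit_det _).1
    (Matrix.linearIndependent_rows_iff_isUnit.1 hli')).ne_zero

/-- Liouville's inequality for a nonzero algebraic integer with one distinguished real embedding. -/
theorem one_le_abs_mul_pow_of_isIntegral {K : Type*} [Field K] [NumberField K] (ι : K →+* ℝ)
    {d : ℕ} (hd : Module.finrank ℚ K ≤ d + 1) {x : K} (hx : IsIntegral ℤ x) (hx0 : x ≠ 0) {B : ℝ}
    (hB : 1 ≤ B) (hφ : ∀ φ : K →+* ℂ, ‖φ x‖ ≤ B) : 1 ≤ |ι x| * B ^ d := by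
  classical
  have hnorm : (1 : ℝ) ≤ ‖algebraMap ℚ ℂ (Algebra.norm ℚ x)‖ := by
    obtain ⟨m, hm⟩ := IsIntegrallyClosed.isIntegral_iff.1 (Algebra.isIntegral_norm ℚ hx)
    have hm0 : m ≠ 0 := by
      rintro rfl
      exact hx0 ((Algebra.norm_eq_zero_iff (R := ℚ)).1 (by rw [← hm, map_zero]))
    rw [← hm]
    simpa using (by exact_mod_cast Int.one_le_abs hm0 : (1 : ℝ) ≤ |(m : ℝ)|)
  rw [Algebra.norm_eq_prod_embeddings, norm_prod] at hnorm
  let σ : K →ₐ[ℚ] ℂ := (Complex.ofRealHom.comp ι).toRatAlgHom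
  have hσ : ‖σ x‖ = |ι x| := by
    change ‖((ι x : ℝ) : ℂ)‖ = _
    simp
  rw [← Finset.mul_prod_erase _ _ (Finset.mem_univ σ), hσ] at hnorm
  refine hnorm.trans (mul_le_mul_of_nonneg_left ?_ (abs_nonneg _))
  calc ∏ φ ∈ Finset.univ.erase σ, ‖φ x‖ ≤ ∏ _φ ∈ Finset.univ.erase σ, B :=
        Finset.prod_le_prod (fun _ _ => norm_nonneg _) fun φ _ => hφ φ.toRingHom
    _ = B ^ (Finset.univ.erase σ).card := by rw [Finset.prod_const]
    _ ≤ B ^ d := by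
        refine pow_le_pow_right₀ hB ?_
        rw [Finset.card_erase_of_mem (Finset.mem_univ _), Finset.card_univ, AlgHom.card]
        omega

/-- Upper bound for the determinant of perturbed functions `x ^ k * exp (l * c * x)`. -/
theorem abs_expPoly_det_le {n Z K T S q : ℕ} (hZ0 : 0 < Z) (c Λ : ℝ) (k l : Fin n → ℕ)
    (hk : ∀ i, k i < K) (hl : ∀ i, l i < T) (ζ : Fin n → ℕ) (hζ : Function.Injective ζ)
    (hZ : ∀ j, ζ j ≤ Z) (hS : ∀ j, ζ j / q < S) (hΛ : (T : ℝ) * S * |Λ| ≤ 1)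
    (hsmall : n * (Z : ℝ) ^ n * ((Z : ℝ) ^ K * Real.exp (T * |c| * Z) * (2 * (T * S * |Λ|))) ≤
      Real.exp (-n)) :
    |(Matrix.of fun i j => (ζ j : ℝ) ^ k i * Real.exp (l i * c * ζ j) *
        Real.exp (-(l i * (ζ j / q : ℕ) * Λ))).det| ≤
      n.factorial * ((2 * ((2 * Z : ℝ) ^ K * Real.exp (K + 6 * (T * |c| * Z)))) ^ n *
        Real.exp (-(n * (n - 1) / 2))) := by
  have hZ1 : (1 : ℝ) ≤ Z := by exact_mod_cast hZ0
  refine abs_interpolation_det_le hZ0 ζ hζ hZ (fun i x => (x : ℝ) ^ k i * Real.exp (l i * c * x) *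
        Real.exp (-(l i * (x / q : ℕ) * Λ))) fun i S' hS' j hj => ?_
  have hmem : ∀ x ∈ S', x ≤ Z ∧ x / q < S := fun x hx => by
    obtain ⟨m, -, rfl⟩ := Finset.mem_image.1 (hS' hx)
    exact ⟨hZ m, hS m⟩
  have hjn : j + 1 ≤ n := by
    rw [← hj]
    simpa using (Finset.card_le_card hS').trans Finset.card_image_le
  have hkK : (k i : ℝ) ≤ K := by exact_mod_cast (hk i).le
  have hlT : (l i : ℝ) ≤ T := by exact_mod_cast (hl i).le
  have hsplit : (fun x : ℕ => (x : ℝ) ^ k i * Real.exp (l i * c * x) *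
        Real.exp (-(l i * (x / q : ℕ) * Λ))) = fun x : ℕ =>
        (x : ℝ) ^ k i * Real.exp (l i * c * x) + (x : ℝ) ^ k i * Real.exp (l i * c * x) *
        (Real.exp (-(l i * (x / q : ℕ) * Λ)) - 1) := by
    funext x
    ring
  rw [hsplit, dividedDiff.add]
  have hlc : |(l i : ℝ) * c| ≤ T * |c| := by
    rw [abs_mul, Nat.abs_cast]
    gcongr
  have h1 : |dividedDiff S' (fun x : ℕ => (x : ℝ) ^ k i * Real.exp (l i * c * x))| * (Z : ℝ) ^ j ≤
      (2 * Z : ℝ) ^ K * Real.exp (K + 6 * (T * |c| * Z)) * Real.exp (-j) := by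
    refine (dividedDiff.abs_pow_mul_exp_le (l i * c) hj fun x hx => (hmem x hx).1).trans ?_
    have e1 : (2 * Z : ℝ) ^ k i ≤ (2 * Z : ℝ) ^ K :=
      pow_le_pow_right₀ (by linarith) (hk i).le
    have e2 : 2 * Real.exp 1 * |(l i : ℝ) * c| * Z ≤ 6 * (T * |c| * Z) := by
      have : Real.exp 1 ≤ 3 := Real.exp_one_lt_d9.le.trans (by norm_num)
      calc 2 * Real.exp 1 * |(l i : ℝ) * c| * Z ≤ 2 * 3 * (T * |c|) * Z := by gcongr
        _ = _ := by ring
    rw [mul_assoc, mul_assoc (_ ^ K), ← Real.exp_add, ← Real.exp_add]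
    exact mul_le_mul e1 (Real.exp_le_exp.2 (by linarith)) (Real.exp_pos _).le (by positivity)
  have h2 : |dividedDiff S' (fun x : ℕ => (x : ℝ) ^ k i * Real.exp (l i * c * x) *
        (Real.exp (-(l i * (x / q : ℕ) * Λ)) - 1))| * (Z : ℝ) ^ j ≤ Real.exp (-j) := by
    have hM : ∀ x ∈ S', |(x : ℝ) ^ k i * Real.exp (l i * c * x) *
        (Real.exp (-(l i * (x / q : ℕ) * Λ)) - 1)| ≤
        (Z : ℝ) ^ K * Real.exp (T * |c| * Z) * (2 * (T * S * |Λ|)) := by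
      intro x hx
      obtain ⟨hxZ, hxS⟩ := hmem x hx
      have hxZ' : (x : ℝ) ≤ Z := by exact_mod_cast hxZ
      have hxS' : ((x / q : ℕ) : ℝ) ≤ S := by exact_mod_cast hxS.le
      rw [abs_mul, abs_mul, abs_pow, Nat.abs_cast, Real.abs_exp]
      have e1 : (x : ℝ) ^ k i ≤ (Z : ℝ) ^ K :=
        (pow_le_pow_left₀ (by positivity) hxZ' _).trans (pow_le_pow_right₀ hZ1 (hk i).le)
      have e2 : (l i : ℝ) * c * x ≤ T * |c| * Z := by
        calc (l i : ℝ) * c * x ≤ |(l i : ℝ) * c| * x := by gcongr; exact le_abs_self _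
          _ ≤ _ := by gcongr
      have e3 : |-((l i : ℝ) * (x / q : ℕ) * Λ)| ≤ T * S * |Λ| := by
        rw [abs_neg, abs_mul, abs_mul, Nat.abs_cast, Nat.abs_cast]
        gcongr
      have e4 : |Real.exp (-(l i * (x / q : ℕ) * Λ)) - 1| ≤ 2 * (T * S * |Λ|) :=
        (Real.abs_exp_sub_one_le (e3.trans hΛ)).trans (by linarith)
      gcongr
    have := dividedDiff.abs_le_card_mul hM
    have hjn' : (S'.card : ℝ) ≤ n := by rw [hj]; exact_mod_cast hjn
    have hZj : (Z : ℝ) ^ j ≤ (Z : ℝ) ^ n := pow_le_pow_right₀ hZ1 (by omega)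
    calc _ ≤ (n * ((Z : ℝ) ^ K * Real.exp (T * |c| * Z) * (2 * (T * S * |Λ|)))) * (Z : ℝ) ^ n := by
          gcongr
          exact this.trans (by gcongr)
      _ ≤ Real.exp (-n) := by linarith
      _ ≤ Real.exp (-j) := by
          rw [Real.exp_le_exp, neg_le_neg_iff]
          exact_mod_cast (by omega : j ≤ n)
  have h3 : (1 : ℝ) ≤ (2 * Z : ℝ) ^ K * Real.exp (K + 6 * (T * |c| * Z)) :=
    one_le_mul_of_one_le_of_one_le (one_le_pow₀ (by linarith)) (Real.one_le_exp (by positivity))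
  calc _ ≤ (|dividedDiff S' (fun x : ℕ => (x : ℝ) ^ k i * Real.exp (l i * c * x))| +
        |dividedDiff S' (fun x : ℕ => (x : ℝ) ^ k i * Real.exp (l i * c * x) *
        (Real.exp (-(l i * (x / q : ℕ) * Λ)) - 1))|) * (Z : ℝ) ^ j := by
        gcongr
        exact abs_add_le _ _
    _ ≤ (2 * Z : ℝ) ^ K * Real.exp (K + 6 * (T * |c| * Z)) * Real.exp (-j) + Real.exp (-j) := by
        rw [add_mul]
        exact add_le_add h1 h2
    _ ≤ _ := by nlinarith [Real.exp_pos (-(j : ℝ))]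

open Polynomial in
/-- A nonvanishing interpolation determinant attached to powers of `β` and `γ`. -/
theorem exists_expPoly_det_ne_zero {F : Type*} [Field F] [CharZero F] {β γ : F} (hβ : β ≠ 0)
    (hγ : γ ≠ 0) {T K R S q : ℕ} (hinj : ∀ l < T, ∀ l' < T, β ^ l = β ^ l' → l = l')
    (hRS : T * K ≤ R * S) (hRq : R ≤ q) :
    ∃ f : Fin K × Fin T → Fin (T + R) × Fin S,
      (Matrix.of fun i j : Fin K × Fin T => (((f j).1 + (f j).2 * q : ℕ) : F) ^ (i.1 : ℕ) *
        (β ^ ((f j).1 : ℕ) * γ ^ ((f j).2 : ℕ)) ^ (i.2 : ℕ)).det ≠ 0 := by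
  refine exists_submatrix_det_ne_zero (Matrix.of fun (i : Fin K × Fin T) (j : Fin (T + R) × Fin S) =>
    ((j.1 + j.2 * q : ℕ) : F) ^ (i.1 : ℕ) * (β ^ (j.1 : ℕ) * γ ^ (j.2 : ℕ)) ^ (i.2 : ℕ)) fun v hv => ?_
  rcases Nat.eq_zero_or_pos K with rfl | hK
  · exact Subsingleton.elim _ _
  set p : Fin T → F[X] := fun l => ∑ k : Fin K, monomial k (v (k, l)) with hp
  have hcoeff : ∀ (l : Fin T) (k : Fin K), (p l).coeff k = v (k, l) := fun l k => by
    simp only [hp, finsetSum_coeff, coeff_monomial]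
    rw [Finset.sum_eq_single k] <;> simp +contextual [Fin.ext_iff]
  by_contra hne
  obtain ⟨r, hr, s, hs, hrs⟩ := exists_expPoly_ne_zero hβ hγ hinj hRS hRq p (fun l => by
    refine lt_of_le_of_lt (natDegree_sum_le_of_forall_le _ _ (n := K - 1) fun k _ =>
      (natDegree_monomial_le _).trans (by omega)) (by omega)) (by
    rintro h0
    refine hne (funext fun ⟨k, l⟩ => ?_)
    rw [← hcoeff, h0]
    simp)
  refine hrs ?_
  rw [← hv (⟨r, hr⟩, ⟨s, hs⟩), Fintype.sum_prod_type_right]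
  refine Finset.sum_congr rfl fun l _ => ?_
  simp only [hp, eval_finsetSum, eval_monomial, Finset.sum_mul, Matrix.of_apply]
  exact Finset.sum_congr rfl fun k _ => by ring

/-- Choice of the sizes of the interpolation box. -/
theorem exists_box_parameters {h a : ℝ} (hh : 1 ≤ h) (ha : 1 ≤ a) {q T : ℕ} (hT1 : 1 ≤ T)
    (hTq : 10 ^ 4 * T * a ≤ q) :
    ∃ K R S : ℕ, T * K ≤ R * S ∧ T + R ≤ q ∧ 1 ≤ S ∧ 10 ^ 6 ≤ K ∧ (K : ℝ) ≤ 2 * 10 ^ 6 * T * h * a ∧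
      S * a ≤ K / 1000 ∧ ((T + R : ℕ) : ℝ) * h ≤ K / 100 := by
  have hT : (1 : ℝ) ≤ T := by exact_mod_cast hT1
  have hh0 : 0 < h := by linarith
  have ha0 : 0 < a := by linarith
  have hTha : 1 ≤ (T : ℝ) * h * a :=
    one_le_mul_of_one_le_of_one_le (one_le_mul_of_one_le_of_one_le hT hh) ha
  set K : ℕ := ⌈10 ^ 6 * T * h * a⌉₊ with hK
  have hK1 : 10 ^ 6 * T * h * a ≤ K := Nat.le_ceil _
  have hK2 : (K : ℝ) < 10 ^ 6 * T * h * a + 1 := Nat.ceil_lt_add_one (by positivity)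
  set S : ℕ := ⌊(K : ℝ) / (1000 * a)⌋₊ with hS
  set R : ℕ := ⌊(K : ℝ) / (200 * h)⌋₊ with hR
  have hS1 : (S : ℝ) ≤ K / (1000 * a) := Nat.floor_le (by positivity)
  have hR1 : (R : ℝ) ≤ K / (200 * h) := Nat.floor_le (by positivity)
  have hS2 : (K : ℝ) / (1000 * a) < S + 1 := Nat.lt_floor_add_one _
  have hR2 : (K : ℝ) / (200 * h) < R + 1 := Nat.lt_floor_add_one _
  have hKa : 1000 * T * h ≤ (K : ℝ) / (1000 * a) := by
    rw [le_div_iff₀ (by positivity)]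
    linarith
  have hKh : 5000 * T * a ≤ (K : ℝ) / (200 * h) := by
    rw [le_div_iff₀ (by positivity)]
    linarith
  have hTh : 1 ≤ (T : ℝ) * h := one_le_mul_of_one_le_of_one_le hT hh
  have hTa : 1 ≤ (T : ℝ) * a := one_le_mul_of_one_le_of_one_le hT ha
  have hS3 : (K : ℝ) / (1000 * a) / 2 ≤ S := by linarith
  have hR3 : (K : ℝ) / (200 * h) / 2 ≤ R := by linarith
  have hS4 : S * (1000 * a) ≤ K := (le_div_iff₀ (by positivity)).1 hS1
  have hR4 : R * (200 * h) ≤ K := (le_div_iff₀ (by positivity)).1 hR1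
  refine ⟨K, R, S, ?_, ?_, ?_, ?_, by linarith, by linarith, ?_⟩
  · have : (T : ℝ) * K ≤ R * S := by
      calc (T : ℝ) * K = (10 ^ 6 * T * h * a) * K / (10 ^ 6 * h * a) := by field_simp
        _ ≤ K * K / (10 ^ 6 * h * a) := by gcongr
        _ ≤ K * K / (8 * 10 ^ 5 * h * a) := by gcongr; norm_num
        _ = (K : ℝ) / (200 * h) / 2 * ((K : ℝ) / (1000 * a) / 2) := by field_simp; ring
        _ ≤ R * S := by gcongr
    exact_mod_cast this
  · have h1 : (R : ℝ) ≤ 5001 * T * a := by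
      refine hR1.trans ?_
      rw [div_le_iff₀ (by positivity)]
      nlinarith
    have : ((T + R : ℕ) : ℝ) ≤ q := by
      push_cast
      nlinarith
    exact_mod_cast this
  · have : (1 : ℝ) ≤ S := by linarith
    exact_mod_cast this
  · have : (10 ^ 6 : ℝ) ≤ K := by linarith
    exact_mod_cast this
  · push_cast
    nlinarith

set_option maxHeartbeats 1000000 in
/-- The numerical inequalities satisfied by the interpolation box. -/
theorem box_estimates {h a ℓ c Λ : ℝ} (hh : 1 ≤ h) (ha : 1 ≤ a) {q T D R S : ℕ} (hT1 : 1 ≤ T)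
    (hS1 : 1 ≤ S) (hq0 : 0 < q) (hDr : (10 ^ 6 : ℝ) ≤ D) (hD2 : (D : ℝ) ≤ 2 * 10 ^ 6 * T * h * a)
    (hSa : S * a ≤ (D : ℝ) / 1000) (hRh : ((T + R : ℕ) : ℝ) * h ≤ (D : ℝ) / 100)
    (hΛ : |Λ| ≤ Real.exp (-(ℓ / 3))) (hcq : |c| * q ≤ 3 * a)
    (hT : 300 * Real.log ℓ ≤ T) (hℓ : 10 ^ 7 * (T : ℝ) ^ 3 * (h * a) ≤ ℓ) (hqℓ : (q : ℝ) ≤ ℓ) :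
    6 * ((S * q : ℕ) : ℝ) ≤ Real.exp (2 * Real.log ℓ) ∧ 1 ≤ Real.log ℓ ∧ ((D * T : ℕ) : ℝ) ≤ ℓ ∧
    T * |c| * ((S * q : ℕ) : ℝ) ≤ 3 * ((D * T : ℕ) : ℝ) / 1000 ∧ (T : ℝ) * S * |Λ| ≤ 1 ∧
    ((D * T : ℕ) : ℝ) * ((S * q : ℕ) : ℝ) ^ (D * T) * (((S * q : ℕ) : ℝ) ^ D *
      Real.exp (T * |c| * ((S * q : ℕ) : ℝ)) * (2 * (T * S * |Λ|))) ≤ Real.exp (-((D * T : ℕ) : ℝ)) ∧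
    T * (S * a) + 4 * Real.log ℓ + 1 + D * (2 * Real.log ℓ) + D + 18 * ((D * T : ℕ) : ℝ) / 1000 -
      (((D * T : ℕ) : ℝ) - 1) / 2 + 3 * (D * (2 * Real.log ℓ) + T * (((T + R : ℕ) : ℝ) * h) +
        T * (S * a)) < 0 := by
  obtain ⟨n, hn⟩ : ∃ n, n = D * T := ⟨_, rfl⟩
  obtain ⟨Z, hZ⟩ : ∃ Z, Z = S * q := ⟨_, rfl⟩
  obtain ⟨Lg, hLg⟩ : ∃ Lg, Lg = Real.log ℓ := ⟨_, rfl⟩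
  rw [← hn, ← hZ, ← hLg]
  rw [← hLg] at hT
  have hTr : (1 : ℝ) ≤ T := by exact_mod_cast hT1
  have hqr : (0 : ℝ) < q := by exact_mod_cast hq0
  have hSr : (1 : ℝ) ≤ S := by exact_mod_cast hS1
  have hha : 1 ≤ h * a := one_le_mul_of_one_le_of_one_le hh ha
  have hT3 : (1 : ℝ) ≤ (T : ℝ) ^ 3 := one_le_pow₀ hTr
  have hℓ7 : 10 ^ 7 ≤ ℓ := by nlinarith [one_le_mul_of_one_le_of_one_le hT3 hha]
  have hLg1 : 1 ≤ Lg := by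
    rw [hLg, Real.le_log_iff_exp_le (by linarith)]
    have := Real.exp_one_lt_d9
    linarith
  have hLg0 : 0 ≤ Lg := by linarith
  have hexpLg : Real.exp Lg = ℓ := by rw [hLg]; exact Real.exp_log (by linarith)
  have hnr : (n : ℝ) = D * T := by rw [hn]; push_cast; ring
  have hnT : (n : ℝ) * T ≤ ℓ / 5 := by
    rw [hnr]
    calc (D : ℝ) * T * T ≤ (2 * 10 ^ 6 * T * h * a) * T * T := by gcongr
      _ = 10 ^ 7 * (T : ℝ) ^ 3 * (h * a) / 5 := by ring
      _ ≤ _ := by gcongr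
  have hnD : (D : ℝ) ≤ n := by rw [hnr]; nlinarith
  have hn6 : (10 ^ 6 : ℝ) * T ≤ n := by rw [hnr]; gcongr
  have hnn : (n : ℝ) ≤ n * T := by nlinarith
  have hnℓ : (n : ℝ) ≤ ℓ / 5 := by linarith
  have hSD : (S : ℝ) ≤ D / 1000 := by nlinarith
  have hTS : (T : ℝ) * S ≤ n / 1000 := by rw [hnr]; nlinarith
  have hSℓ : 6 * (S : ℝ) ≤ ℓ := by linarith
  have hZ0 : 0 < Z := by rw [hZ]; exact Nat.mul_pos hS1 hq0
  have hZr : (Z : ℝ) = S * q := by rw [hZ]; push_cast; ring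
  have hZ6 : 6 * (Z : ℝ) ≤ Real.exp (2 * Lg) := by
    rw [two_mul, Real.exp_add, hexpLg, hZr]
    calc 6 * ((S : ℝ) * q) = 6 * S * q := by ring
      _ ≤ ℓ * ℓ := by gcongr
  have hZ0r : (1 : ℝ) ≤ Z := by exact_mod_cast hZ0
  have hX : T * |c| * Z ≤ 3 * n / 1000 := by
    calc T * |c| * Z = T * S * (|c| * q) := by rw [hZr]; ring
      _ ≤ T * S * (3 * a) := by gcongr
      _ = 3 * T * (S * a) := by ring
      _ ≤ 3 * T * (D / 1000) := by gcongr
      _ = 3 * n / 1000 := by rw [hnr]; ring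
  have hLgT : Lg ≤ T / 300 := by linarith
  have hΛTS : (T : ℝ) * S * |Λ| ≤ Real.exp (Lg - ℓ / 3) := by
    rw [sub_eq_add_neg, Real.exp_add, hexpLg]
    gcongr
    linarith
  have hsmall : n * (Z : ℝ) ^ n * ((Z : ℝ) ^ D * Real.exp (T * |c| * Z) * (2 * (T * S * |Λ|))) ≤
      Real.exp (-n) := by
    have hZe : (Z : ℝ) ≤ Real.exp (2 * Lg) := by linarith
    have h2e : (2 : ℝ) ≤ Real.exp 1 := by
      have := Real.add_one_le_exp (1 : ℝ)
      linarith
    calc _ ≤ Real.exp Lg * Real.exp (2 * Lg) ^ n * (Real.exp (2 * Lg) ^ D *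
          Real.exp (3 * n / 1000) * (Real.exp 1 * Real.exp (Lg - ℓ / 3))) := by
          gcongr
          rw [hexpLg]
          linarith
      _ = Real.exp (Lg + n * (2 * Lg) + (D * (2 * Lg) + 3 * n / 1000 + (1 + (Lg - ℓ / 3)))) := by
          simp only [Real.exp_add, Real.exp_nat_mul]
      _ ≤ _ := by
          rw [Real.exp_le_exp]
          have e1 : (n : ℝ) * Lg ≤ n * (T / 300) := by gcongr
          have e2 : (D : ℝ) * Lg ≤ n * (T / 300) := by gcongr
          linarith
  have hΛTS1 : (T : ℝ) * S * |Λ| ≤ 1 := by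
    refine hΛTS.trans (Real.exp_le_one_iff.2 ?_)
    linarith
  refine ⟨hZ6, hLg1, by linarith, hX, hΛTS1, hsmall, ?_⟩
  have e1 : (T : ℝ) * (S * a) ≤ n / 1000 := by
    rw [hnr]
    calc (T : ℝ) * (S * a) ≤ T * (D / 1000) := by gcongr
      _ = _ := by ring
  have e2 : (T : ℝ) * (((T + R : ℕ) : ℝ) * h) ≤ n / 100 := by
    rw [hnr]
    calc (T : ℝ) * (((T + R : ℕ) : ℝ) * h) ≤ T * (D / 100) := by gcongr
      _ = _ := by ring
  have e3 : (D : ℝ) * (2 * Lg) ≤ n / 150 := by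
    rw [hnr]
    calc (D : ℝ) * (2 * Lg) ≤ D * (2 * (T / 300)) := by gcongr
      _ = _ := by ring
  have e4 : (D : ℝ) ≤ n / 10 := by
    rw [hnr]
    have : (300 : ℝ) ≤ T := by linarith
    nlinarith
  linarith

/-- The determinant used for two logarithms, cleared of denominators: integrality, conjugate bounds
and the factor relating it to the exponential polynomial determinant. -/
theorem exists_integral_expPoly_det {K : Type*} [Field K] [NumberField K] {β A₁ A₂ : K}
    (hβi : IsIntegral ℤ β) (hA₁i : IsIntegral ℤ A₁) (hA₂i : IsIntegral ℤ A₂) (hA₁0 : A₁ ≠ 0)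
    {h a Lg : ℝ} (hh : 0 ≤ h) (ha : 0 ≤ a) (hLg : 0 ≤ Lg) {q T D R S : ℕ}
    (hβh : ∀ φ : K →+* ℂ, ‖φ β‖ ≤ Real.exp h) (hA₁h : ∀ φ : K →+* ℂ, ‖φ A₁‖ ≤ Real.exp a)
    (hA₂h : ∀ φ : K →+* ℂ, ‖φ A₂‖ ≤ Real.exp a) (hn : ((D * T : ℕ) : ℝ) ≤ Real.exp Lg)
    (hZ : ((S * q : ℕ) : ℝ) ≤ Real.exp (2 * Lg)) (hRq : T + R ≤ q)
    (f : Fin D × Fin T → Fin (T + R) × Fin S) :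
    ∃ E : K, IsIntegral ℤ E ∧ E = (∏ i : Fin D × Fin T, (A₁ ^ S) ^ (i.2 : ℕ)) *
      (Matrix.of fun i j : Fin D × Fin T => (((f j).1 + (f j).2 * q : ℕ) : K) ^ (i.1 : ℕ) *
        (β ^ ((f j).1 : ℕ) * (A₂ / A₁) ^ ((f j).2 : ℕ)) ^ (i.2 : ℕ)).det ∧
      ∀ φ : K →+* ℂ, ‖φ E‖ ≤ Real.exp (((D * T : ℕ) : ℝ) * Lg + ((D * T : ℕ) : ℝ) *
        (D * (2 * Lg) + T * (((T + R : ℕ) : ℝ) * h) + T * (S * a))) := by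
  classical
  obtain ⟨n, hn'⟩ : ∃ n, n = D * T := ⟨_, rfl⟩
  obtain ⟨Z, hZ'⟩ : ∃ Z, Z = S * q := ⟨_, rfl⟩
  rw [← hn'] at hn ⊢
  rw [← hZ'] at hZ
  set N : Matrix (Fin D × Fin T) (Fin D × Fin T) K := Matrix.of fun i j =>
    (((f j).1 + (f j).2 * q : ℕ) : K) ^ (i.1 : ℕ) *
        (β ^ ((f j).1 : ℕ) * (A₂ / A₁) ^ ((f j).2 : ℕ)) ^ (i.2 : ℕ) with hN
  set E : Matrix (Fin D × Fin T) (Fin D × Fin T) K := Matrix.of fun i j =>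
    (((f j).1 + (f j).2 * q : ℕ) : K) ^ (i.1 : ℕ) * (β ^ ((f j).1 : ℕ)) ^ (i.2 : ℕ) *
      ((A₂ ^ ((f j).2 : ℕ)) ^ (i.2 : ℕ) * (A₁ ^ (S - (f j).2)) ^ (i.2 : ℕ)) with hE
  have hEN : E = Matrix.of fun i j => (A₁ ^ S) ^ (i.2 : ℕ) * N i j := by
    ext i j
    simp only [hE, hN, Matrix.of_apply]
    have hs : ((f j).2 : ℕ) ≤ S := (f j).2.2.le
    have key : A₂ ^ ((f j).2 : ℕ) * A₁ ^ (S - (f j).2) = (A₂ / A₁) ^ ((f j).2 : ℕ) * A₁ ^ S := by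
      have : A₁ ^ S = A₁ ^ (S - (f j).2) * A₁ ^ ((f j).2 : ℕ) := by
        rw [← pow_add, Nat.sub_add_cancel hs]
      rw [this, div_pow]
      field_simp
    rw [← mul_pow (A₂ ^ _), key]
    generalize A₂ / A₁ = γ
    simp only [mul_pow]
    ring
  have hEdet : E.det = (∏ i : Fin D × Fin T, (A₁ ^ S) ^ (i.2 : ℕ)) * N.det := by
    rw [hEN, Matrix.det_mul_column]
  have hζZ : ∀ j, ((f j).1 : ℕ) + (f j).2 * q ≤ Z := by
    intro j
    have h1 := (f j).1.2
    have h2 : ((f j).2 : ℕ) + 1 ≤ S := (f j).2.2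
    have h3 := Nat.mul_le_mul_right q h2
    rw [hZ']
    rw [add_mul] at h3
    omega
  have hcard : Fintype.card (Fin D × Fin T) = n := by simp [hn']
  obtain ⟨E₁, hE₁⟩ : ∃ E₁ : ℝ, E₁ = D * (2 * Lg) + T * (((T + R : ℕ) : ℝ) * h) + T * (S * a) :=
    ⟨_, rfl⟩
  rw [← hE₁]
  have hfact : ((n.factorial : ℕ) : ℝ) ≤ Real.exp (n * Lg) := by
    rw [Real.exp_nat_mul]
    calc ((n.factorial : ℕ) : ℝ) ≤ (n : ℝ) ^ n := by exact_mod_cast Nat.factorial_le_pow n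
      _ ≤ _ := by gcongr
  have hconj : ∀ φ : K →+* ℂ, ‖φ E.det‖ ≤ Real.exp (n * Lg + n * E₁) := by
    intro φ
    rw [RingHom.map_det]
    refine (norm_det_le_prod _ (fun _ => Real.exp E₁) fun i j => ?_).trans ?_
    · simp only [RingHom.mapMatrix_apply, Matrix.map_apply, hE, Matrix.of_apply, map_mul, map_pow,
        map_natCast, norm_mul, norm_pow, Complex.norm_natCast]
      have hiT : ((i.2 : ℕ) : ℝ) ≤ T := by exact_mod_cast i.2.2.le
      have e1 : ((((f j).1 : ℕ) + (f j).2 * q : ℕ) : ℝ) ^ (i.1 : ℕ) ≤ Real.exp (D * (2 * Lg)) := by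
        rw [Real.exp_nat_mul]
        have h1 : ((((f j).1 : ℕ) + (f j).2 * q : ℕ) : ℝ) ≤ Z := by exact_mod_cast hζZ j
        have h2 : (1 : ℝ) ≤ Real.exp (2 * Lg) := Real.one_le_exp (by linarith)
        calc _ ≤ Real.exp (2 * Lg) ^ (i.1 : ℕ) := by gcongr; linarith
          _ ≤ _ := pow_le_pow_right₀ h2 i.1.2.le
      have e2 : (‖φ β‖ ^ ((f j).1 : ℕ)) ^ (i.2 : ℕ) ≤ Real.exp (T * (((T + R : ℕ) : ℝ) * h)) := by
        calc _ ≤ (Real.exp h ^ ((f j).1 : ℕ)) ^ (i.2 : ℕ) := by gcongr; exact hβh φ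
          _ = Real.exp ((i.2 : ℕ) * (((f j).1 : ℕ) * h)) := by simp only [Real.exp_nat_mul]
          _ ≤ _ := by
            rw [Real.exp_le_exp]
            have : (((f j).1 : ℕ) : ℝ) ≤ ((T + R : ℕ) : ℝ) := by exact_mod_cast (f j).1.2.le
            gcongr
      have e3 : (‖φ A₂‖ ^ ((f j).2 : ℕ)) ^ (i.2 : ℕ) * (‖φ A₁‖ ^ (S - (f j).2)) ^ (i.2 : ℕ) ≤
          Real.exp (T * (S * a)) := by
        calc _ ≤ (Real.exp a ^ ((f j).2 : ℕ)) ^ (i.2 : ℕ) *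
              (Real.exp a ^ (S - (f j).2)) ^ (i.2 : ℕ) := by
              gcongr
              · exact hA₂h φ
              · exact hA₁h φ
          _ = Real.exp ((i.2 : ℕ) * (S * a)) := by
            rw [← mul_pow, ← pow_add, Nat.add_sub_cancel' (f j).2.2.le, Real.exp_nat_mul,
              Real.exp_nat_mul]
          _ ≤ _ := by
            rw [Real.exp_le_exp]
            gcongr
      refine (mul_le_mul (mul_le_mul e1 e2 (by positivity) (by positivity)) e3 (by positivity)
        (by positivity)).trans_eq ?_
      rw [hE₁, Real.exp_add, Real.exp_add]
    · rw [Finset.prod_const, Finset.card_univ, hcard, Real.exp_add, Real.exp_nat_mul E₁ n]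
      gcongr
  have hinteg : IsIntegral ℤ E.det := by
    have hnat : ∀ m : ℕ, IsIntegral ℤ (m : K) := fun m => by
      exact_mod_cast (isIntegral_algebraMap (R := ℤ) (A := K) (x := m))
    refine IsIntegral.det fun i j => ?_
    simp only [hE, Matrix.of_apply]
    exact (((hnat _).pow _).mul ((hβi.pow _).pow _)).mul (((hA₂i.pow _).pow _).mul ((hA₁i.pow _).pow _))
  exact ⟨E.det, hinteg, hEdet, hconj⟩

/-- The archimedean upper bound for the determinant used for two logarithms. -/
theorem abs_map_expPoly_det_le {K : Type*} [Field K] (ι : K →+* ℝ) {β γ : K}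
    (hβ : 0 < ι β) (hγ : 0 < ι γ) {q T D R S : ℕ} {Λ : ℝ}
    (hΛ : Λ = q * Real.log (ι β) - Real.log (ι γ)) (hRq : T + R ≤ q) (hq0 : 0 < q) (hS : 0 < S)
    (hΛTS1 : (T : ℝ) * S * |Λ| ≤ 1)
    (hsmall : ((D * T : ℕ) : ℝ) * ((S * q : ℕ) : ℝ) ^ (D * T) * (((S * q : ℕ) : ℝ) ^ D *
      Real.exp (T * |Real.log (ι β)| * ((S * q : ℕ) : ℝ)) * (2 * (T * S * |Λ|))) ≤
        Real.exp (-((D * T : ℕ) : ℝ)))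
    (f : Fin D × Fin T → Fin (T + R) × Fin S) (hfinj : Function.Injective f) :
    |ι (Matrix.of fun i j : Fin D × Fin T => (((f j).1 + (f j).2 * q : ℕ) : K) ^ (i.1 : ℕ) *
        (β ^ ((f j).1 : ℕ) * γ ^ ((f j).2 : ℕ)) ^ (i.2 : ℕ)).det| ≤
      ((D * T).factorial : ℝ) * ((2 * ((2 * ((S * q : ℕ) : ℝ)) ^ D * Real.exp (D + 6 *
        (T * |Real.log (ι β)| * ((S * q : ℕ) : ℝ))))) ^ (D * T) *
          Real.exp (-(((D * T : ℕ) : ℝ) * (((D * T : ℕ) : ℝ) - 1) / 2))) := by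
  classical
  obtain ⟨Z, hZ'⟩ : ∃ Z, Z = S * q := ⟨_, rfl⟩
  have hZ0 : 0 < Z := by rw [hZ']; exact Nat.mul_pos hS hq0
  rw [← hZ'] at hsmall ⊢
  have hζZ : ∀ j, ((f j).1 : ℕ) + (f j).2 * q ≤ Z := by
    intro j
    have h1 := (f j).1.2
    have h2 : ((f j).2 : ℕ) + 1 ≤ S := (f j).2.2
    have h3 := Nat.mul_le_mul_right q h2
    rw [hZ']
    rw [add_mul] at h3
    omega
  have hdivq : ∀ j, (((f j).1 : ℕ) + (f j).2 * q) / q = (f j).2 := fun j => by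
    rw [Nat.add_mul_div_right _ _ hq0, Nat.div_eq_of_lt ((f j).1.2.trans_le hRq), zero_add]
  have hmodq : ∀ j, (((f j).1 : ℕ) + (f j).2 * q) % q = (f j).1 := fun j => by
    rw [Nat.add_mul_mod_self_right, Nat.mod_eq_of_lt ((f j).1.2.trans_le hRq)]
  let e : Fin (D * T) ≃ Fin D × Fin T := finProdFinEquiv.symm
  have key := abs_expPoly_det_le (n := D * T) (K := D) (T := T) (S := S) (q := q) hZ0 (Real.log (ι β)) Λ
    (fun i => (e i).1) (fun i => (e i).2) (fun i => (e i).1.2) (fun i => (e i).2.2)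
    (fun j => (f (e j)).1 + (f (e j)).2 * q) (fun i j hij => by
      have hij' : ((f (e i)).1 : ℕ) + (f (e i)).2 * q = (f (e j)).1 + (f (e j)).2 * q := hij
      have h1 := hdivq (e i)
      have h2 := hmodq (e i)
      rw [hij', hdivq] at h1
      rw [hij', hmodq] at h2
      exact e.injective (hfinj (Prod.ext (Fin.ext h2.symm) (Fin.ext h1.symm))))
    (fun j => hζZ _) (fun j => by rw [hdivq]; exact (f (e j)).2.2) hΛTS1 hsmall
  convert key using 2
  rw [RingHom.map_det, ← Matrix.det_submatrix_equiv_self e]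
  congr 1
  ext i j
  simp only [Matrix.submatrix_apply, RingHom.mapMatrix_apply, Matrix.map_apply, 
    Matrix.of_apply, map_mul, map_pow, map_natCast, hdivq]
  rw [mul_assoc, ← Real.exp_add]
  congr 1
  rw [← Real.exp_log hβ, ← Real.exp_log (hγ), ← Real.exp_nat_mul, ← Real.exp_nat_mul,
    ← Real.exp_add, ← Real.exp_nat_mul, Real.log_exp]
  congr 1
  rw [hΛ]
  push_cast
  ring

/-- A lower bound for two logarithms: `β ^ q * A₁ / A₂` cannot be extremely close to `1`. -/
theorem false_of_two_logs {K : Type*} [Field K] [NumberField K] (ι : K →+* ℝ)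
    (hd : Module.finrank ℚ K ≤ 4) {β A₁ A₂ : K} (hβi : IsIntegral ℤ β) (hA₁i : IsIntegral ℤ A₁)
    (hA₂i : IsIntegral ℤ A₂) (hβ : 0 < ι β) (hA₁ : 0 < ι A₁) (hA₂ : 0 < ι A₂) (hβ1 : ι β ≠ 1)
    {h a ℓ : ℝ} (hh : 1 ≤ h) (ha : 1 ≤ a) {q T : ℕ} (hT1 : 1 ≤ T)
    (hβh : ∀ φ : K →+* ℂ, ‖φ β‖ ≤ Real.exp h) (hA₁h : ∀ φ : K →+* ℂ, ‖φ A₁‖ ≤ Real.exp a)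
    (hA₂h : ∀ φ : K →+* ℂ, ‖φ A₂‖ ≤ Real.exp a)
    (hlog : |Real.log (ι A₁) - Real.log (ι A₂)| ≤ 2 * a)
    (hΛ : |q * Real.log (ι β) + Real.log (ι A₁) - Real.log (ι A₂)| ≤ Real.exp (-(ℓ / 3)))
    (hT : 300 * Real.log ℓ ≤ T) (hℓ : 10 ^ 7 * (T : ℝ) ^ 3 * (h * a) ≤ ℓ)
    (hTq : 10 ^ 4 * T * a ≤ q) (hqℓ : (q : ℝ) ≤ ℓ) : False := by
  classical
  obtain ⟨D, R, S, hRS, hRq, hS1, hD1, hD2, hSa, hRh⟩ := exists_box_parameters hh ha hT1 hTq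
  have hq0 : 0 < q := by omega
  have hDr : (10 ^ 6 : ℝ) ≤ D := by exact_mod_cast hD1
  have hha : 1 ≤ h * a := one_le_mul_of_one_le_of_one_le hh ha
  have hTr : (1 : ℝ) ≤ T := by exact_mod_cast hT1
  have hqr : (0 : ℝ) < q := by exact_mod_cast hq0
  have hT3 : (1 : ℝ) ≤ (T : ℝ) ^ 3 := one_le_pow₀ hTr
  have hℓ7 : 10 ^ 7 ≤ ℓ := by nlinarith [one_le_mul_of_one_le_of_one_le hT3 hha]
  have hβ0 : β ≠ 0 := by rintro rfl; simp at hβ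
  have hA₁0 : A₁ ≠ 0 := by rintro rfl; simp at hA₁
  have hA₂0 : A₂ ≠ 0 := by rintro rfl; simp at hA₂
  obtain ⟨c, hc⟩ : ∃ c, c = Real.log (ι β) := ⟨_, rfl⟩
  obtain ⟨Λ, hΛdef⟩ : ∃ Λ, Λ = q * Real.log (ι β) + Real.log (ι A₁) - Real.log (ι A₂) := ⟨_, rfl⟩
  rw [← hΛdef] at hΛ
  have hΛγ : Λ = q * Real.log (ι β) - Real.log (ι (A₂ / A₁)) := by
    rw [map_div₀, Real.log_div hA₂.ne' hA₁.ne', hΛdef]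
    ring
  have hΛ1 : |Λ| ≤ 1 := hΛ.trans (Real.exp_le_one_iff.2 (by linarith))
  have hcq : |c| * q ≤ 3 * a := by
    have : c * q = Λ - (Real.log (ι A₁) - Real.log (ι A₂)) := by rw [hΛdef, hc]; ring
    rw [← abs_of_pos hqr, ← abs_mul, this]
    refine (abs_sub _ _).trans ?_
    linarith
  obtain ⟨hZ6, hLg1, hnℓ, hX, hΛTS1, hsmall, hneg⟩ := box_estimates hh ha hT1 hS1 hq0 hDr hD2 hSa
    hRh hΛ hcq hT hℓ hqℓ
  obtain ⟨Lg, hLg⟩ : ∃ Lg, Lg = Real.log ℓ := ⟨_, rfl⟩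
  have hexpLg : Real.exp Lg = ℓ := by rw [hLg]; exact Real.exp_log (by linarith)
  rw [← hLg] at hZ6 hLg1 hneg
  have hinj : ∀ l < T, ∀ l' < T, β ^ l = β ^ l' → l = l' := by
    intro l _ l' _ hll
    have : (ι β) ^ l = (ι β) ^ l' := by rw [← map_pow, ← map_pow, hll]
    exact pow_right_injective₀ hβ hβ1 this
  obtain ⟨f, hf⟩ := exists_expPoly_det_ne_zero (F := K) hβ0 (div_ne_zero hA₂0 hA₁0) hinj hRS
    (show R ≤ q by omega)
  have hfinj : Function.Injective f := by
    intro i j hij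
    by_contra hne
    refine hf (Matrix.det_zero_of_column_eq hne fun k => ?_)
    simp only [Matrix.of_apply, hij]
  obtain ⟨E, hinteg, hE, hconj⟩ := exists_integral_expPoly_det hβi hA₁i hA₂i hA₁0 (by linarith)
    (by linarith) (show 0 ≤ Lg by linarith) hβh hA₁h hA₂h (hnℓ.trans_eq hexpLg.symm)
    (show ((S * q : ℕ) : ℝ) ≤ _ by
      have : (0 : ℝ) ≤ ((S * q : ℕ) : ℝ) := Nat.cast_nonneg _
      linarith) hRq f
  have hE0 : E ≠ 0 := by
    rw [hE]
    exact mul_ne_zero (Finset.prod_ne_zero_iff.2 fun _ _ => pow_ne_zero _ (pow_ne_zero _ hA₁0)) hf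
  rw [hc] at hX hsmall
  have hreal := abs_map_expPoly_det_le ι hβ (by rw [map_div₀]; exact div_pos hA₂ hA₁) hΛγ hRq hq0
    hS1 hΛTS1 hsmall f hfinj
  rw [← hc] at hX hreal
  generalize (Matrix.of fun i j : Fin D × Fin T => (((f j).1 + (f j).2 * q : ℕ) : K) ^ (i.1 : ℕ) *
        (β ^ ((f j).1 : ℕ) * (A₂ / A₁) ^ ((f j).2 : ℕ)) ^ (i.2 : ℕ)).det = N at hreal hE
  have hcard : Fintype.card (Fin D × Fin T) = D * T := by simp
  have hnr0 : 0 < ((D * T : ℕ) : ℝ) := by push_cast; positivity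
  generalize D * T = n at *
  generalize S * q = Z at *
  obtain ⟨E₁, hE₁⟩ : ∃ E₁ : ℝ, E₁ = D * (2 * Lg) + T * (((T + R : ℕ) : ℝ) * h) + T * (S * a) :=
    ⟨_, rfl⟩
  rw [← hE₁] at hconj hneg
  have hLg0 : 0 ≤ Lg := by linarith
  have hE₁0 : 0 ≤ E₁ := by rw [hE₁]; positivity
  have hfact : ((n.factorial : ℕ) : ℝ) ≤ Real.exp (n * Lg) := by
    rw [Real.exp_nat_mul, hexpLg]
    calc ((n.factorial : ℕ) : ℝ) ≤ (n : ℝ) ^ n := by exact_mod_cast Nat.factorial_le_pow n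
      _ ≤ _ := by gcongr
  have hliou := one_le_abs_mul_pow_of_isIntegral ι (d := 3) hd hinteg hE0
    (Real.one_le_exp (by positivity)) hconj
  have hprod : |ι (∏ i : Fin D × Fin T, (A₁ ^ S) ^ (i.2 : ℕ))| ≤ Real.exp (n * (T * (S * a))) := by
    rw [map_prod, Finset.abs_prod, Real.exp_nat_mul, ← hcard, ← Finset.card_univ,
      ← Finset.prod_const]
    refine Finset.prod_le_prod (fun _ _ => abs_nonneg _) fun i _ => ?_
    have hιA : ι A₁ ≤ Real.exp a := by
      have := hA₁h (Complex.ofRealHom.comp ι)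
      simp only [RingHom.coe_comp, Function.comp_apply, Complex.ofRealHom_eq_coe,
        Complex.norm_real, Real.norm_eq_abs] at this
      exact (le_abs_self _).trans this
    rw [map_pow, map_pow, abs_of_pos (by positivity)]
    calc _ ≤ (Real.exp a ^ S) ^ (i.2 : ℕ) := by gcongr
      _ ≤ (Real.exp a ^ S) ^ T := pow_le_pow_right₀
          (one_le_pow₀ (Real.one_le_exp (by linarith))) i.2.2.le
      _ = _ := by rw [Real.exp_nat_mul, Real.exp_nat_mul]
  have hupper : |ι E| ≤ Real.exp (n * (T * (S * a)) + (n * Lg + (n * (1 + (D * (2 * Lg) +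
      (D + 6 * (3 * n / 1000)))) + -(n * (n - 1) / 2)))) := by
    rw [hE, map_mul, abs_mul]
    refine (mul_le_mul hprod hreal (abs_nonneg _) (Real.exp_pos _).le).trans ?_
    have h2e : (2 : ℝ) ≤ Real.exp 1 := by
      have := Real.add_one_le_exp (1 : ℝ)
      linarith
    have hexp : Real.exp (n * (T * (S * a)) + (n * Lg + (n * (1 + (D * (2 * Lg) +
        (D + 6 * (3 * n / 1000)))) + -(n * (n - 1) / 2)))) = Real.exp (n * (T * (S * a))) *
        (Real.exp (n * Lg) * ((Real.exp 1 * (Real.exp (2 * Lg) ^ D *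
          Real.exp (D + 6 * (3 * n / 1000)))) ^ n * Real.exp (-(n * (n - 1) / 2)))) := by
      rw [Real.exp_add, Real.exp_add, Real.exp_add, Real.exp_nat_mul (1 + _) n, Real.exp_add 1,
        Real.exp_add (D * (2 * Lg)), Real.exp_nat_mul _ D]
    rw [hexp]
    have hZe : 2 * (Z : ℝ) ≤ Real.exp (2 * Lg) := by linarith [Nat.cast_nonneg (α := ℝ) Z]
    gcongr
  have hfinal : (1 : ℝ) ≤ Real.exp ((n * (T * (S * a)) + (n * Lg + (n * (1 + (D * (2 * Lg) +
      (D + 6 * (3 * n / 1000)))) + -(n * (n - 1) / 2)))) + (3 : ℕ) * (n * Lg + n * E₁)) := by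
    rw [Real.exp_add, Real.exp_nat_mul _ 3]
    exact hliou.trans (by gcongr)
  rw [Real.one_le_exp_iff] at hfinal
  have hfac : (n * (T * (S * a)) + (n * Lg + (n * (1 + (D * (2 * Lg) +
      (D + 6 * (3 * n / 1000)))) + -(n * (n - 1) / 2)))) + (3 : ℕ) * (n * Lg + n * E₁) =
      n * (T * (S * a) + 4 * Lg + 1 + D * (2 * Lg) + D + 18 * n / 1000 - (n - 1) / 2 + 3 * E₁) := by
    push_cast
    ring
  rw [hfac] at hfinal
  exact absurd hfinal (not_le.2 (mul_neg_of_pos_of_neg hnr0 hneg))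

theorem isIntegral_zpow {K : Type*} [Field K] {x : K} (hx : IsIntegral ℤ x)
    (hx' : IsIntegral ℤ x⁻¹) (s : ℤ) : IsIntegral ℤ (x ^ s) := by
  obtain ⟨n, rfl | rfl⟩ := s.eq_nat_or_neg
  · rw [zpow_natCast]
    exact hx.pow n
  · rw [zpow_neg, zpow_natCast, ← inv_pow]
    exact hx'.pow n

theorem norm_map_zpow_le {K : Type*} [Field K] (φ : K →+* ℂ) {x : K} {h : ℝ}
    (hx : ‖φ x‖ ≤ Real.exp h) (hx' : ‖φ x⁻¹‖ ≤ Real.exp h) (s : ℤ) :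
    ‖φ (x ^ s)‖ ≤ Real.exp (|(s : ℝ)| * h) := by
  obtain ⟨n, rfl | rfl⟩ := s.eq_nat_or_neg
  · rw [zpow_natCast, map_pow, norm_pow, Int.cast_natCast, Nat.abs_cast, Real.exp_nat_mul]
    gcongr
  · rw [zpow_neg, zpow_natCast, ← inv_pow, map_pow, norm_pow, Int.cast_neg, abs_neg,
      Int.cast_natCast, Nat.abs_cast, Real.exp_nat_mul]
    gcongr

/-- Dirichlet approximation step: sizes of the parameters of a linear form in two logarithms. -/
theorem exists_dirichlet_parameters {h₁ h₂ g H ℓ : ℝ} (hh₁0 : 1 / 2 ≤ h₁) (hh₂0 : 1 / 2 ≤ h₂)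
    (hhH : h₁ ≤ H) (hh₂₁ : h₂ ≤ h₁) (hg : 0 ≤ g) {b₁ b₂ T P : ℕ} (hℓ0 : 0 < ℓ)
    (hb₁ : ℓ / 5 ≤ b₁ * h₁) (hb₁' : b₁ * h₁ ≤ ℓ / 2) (hb₂' : b₂ * h₂ ≤ ℓ / 2) (hb₁0 : (0 : ℝ) < b₁)
    (hTr : (1 : ℝ) ≤ T) (hPr : (1 : ℝ) ≤ P) (hP : 8 * 10 ^ 7 * (T : ℝ) ^ 3 * H ≤ P)
    (hPℓ : 10 ^ 7 * (T : ℝ) ^ 3 * (7 * (P * H) * (2 * g + 7 * (P * H))) ≤ ℓ / 2) :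
    ∃ (p₁ p₂ q s₁ : ℕ) (s₂ : ℤ) (h a : ℝ), 1 ≤ p₁ ∧ (b₁ : ℝ) = p₁ * q + s₁ ∧
      (s₂ : ℝ) = b₂ - q * p₂ ∧ p₁ * h₁ + p₂ * h₂ ≤ h ∧ 2 * g + s₁ * h₁ + |(s₂ : ℝ)| * h₂ ≤ a ∧
      1 ≤ h ∧ 1 ≤ a ∧ 10 ^ 7 * (T : ℝ) ^ 3 * (h * a) ≤ ℓ ∧ 10 ^ 4 * T * a ≤ q ∧ (q : ℝ) ≤ ℓ := by
  have hP1 : 1 ≤ P := by exact_mod_cast hPr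
  have hH0 : 0 < H := by linarith
  obtain ⟨j, k, hk0, hkP, hjk⟩ := Real.exists_int_int_abs_mul_sub_le ((b₂ : ℝ) / b₁) hP1
  obtain ⟨p₁, rfl⟩ : ∃ p₁ : ℕ, k = p₁ := ⟨k.toNat, by omega⟩
  have hP1' : 1 / ((P : ℝ) + 1) ≤ 1 / P := by gcongr; linarith
  have hP1'' : 1 / ((P : ℝ) + 1) < 1 := by rw [div_lt_one (by linarith)]; linarith
  have hj0 : 0 ≤ j := by
    by_contra hcon
    have h1 : (j : ℝ) ≤ -1 := by exact_mod_cast (show j ≤ -1 by omega)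
    have h2 : (0 : ℝ) ≤ ((p₁ : ℤ) : ℝ) * (b₂ / b₁) := by positivity
    have h3 := le_abs_self (((p₁ : ℤ) : ℝ) * ((b₂ : ℝ) / b₁) - j)
    linarith
  obtain ⟨p₂, rfl⟩ : ∃ p₂ : ℕ, j = p₂ := ⟨j.toNat, by omega⟩
  simp only [Int.cast_natCast] at hjk
  have hp1 : 1 ≤ p₁ := by omega
  have hp1r : (1 : ℝ) ≤ p₁ := by exact_mod_cast hp1
  have hpP : (p₁ : ℝ) ≤ P := by exact_mod_cast hkP
  obtain ⟨q, hq⟩ : ∃ q, q = b₁ / p₁ := ⟨_, rfl⟩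
  obtain ⟨s₁, hs₁⟩ : ∃ s₁, s₁ = b₁ % p₁ := ⟨_, rfl⟩
  have hb₁q : b₁ = p₁ * q + s₁ := by rw [hq, hs₁, Nat.div_add_mod]
  have hs₁p : s₁ < p₁ := by rw [hs₁]; exact Nat.mod_lt _ hp1
  obtain ⟨s₂, hs₂⟩ : ∃ s₂ : ℤ, s₂ = b₂ - q * p₂ := ⟨_, rfl⟩
  have hb₁qr : (b₁ : ℝ) = p₁ * q + s₁ := by exact_mod_cast hb₁q
  have hs₁r : (s₁ : ℝ) ≤ p₁ := by exact_mod_cast hs₁p.le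
  have hs₂r : (s₂ : ℝ) = b₂ - q * p₂ := by rw [hs₂]; push_cast; ring
  have hh₁00 : 0 < h₁ := by linarith
  have hh₂00 : 0 < h₂ := by linarith
  -- size of `p₂`
  have hp₂ : p₂ * h₂ ≤ 7 / 2 * (p₁ * h₁) := by
    have h1 : (p₂ : ℝ) ≤ p₁ * (b₂ / b₁) + 1 := by
      have := neg_abs_le ((p₁ : ℝ) * ((b₂ : ℝ) / b₁) - p₂)
      linarith
    have h2 : (b₂ : ℝ) / b₁ * h₂ ≤ 5 / 2 * h₁ := by
      rw [div_mul_eq_mul_div, div_le_iff₀ hb₁0]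
      linarith
    calc p₂ * h₂ ≤ (p₁ * (b₂ / b₁) + 1) * h₂ := by gcongr
      _ = p₁ * (b₂ / b₁ * h₂) + h₂ := by ring
      _ ≤ p₁ * (5 / 2 * h₁) + p₁ * h₁ := by
        gcongr
        exact hh₂₁.trans (le_mul_of_one_le_left hh₁00.le hp1r)
      _ = _ := by ring
  have hs₂' : |(s₂ : ℝ)| * h₂ ≤ 7 / 2 * (p₁ * h₁) + ℓ / (2 * p₁ * P) := by
    have h1 : p₁ * (s₂ : ℝ) = b₁ * (p₁ * (b₂ / b₁) - p₂) + s₁ * p₂ := by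
      rw [hs₂r]
      field_simp
      rw [hb₁qr]
      ring
    have h2 : p₁ * |(s₂ : ℝ)| ≤ b₁ * (1 / P) + p₁ * p₂ := by
      rw [← abs_of_nonneg (Nat.cast_nonneg (α := ℝ) p₁), ← abs_mul, h1,
        abs_of_nonneg (Nat.cast_nonneg (α := ℝ) p₁)]
      refine (abs_add_le _ _).trans ?_
      rw [abs_mul, abs_mul, Nat.abs_cast, Nat.abs_cast, Nat.abs_cast]
      gcongr
      linarith
    have h3 : |(s₂ : ℝ)| ≤ b₁ / (p₁ * P) + p₂ := by
      have : b₁ / (p₁ * P) + p₂ = (b₁ * (1 / P) + p₁ * p₂) / (p₁ : ℝ) := by field_simp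
      rw [this, le_div_iff₀ (by linarith)]
      linarith
    calc |(s₂ : ℝ)| * h₂ ≤ (b₁ / (p₁ * P) + p₂) * h₂ := by gcongr
      _ = (b₁ * h₂) / (p₁ * P) + p₂ * h₂ := by ring
      _ ≤ (ℓ / 2) / (p₁ * P) + 7 / 2 * (p₁ * h₁) := by
        gcongr
        exact (mul_le_mul_of_nonneg_left hh₂₁ hb₁0.le).trans hb₁'
      _ = _ := by field_simp; ring
  have hs₁' : s₁ * h₁ ≤ p₁ * h₁ := by gcongr
  obtain ⟨h, hh⟩ : ∃ h, h = 7 * (p₁ * h₁) := ⟨_, rfl⟩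
  obtain ⟨a, ha⟩ : ∃ a, a = 2 * g + 7 * (p₁ * h₁) + ℓ / (2 * p₁ * P) := ⟨_, rfl⟩
  have hph : 1 / 2 ≤ p₁ * h₁ := hh₁0.trans (le_mul_of_one_le_left hh₁00.le hp1r)
  have hfrac : 0 ≤ ℓ / (2 * p₁ * P) := by positivity
  have hh1 : 1 ≤ h := by linarith
  have ha1 : 1 ≤ a := by linarith
  have hha : 10 ^ 7 * (T : ℝ) ^ 3 * (h * a) ≤ ℓ := by
    have h1 : h * a = 7 * (p₁ * h₁) * (2 * g + 7 * (p₁ * h₁)) + 7 / 2 * (h₁ * ℓ / P) := by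
      rw [hh, ha]
      field_simp
    have h2 : p₁ * h₁ ≤ P * H := by gcongr
    have h3 : h * a ≤ 7 * (P * H) * (2 * g + 7 * (P * H)) + 4 * (H * ℓ / P) := by
      rw [h1]
      gcongr
      norm_num
    have h4 : 10 ^ 7 * (T : ℝ) ^ 3 * (4 * (H * ℓ / P)) ≤ ℓ / 2 := by
      have : 10 ^ 7 * (T : ℝ) ^ 3 * (4 * (H * ℓ / P)) =
        (8 * 10 ^ 7 * (T : ℝ) ^ 3 * H) * (ℓ / 2) / P := by ring
      rw [this, div_le_iff₀ (by linarith), mul_comm (ℓ / 2)]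
      gcongr
    calc _ ≤ 10 ^ 7 * (T : ℝ) ^ 3 * (7 * (P * H) * (2 * g + 7 * (P * H)) + 4 * (H * ℓ / P)) := by
          gcongr
      _ ≤ ℓ := by linarith
  have hhℓ : h ≤ ℓ := by
    have : (1 : ℝ) * (h * 1) ≤ 10 ^ 7 * (T : ℝ) ^ 3 * (h * a) := by
      gcongr
      linarith [one_le_pow₀ hTr (n := 3)]
    linarith
  have hq1 : 7 / 5 * ℓ ≤ (q + 1) * h := by
    have : b₁ * h₁ ≤ (q + 1) * (p₁ * h₁) := by
      calc b₁ * h₁ ≤ (p₁ * q + p₁) * h₁ := by rw [hb₁qr]; gcongr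
        _ = _ := by ring
    rw [hh]
    linarith
  have hTq : 10 ^ 4 * T * a ≤ q := by
    have h1 : 10 ^ 7 * (T : ℝ) * (h * a) ≤ ℓ := by
      refine le_trans ?_ hha
      gcongr
      exact le_self_pow₀ hTr (by norm_num)
    have h2 : (10 ^ 4 * T * a) * h ≤ q * h := by linarith
    exact le_of_mul_le_mul_right h2 (by linarith)
  have hqℓ : (q : ℝ) ≤ ℓ := by
    have : (q : ℝ) ≤ b₁ := by exact_mod_cast hq ▸ Nat.div_le_self _ _
    have h2 : (b₁ : ℝ) * (1 / 2) ≤ b₁ * h₁ := by gcongr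
    linarith
  exact ⟨p₁, p₂, q, s₁, s₂, h, a, hp1, hb₁qr, hs₂r, by linarith, by linarith, hh1, ha1, hha, hTq,
    hqℓ⟩

/-- A linear form in three logarithms, two of them logarithms of multiplicatively independent units,
cannot be extremely small: Dirichlet approximation reduces to two logarithms. -/
theorem false_of_three_logs {K : Type*} [Field K] [NumberField K] (ι : K →+* ℝ)
    (hd : Module.finrank ℚ K ≤ 4) {η₁ η₂ M₁ M₂ : K}
    (hη₁i : IsIntegral ℤ η₁) (hη₁i' : IsIntegral ℤ η₁⁻¹) (hη₂i : IsIntegral ℤ η₂)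
    (hη₂i' : IsIntegral ℤ η₂⁻¹) (hM₁i : IsIntegral ℤ M₁) (hM₂i : IsIntegral ℤ M₂)
    (hη₁0 : 0 < ι η₁) (hη₂0 : 0 < ι η₂) (hM₁1 : 1 ≤ ι M₁) (hM₂1 : 1 ≤ ι M₂)
    (hind : ∀ p₁ p₂ : ℕ, 1 ≤ p₁ → ι η₁ ^ p₁ ≠ ι η₂ ^ p₂) {h₁ h₂ g H ℓ : ℝ}
    (hh₁ : h₁ = Real.log (ι η₁)) (hh₂ : h₂ = Real.log (ι η₂))
    (hη₁h : ∀ φ : K →+* ℂ, ‖φ η₁‖ ≤ Real.exp h₁) (hη₁h' : ∀ φ : K →+* ℂ, ‖φ η₁⁻¹‖ ≤ Real.exp h₁)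
    (hη₂h : ∀ φ : K →+* ℂ, ‖φ η₂‖ ≤ Real.exp h₂) (hη₂h' : ∀ φ : K →+* ℂ, ‖φ η₂⁻¹‖ ≤ Real.exp h₂)
    (hM₁h : ∀ φ : K →+* ℂ, ‖φ M₁‖ ≤ Real.exp (2 * g))
    (hM₂h : ∀ φ : K →+* ℂ, ‖φ M₂‖ ≤ Real.exp (2 * g))
    (hh₁0 : 1 / 2 ≤ h₁) (hh₂0 : 1 / 2 ≤ h₂) (hhH : h₁ ≤ H) (hh₂₁ : h₂ ≤ h₁) {b₁ b₂ T P : ℕ}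
    (hb₁ : ℓ / 5 ≤ b₁ * h₁) (hb₁' : b₁ * h₁ ≤ ℓ / 2) (hb₂' : b₂ * h₂ ≤ ℓ / 2)
    (hΛ : |b₁ * h₁ + Real.log (ι M₁) - b₂ * h₂ - Real.log (ι M₂)| ≤ Real.exp (-(ℓ / 3)))
    (hT1 : 1 ≤ T) (hT : 300 * Real.log ℓ ≤ T) (hP : 8 * 10 ^ 7 * (T : ℝ) ^ 3 * H ≤ P)
    (hPℓ : 10 ^ 7 * (T : ℝ) ^ 3 * (7 * (P * H) * (2 * g + 7 * (P * H))) ≤ ℓ / 2) : False := by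
  have hTr : (1 : ℝ) ≤ T := by exact_mod_cast hT1
  have hT3 : (1 : ℝ) ≤ (T : ℝ) ^ 3 := one_le_pow₀ hTr
  have hH : 1 / 2 ≤ H := hh₁0.trans hhH
  have hPr : (1 : ℝ) ≤ P := by nlinarith
  have hMlog : |Real.log (ι M₁) - Real.log (ι M₂)| ≤ 2 * g := by
    have key : ∀ M : K, 1 ≤ ι M → (∀ φ : K →+* ℂ, ‖φ M‖ ≤ Real.exp (2 * g)) →
        0 ≤ Real.log (ι M) ∧ Real.log (ι M) ≤ 2 * g := by
      intro M hM hφ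
      refine ⟨Real.log_nonneg hM, (Real.log_le_iff_le_exp (by linarith)).2 ?_⟩
      have := hφ (Complex.ofRealHom.comp ι)
      simp only [RingHom.coe_comp, Function.comp_apply, Complex.ofRealHom_eq_coe,
        Complex.norm_real, Real.norm_eq_abs] at this
      exact (le_abs_self _).trans this
    have h1 := key _ hM₁1 hM₁h
    have h2 := key _ hM₂1 hM₂h
    rw [abs_le]
    constructor <;> linarith [h1.1, h1.2, h2.1, h2.2]
  have hg : 0 ≤ g := by linarith [abs_nonneg (Real.log (ι M₁) - Real.log (ι M₂))]
  have hℓ0 : 0 < ℓ := by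
    have : 0 < 10 ^ 7 * (T : ℝ) ^ 3 * (7 * (P * H) * (2 * g + 7 * (P * H))) := by positivity
    linarith
  have hb₁0 : (0 : ℝ) < b₁ := by
    by_contra hcon
    have : (b₁ : ℝ) = 0 := le_antisymm (not_lt.1 hcon) (Nat.cast_nonneg _)
    rw [this] at hb₁
    linarith
  obtain ⟨p₁, p₂, q, s₁, s₂, h, a, hp1, hb₁qr, hs₂r, hh, ha, hh1, ha1, hha, hTq, hqℓ⟩ :=
    exists_dirichlet_parameters hh₁0 hh₂0 hhH hh₂₁ hg hℓ0 hb₁ hb₁' hb₂' hb₁0 hTr hPr hP hPℓ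
  have hh₁00 : 0 < h₁ := by linarith
  have hh₂00 : 0 < h₂ := by linarith
  have hsh₁ : 0 ≤ s₁ * h₁ := by positivity
  have hsh₂ : 0 ≤ |(s₂ : ℝ)| * h₂ := by positivity
  have hη₁ne : η₁ ≠ 0 := by rintro rfl; simp at hη₁0
  have hη₂ne : η₂ ≠ 0 := by rintro rfl; simp at hη₂0
  have hιz : ∀ (x : K) (s : ℤ), ι (x ^ s) = ι x ^ s := fun x s => map_zpow₀ ι x s
  refine false_of_two_logs ι hd (β := η₁ ^ (p₁ : ℤ) * η₂ ^ (-(p₂ : ℤ)))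
    (A₁ := M₁ * η₁ ^ (s₁ : ℤ) * η₂ ^ (-s₂)) (A₂ := M₂) (h := h) (a := a) (ℓ := ℓ) (q := q) (T := T)
    ((isIntegral_zpow hη₁i hη₁i' _).mul (isIntegral_zpow hη₂i hη₂i' _))
    ((hM₁i.mul (isIntegral_zpow hη₁i hη₁i' _)).mul (isIntegral_zpow hη₂i hη₂i' _)) hM₂i
    ?_ ?_ (by linarith) ?_ hh1 ha1 hT1 ?_ ?_ ?_ ?_ ?_ hT hha hTq hqℓ
  · rw [map_mul, hιz, hιz]; positivity
  · rw [map_mul, map_mul, hιz, hιz]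
    have : 0 < ι M₁ := by linarith
    positivity
  · rw [map_mul, hιz, hιz, zpow_neg, zpow_natCast, zpow_natCast, ← div_eq_mul_inv]
    intro hcon
    exact hind p₁ p₂ hp1 ((div_eq_one_iff_eq (by positivity)).1 hcon)
  · intro φ
    rw [map_mul, norm_mul]
    calc _ ≤ Real.exp (|((p₁ : ℤ) : ℝ)| * h₁) * Real.exp (|((-(p₂ : ℤ) : ℤ) : ℝ)| * h₂) := by
          gcongr
          · exact norm_map_zpow_le φ (hη₁h φ) (hη₁h' φ) _
          · exact norm_map_zpow_le φ (hη₂h φ) (hη₂h' φ) _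
      _ ≤ _ := by
        rw [← Real.exp_add, Real.exp_le_exp]
        simp only [Int.cast_neg, Int.cast_natCast, abs_neg, Nat.abs_cast]
        linarith
  · intro φ
    rw [map_mul, norm_mul, map_mul, norm_mul]
    calc _ ≤ Real.exp (2 * g) * Real.exp (|((s₁ : ℤ) : ℝ)| * h₁) *
          Real.exp (|((-s₂ : ℤ) : ℝ)| * h₂) := by
          gcongr
          · exact hM₁h φ
          · exact norm_map_zpow_le φ (hη₁h φ) (hη₁h' φ) _
          · exact norm_map_zpow_le φ (hη₂h φ) (hη₂h' φ) _
      _ ≤ _ := by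
        rw [← Real.exp_add, ← Real.exp_add, Real.exp_le_exp]
        simp only [Int.cast_neg, Int.cast_natCast, abs_neg, Nat.abs_cast]
        linarith
  · intro φ
    refine (hM₂h φ).trans (Real.exp_le_exp.2 ?_)
    linarith
  all_goals
    have hlogA : Real.log (ι (M₁ * η₁ ^ (s₁ : ℤ) * η₂ ^ (-s₂))) =
        Real.log (ι M₁) + s₁ * h₁ - s₂ * h₂ := by
      have : 0 < ι M₁ := by linarith
      rw [map_mul, map_mul, hιz, hιz, Real.log_mul (by positivity) (by positivity),
        Real.log_mul (by positivity) (by positivity), Real.log_zpow, Real.log_zpow, hh₁, hh₂]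
      push_cast
      ring
  · rw [hlogA]
    have h1 := abs_le.1 hMlog
    have h2 : |s₂ * h₂| ≤ |(s₂ : ℝ)| * h₂ := by rw [abs_mul, abs_of_pos hh₂00]
    have h3 := abs_le.1 h2
    rw [abs_le]
    constructor <;> linarith [h1.1, h1.2, h3.1, h3.2]
  · rw [hlogA, map_mul, hιz, hιz, Real.log_mul (by positivity) (by positivity), Real.log_zpow,
      Real.log_zpow, ← hh₁, ← hh₂]
    convert hΛ using 2
    rw [hs₂r, hb₁qr]
    push_cast
    ring

open IntermediateField in
/-- The real biquadratic field generated by two square roots. -/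
theorem exists_numberField_sqrt_sqrt (a b : ℕ) :
    ∃ (K : Type) (_ : Field K) (_ : NumberField K) (ι : K →+* ℝ) (r s : K),
      Module.finrank ℚ K ≤ 4 ∧ r ^ 2 = a ∧ s ^ 2 = b ∧ ι r = √a ∧ ι s = √b := by
  have hpoly : ∀ n : ℕ, IsIntegral ℚ (√(n : ℝ)) ∧ Module.finrank ℚ ℚ⟮√(n : ℝ)⟯ ≤ 2 := by
    intro n
    have hmonic : (Polynomial.X ^ 2 - Polynomial.C (n : ℚ)).Monic :=
      Polynomial.monic_X_pow_sub_C _ two_ne_zero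
    have hroot : Polynomial.aeval (√(n : ℝ)) (Polynomial.X ^ 2 - Polynomial.C (n : ℚ)) = 0 := by
      simp
    have hi : IsIntegral ℚ (√(n : ℝ)) := ⟨_, hmonic, by rwa [← Polynomial.aeval_def]⟩
    refine ⟨hi, ?_⟩
    rw [adjoin.finrank hi]
    refine (Polynomial.natDegree_le_natDegree (minpoly.min ℚ _ hmonic hroot)).trans ?_
    rw [Polynomial.natDegree_X_pow_sub_C]
  let L : IntermediateField ℚ ℝ := ℚ⟮√(a : ℝ)⟯ ⊔ ℚ⟮√(b : ℝ)⟯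
  have := adjoin.finiteDimensional (hpoly a).1
  have := adjoin.finiteDimensional (hpoly b).1
  have : FiniteDimensional ℚ L := finiteDimensional_sup _ _
  have hr : √(a : ℝ) ∈ L := le_sup_left (a := ℚ⟮√(a : ℝ)⟯) (mem_adjoin_simple_self ℚ _)
  have hs : √(b : ℝ) ∈ L := le_sup_right (a := ℚ⟮√(a : ℝ)⟯) (mem_adjoin_simple_self ℚ _)
  refine ⟨L, inferInstance, ⟨⟩, L.val.toRingHom, ⟨_, hr⟩, ⟨_, hs⟩, ?_, ?_, ?_, rfl, rfl⟩
  · refine (finrank_sup_le _ _).trans ?_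
    exact (Nat.mul_le_mul (hpoly a).2 (hpoly b).2)
  · apply Subtype.ext
    push_cast
    exact Real.sq_sqrt (Nat.cast_nonneg _)
  · apply Subtype.ext
    push_cast
    exact Real.sq_sqrt (Nat.cast_nonneg _)

theorem norm_map_add_mul_le {K : Type*} [Field K] (φ : K →+* ℂ) {r : K} {D : ℕ} (hr : r ^ 2 = D)
    (m m' : ℤ) {B : ℝ} (h1 : |m + m' * √D| ≤ B) (h2 : |m - m' * √D| ≤ B) :
    ‖φ (m + m' * r)‖ ≤ B := by
  have hsq : (φ r) ^ 2 = ((√D : ℝ) : ℂ) ^ 2 := by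
    rw [← map_pow, hr, map_natCast, ← Complex.ofReal_pow, Real.sq_sqrt (Nat.cast_nonneg _)]
    simp
  rw [map_add, map_mul, map_intCast, map_intCast]
  rcases sq_eq_sq_iff_eq_or_eq_neg.1 hsq with h | h
  · rw [h]
    have : ((m : ℂ) + m' * ((√D : ℝ) : ℂ)) = ((m + m' * √D : ℝ) : ℂ) := by push_cast; ring
    rwa [this, Complex.norm_real]
  · rw [h]
    have : ((m : ℂ) + m' * -((√D : ℝ) : ℂ)) = ((m - m' * √D : ℝ) : ℂ) := by push_cast; ring
    rwa [this, Complex.norm_real]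

theorem exists_pow_eq_add_mul_sqrt {D u v : ℕ} (hu : 1 ≤ u) (hv : 1 ≤ v) (p : ℕ) :
    ∃ U V : ℕ, ((u : ℝ) + v * √D) ^ p = U + V * √D ∧ 1 ≤ U ∧ (1 ≤ p → 1 ≤ V) := by
  induction p with
  | zero => exact ⟨1, 0, by simp, le_rfl, by simp⟩
  | succ p ih =>
    obtain ⟨U, V, h, hU, -⟩ := ih
    refine ⟨U * u + V * v * D, U * v + V * u, ?_, ?_, fun _ => ?_⟩
    · rw [pow_succ, h]
      push_cast
      have := Real.mul_self_sqrt (Nat.cast_nonneg (α := ℝ) D)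
      linear_combination (V : ℝ) * v * this
    · have := Nat.mul_le_mul hU hu
      omega
    · have := Nat.mul_le_mul hU hv
      omega

theorem add_mul_sqrt_pow_ne {D₁ D₂ u₁ v₁ u₂ v₂ : ℕ} (hD₁ : ¬ IsSquare D₁) (hD₂ : ¬ IsSquare D₂)
    (hD : ¬ IsSquare (D₁ * D₂)) (hu₁ : 1 ≤ u₁) (hv₁ : 1 ≤ v₁) (hu₂ : 1 ≤ u₂) (hv₂ : 1 ≤ v₂)
    (p₁ p₂ : ℕ) (hp : 1 ≤ p₁) :
    ((u₁ : ℝ) + v₁ * √D₁) ^ p₁ ≠ ((u₂ : ℝ) + v₂ * √D₂) ^ p₂ := by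
  obtain ⟨U, V, h, -, hV⟩ := exists_pow_eq_add_mul_sqrt (D := D₁) hu₁ hv₁ p₁
  obtain ⟨U', V', h', -, -⟩ := exists_pow_eq_add_mul_sqrt (D := D₂) hu₂ hv₂ p₂
  rw [h, h']
  intro heq
  have hV0 : (V : ℝ) ≠ 0 := by
    have := hV hp
    positivity
  have i1 : Irrational √(D₁ : ℝ) := irrational_sqrt_natCast_iff.2 hD₁
  have i2 : Irrational √(D₂ : ℝ) := irrational_sqrt_natCast_iff.2 hD₂
  have i3 : Irrational √((D₁ * D₂ : ℕ) : ℝ) := irrational_sqrt_natCast_iff.2 hD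
  have s1 := Real.mul_self_sqrt (Nat.cast_nonneg (α := ℝ) D₁)
  have s2 := Real.mul_self_sqrt (Nat.cast_nonneg (α := ℝ) D₂)
  by_cases hV' : V' = 0
  · refine i1 ⟨((U' : ℚ) - U) / V, ?_⟩
    rw [hV'] at heq
    push_cast
    rw [div_eq_iff hV0]
    push_cast at heq
    linarith
  have hV'0 : (V' : ℝ) ≠ 0 := by exact_mod_cast hV'
  by_cases hU : U = U'
  · refine i3 ⟨(V' : ℚ) * D₂ / V, ?_⟩
    push_cast
    rw [Real.sqrt_mul (Nat.cast_nonneg _), div_eq_iff hV0]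
    rw [hU] at heq
    have h5 : (V : ℝ) * √D₁ = V' * √D₂ := by linarith
    linear_combination -(√(D₂ : ℝ) * h5) - V' * s2
  · have hUr : ((U' : ℝ) - U) ≠ 0 := sub_ne_zero.2 (by exact_mod_cast (Ne.symm hU))
    refine i2 ⟨((V : ℚ) ^ 2 * D₁ - ((U' : ℚ) - U) ^ 2 - (V' : ℚ) ^ 2 * D₂) / (2 * (U' - U) * V'), ?_⟩
    push_cast
    rw [div_eq_iff (by positivity)]
    have h5 : (V : ℝ) * √D₁ = (U' - U) + V' * √D₂ := by linarith
    linear_combination (V * √D₁ + ((U' - U) + V' * √D₂)) * h5 - V ^ 2 * s1 + V' ^ 2 * s2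

theorem half_le_log_add_mul_sqrt {D u v : ℕ} (hD : 1 ≤ D) (hu : 1 ≤ u) (hv : 1 ≤ v) :
    1 / 2 ≤ Real.log (u + v * √D) := by
  have h1 : (1 : ℝ) ≤ √D := Real.one_le_sqrt.2 (by exact_mod_cast hD)
  have hu' : (1 : ℝ) ≤ u := by exact_mod_cast hu
  have hv' : (1 : ℝ) ≤ v := by exact_mod_cast hv
  have h2 : (2 : ℝ) ≤ u + v * √D := by nlinarith
  have := Real.log_le_log (by norm_num) h2
  linarith [Real.log_two_gt_d9]

/-- No extremely small linear forms in logarithms coming from two independent Pell equations. -/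
theorem false_of_pell_logs {D₁ D₂ u₁ v₁ u₂ v₂ : ℕ} (hD₁ : ¬ IsSquare D₁) (hD₂ : ¬ IsSquare D₂)
    (hD : ¬ IsSquare (D₁ * D₂)) (hu₁ : 1 ≤ u₁) (hv₁ : 1 ≤ v₁) (hu₂ : 1 ≤ u₂) (hv₂ : 1 ≤ v₂)
    (hp₁ : u₁ ^ 2 = D₁ * v₁ ^ 2 + 1) (hp₂ : u₂ ^ 2 = D₂ * v₂ ^ 2 + 1) {m₁ m₁' m₂ m₂' : ℤ}
    {g H ℓ : ℝ} (hM₁ : 1 ≤ m₁ + m₁' * √D₁) (hM₂ : 1 ≤ m₂ + m₂' * √D₂)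
    (hM₁g : |m₁ + m₁' * √D₁| ≤ Real.exp (2 * g)) (hM₁g' : |m₁ - m₁' * √D₁| ≤ Real.exp (2 * g))
    (hM₂g : |m₂ + m₂' * √D₂| ≤ Real.exp (2 * g)) (hM₂g' : |m₂ - m₂' * √D₂| ≤ Real.exp (2 * g))
    (hH₁ : Real.log (u₁ + v₁ * √D₁) ≤ H) (hH₂ : Real.log (u₂ + v₂ * √D₂) ≤ H) {b₁ b₂ T P : ℕ}
    (hb₁ : ℓ / 5 ≤ b₁ * Real.log (u₁ + v₁ * √D₁)) (hb₁' : b₁ * Real.log (u₁ + v₁ * √D₁) ≤ ℓ / 2)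
    (hb₂ : ℓ / 5 ≤ b₂ * Real.log (u₂ + v₂ * √D₂)) (hb₂' : b₂ * Real.log (u₂ + v₂ * √D₂) ≤ ℓ / 2)
    (hΛ : |b₁ * Real.log (u₁ + v₁ * √D₁) + Real.log (m₁ + m₁' * √D₁) -
      b₂ * Real.log (u₂ + v₂ * √D₂) - Real.log (m₂ + m₂' * √D₂)| ≤ Real.exp (-(ℓ / 3)))
    (hT1 : 1 ≤ T) (hT : 300 * Real.log ℓ ≤ T) (hP : 8 * 10 ^ 7 * (T : ℝ) ^ 3 * H ≤ P)
    (hPℓ : 10 ^ 7 * (T : ℝ) ^ 3 * (7 * (P * H) * (2 * g + 7 * (P * H))) ≤ ℓ / 2) : False := by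
  wlog hle : Real.log (u₂ + v₂ * √D₂) ≤ Real.log (u₁ + v₁ * √D₁) generalizing D₁ D₂ u₁ v₁ u₂ v₂
    m₁ m₁' m₂ m₂' b₁ b₂
  · refine this hD₂ hD₁ (by rwa [mul_comm]) hu₂ hv₂ hu₁ hv₁ hp₂ hp₁ hM₂ hM₁ hM₂g hM₂g' hM₁g hM₁g' hH₂
      hH₁ hb₂ hb₂' hb₁ hb₁' ?_ (le_of_not_ge hle)
    rw [← abs_neg]
    convert hΛ using 2
    ring
  have hD₁1 : 1 ≤ D₁ := Nat.one_le_iff_ne_zero.2 (by rintro rfl; exact hD₁ (IsSquare.zero))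
  have hD₂1 : 1 ≤ D₂ := Nat.one_le_iff_ne_zero.2 (by rintro rfl; exact hD₂ (IsSquare.zero))
  have hh₁ := half_le_log_add_mul_sqrt hD₁1 hu₁ hv₁
  have hh₂ := half_le_log_add_mul_sqrt hD₂1 hu₂ hv₂
  obtain ⟨K, _, _, ι, r, s, hd, hr, hs, hιr, hιs⟩ := exists_numberField_sqrt_sqrt D₁ D₂
  have hinteg : ∀ (x : K) (D : ℕ), x ^ 2 = D → ∀ m m' : ℤ, IsIntegral ℤ ((m : K) + m' * x) := by
    intro x D hx m m'
    have hc : ∀ k : ℤ, IsIntegral ℤ (k : K) := fun k => isIntegral_algebraMap (R := ℤ) (A := K)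
    have : IsIntegral ℤ x := IsIntegral.of_pow two_pos (by rw [hx]; exact_mod_cast hc D)
    exact (hc m).add ((hc m').mul this)
  have hinv : ∀ (x : K) (D u v : ℕ), x ^ 2 = D → u ^ 2 = D * v ^ 2 + 1 →
      (((u : ℤ) : K) + ((v : ℤ) : K) * x)⁻¹ = ((u : ℤ) : K) + ((-v : ℤ) : K) * x := by
    intro x D u v hx h
    have h' : (u : K) ^ 2 = D * v ^ 2 + 1 := by exact_mod_cast h
    refine inv_eq_of_mul_eq_one_right ?_
    push_cast
    linear_combination h' - (v : K) ^ 2 * hx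
  have hιval : ∀ (x : K) (D : ℕ), ι x = √D → ∀ m m' : ℤ, ι ((m : K) + m' * x) = m + m' * √D := by
    intro x D hx m m'
    simp [hx]
  have hunit : ∀ (x : K) (D u v : ℕ), x ^ 2 = D → 1 ≤ u → ∀ φ : K →+* ℂ,
      ‖φ (((u : ℤ) : K) + ((v : ℤ) : K) * x)‖ ≤ Real.exp (Real.log (u + v * √D)) ∧
      ‖φ (((u : ℤ) : K) + ((-v : ℤ) : K) * x)‖ ≤ Real.exp (Real.log (u + v * √D)) := by
    intro x D u v hx hu φ
    have hu' : (1 : ℝ) ≤ u := by exact_mod_cast hu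
    have hv' : (0 : ℝ) ≤ v * √D := by positivity
    rw [Real.exp_log (by linarith)]
    have e1 : |(u : ℝ) + v * √D| ≤ u + v * √D := by rw [abs_of_nonneg (by linarith)]
    have e2 : |(u : ℝ) - v * √D| ≤ u + v * √D := by rw [abs_le]; constructor <;> linarith
    constructor
    · exact norm_map_add_mul_le φ hx _ _ (by simpa using e1) (by simpa using e2)
    · refine norm_map_add_mul_le φ hx _ _ ?_ ?_
      · push_cast
        rwa [neg_mul, ← sub_eq_add_neg]
      · push_cast
        rwa [neg_mul, sub_neg_eq_add]
  have v1 := hιval r D₁ hιr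
  have v2 := hιval s D₂ hιs
  have hpos : ∀ (D u v : ℕ), 1 ≤ u → (0 : ℝ) < ((u : ℤ) : ℝ) + ((v : ℤ) : ℝ) * √D := by
    intro D u v hu
    have hu' : (0 : ℝ) < ((u : ℤ) : ℝ) := by exact_mod_cast hu
    positivity
  refine false_of_three_logs ι hd (η₁ := ((u₁ : ℤ) : K) + ((v₁ : ℤ) : K) * r)
    (η₂ := ((u₂ : ℤ) : K) + ((v₂ : ℤ) : K) * s) (M₁ := (m₁ : K) + m₁' * r) (M₂ := (m₂ : K) + m₂' * s)
    (hinteg r D₁ hr _ _) ?_ (hinteg s D₂ hs _ _) ?_ (hinteg r D₁ hr _ _) (hinteg s D₂ hs _ _)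
    ?_ ?_ ?_ ?_ ?_ (h₁ := Real.log (u₁ + v₁ * √D₁)) (h₂ := Real.log (u₂ + v₂ * √D₂)) ?_ ?_
    (fun φ => (hunit r D₁ u₁ v₁ hr hu₁ φ).1) ?_ (fun φ => (hunit s D₂ u₂ v₂ hs hu₂ φ).1) ?_
    (fun φ => norm_map_add_mul_le φ hr _ _ hM₁g hM₁g')
    (fun φ => norm_map_add_mul_le φ hs _ _ hM₂g hM₂g') hh₁ hh₂ hH₁ hle hb₁ hb₁' hb₂' ?_ hT1 hT hP hPℓ
  · rw [hinv r D₁ u₁ v₁ hr hp₁]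
    exact hinteg r D₁ hr _ _
  · rw [hinv s D₂ u₂ v₂ hs hp₂]
    exact hinteg s D₂ hs _ _
  · rw [v1]
    exact hpos _ _ _ hu₁
  · rw [v2]
    exact hpos _ _ _ hu₂
  · rwa [v1]
  · rwa [v2]
  · rw [v1, v2]
    exact_mod_cast add_mul_sqrt_pow_ne hD₁ hD₂ hD hu₁ hv₁ hu₂ hv₂
  · rw [v1]
    simp
  · rw [v2]
    simp
  · intro φ
    rw [hinv r D₁ u₁ v₁ hr hp₁]
    exact (hunit r D₁ u₁ v₁ hr hu₁ φ).2
  · intro φ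
    rw [hinv s D₂ u₂ v₂ hs hp₂]
    exact (hunit s D₂ u₂ v₂ hs hu₂ φ).2
  · rwa [v1, v2]

/-- The divisor bound `d(n) ≤ C * n ^ δ`. -/
theorem exists_card_divisors_le_rpow {δ : ℝ} (hδ : 0 < δ) :
    ∃ C : ℝ, 1 ≤ C ∧ ∀ n : ℕ, n ≠ 0 → (n.divisors.card : ℝ) ≤ C * (n : ℝ) ^ δ := by
  obtain ⟨B, hB⟩ := exists_nat_ge ((2 : ℝ) ^ (1 / δ))
  have hlog2 : 0 < Real.log 2 := Real.log_pos (by norm_num)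
  have hC1 : 1 ≤ 1 / (δ * Real.log 2) + 1 := by
    have : 0 ≤ 1 / (δ * Real.log 2) := by positivity
    linarith
  obtain ⟨C, hC⟩ : ∃ C, C = 1 / (δ * Real.log 2) + 1 := ⟨_, rfl⟩
  rw [← hC] at hC1
  refine ⟨C ^ B, one_le_pow₀ hC1, fun n hn => ?_⟩
  have hterm : ∀ p ∈ n.primeFactors, ((n.factorization p + 1 : ℕ) : ℝ) ≤
      (if p < B then C else 1) * ((p : ℝ) ^ (n.factorization p)) ^ δ := by
    intro p hp
    have hp2 : (2 : ℝ) ≤ p := by exact_mod_cast (Nat.prime_of_mem_primeFactors hp).two_le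
    generalize n.factorization p = e
    rw [← Real.rpow_natCast_mul (by linarith), mul_comm (e : ℝ), Real.rpow_mul_natCast (by linarith)]
    push_cast
    split_ifs with h
    · have h1 : (e : ℝ) * (δ * Real.log 2) ≤ ((2 : ℝ) ^ δ) ^ e := by
        rw [← Real.rpow_mul_natCast (by norm_num), Real.rpow_def_of_pos (by norm_num)]
        have := Real.add_one_le_exp (Real.log 2 * (δ * e))
        linarith
      have h2 : (1 : ℝ) ≤ ((2 : ℝ) ^ δ) ^ e := one_le_pow₀ (Real.one_le_rpow (by norm_num) hδ.le)
      have h3 : (e : ℝ) ≤ 1 / (δ * Real.log 2) * ((2 : ℝ) ^ δ) ^ e := by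
        rw [div_mul_eq_mul_div, le_div_iff₀ (by positivity)]
        linarith
      calc (e : ℝ) + 1 ≤ C * ((2 : ℝ) ^ δ) ^ e := by rw [hC, add_mul]; linarith
        _ ≤ _ := by gcongr
    · have h1 : (2 : ℝ) ≤ (p : ℝ) ^ δ := by
        have hBp : (2 : ℝ) ^ (1 / δ) ≤ p := hB.trans (by exact_mod_cast not_lt.1 h)
        calc (2 : ℝ) = ((2 : ℝ) ^ (1 / δ)) ^ δ := by
              rw [← Real.rpow_mul (by norm_num), one_div_mul_cancel hδ.ne', Real.rpow_one]
          _ ≤ _ := by gcongr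
      have h2 : (e : ℝ) + 1 ≤ 2 ^ e := by exact_mod_cast Nat.lt_two_pow_self
      rw [one_mul]
      exact h2.trans (by gcongr)
  rw [Nat.card_divisors hn]
  push_cast at hterm ⊢
  refine (Finset.prod_le_prod (fun _ _ => by positivity) hterm).trans ?_
  rw [Finset.prod_mul_distrib, Real.finsetProd_rpow _ _ (fun _ _ => by positivity)]
  have hprod : (∏ p ∈ n.primeFactors, (p : ℝ) ^ (n.factorization p)) = n := by
    exact_mod_cast Nat.prod_factorization_pow_eq_self hn
  rw [hprod]
  gcongr
  rw [Finset.prod_ite, Finset.prod_const_one, mul_one, Finset.prod_const]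
  refine pow_le_pow_right₀ hC1 ?_
  calc _ ≤ (Finset.range B).card := Finset.card_le_card fun p hp => by
        simp only [Finset.mem_filter] at hp
        exact Finset.mem_range.2 hp.2
    _ = B := Finset.card_range B

theorem exists_residue_of_coprime {x y D : ℤ} (hxy : IsCoprime x y)
    (hn : x ^ 2 - D * y ^ 2 ≠ 0) :
    ∃ t : ℕ, (t : ℤ) < |x ^ 2 - D * y ^ 2| ∧ x ^ 2 - D * y ^ 2 ∣ x - t * y ∧
      x ^ 2 - D * y ^ 2 ∣ t ^ 2 - D := by
  obtain ⟨n, hndef⟩ : ∃ n, n = x ^ 2 - D * y ^ 2 := ⟨_, rfl⟩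
  rw [← hndef] at hn ⊢
  have hcop : IsCoprime n y := by
    have : IsCoprime (x ^ 2 + y * (-(D * y))) y := (hxy.pow_left).add_mul_left_left _
    rw [hndef]
    convert this using 1
    ring
  obtain ⟨c, w, hw⟩ := hcop
  refine ⟨((x * w) % n).toNat, ?_, ?_, ?_⟩
  all_goals rw [Int.toNat_of_nonneg (Int.emod_nonneg _ hn)]
  · exact Int.emod_lt_abs _ hn
  · have h1 : n ∣ x * w - x * w % n := Int.dvd_self_sub_emod
    have h2 : x - x * w % n * y = (x * w - x * w % n) * y + n * (c * x) := by
      linear_combination -x * hw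
    rw [h2]
    exact dvd_add (h1.mul_right _) (dvd_mul_right _ _)
  · have h1 : n ∣ x * w - x * w % n := Int.dvd_self_sub_emod
    generalize x * w % n = t at h1 ⊢
    have h2 : t ^ 2 - D = -(x * w - t) * (x * w + t) + n * (w ^ 2 + D * (-(c * (1 + w * y)))) := by
      linear_combination D * (1 + w * y) * hw - w ^ 2 * hndef
    rw [h2]
    exact dvd_add ((h1.neg_right).mul_right _) (dvd_mul_right _ _)

theorem exists_pell_quotient {x₁ y₁ x₂ y₂ D n t : ℤ} (hn : n ≠ 0) (h₁ : x₁ ^ 2 - D * y₁ ^ 2 = n)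
    (h₂ : x₂ ^ 2 - D * y₂ ^ 2 = n) (hd₁ : n ∣ x₁ - t * y₁) (hd₂ : n ∣ x₂ - t * y₂)
    (ht : n ∣ t ^ 2 - D) :
    ∃ U V : ℤ, x₁ * x₂ - D * (y₁ * y₂) = n * U ∧ x₁ * y₂ - y₁ * x₂ = n * V ∧
      U ^ 2 = D * V ^ 2 + 1 := by
  have hU : n ∣ x₁ * x₂ - D * (y₁ * y₂) := by
    have : x₁ * x₂ - D * (y₁ * y₂) = (x₁ - t * y₁) * x₂ + (x₂ - t * y₂) * (t * y₁) +
      (t ^ 2 - D) * (y₁ * y₂) := by ring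
    rw [this]
    exact dvd_add (dvd_add (hd₁.mul_right _) (hd₂.mul_right _)) (ht.mul_right _)
  have hV : n ∣ x₁ * y₂ - y₁ * x₂ := by
    have : x₁ * y₂ - y₁ * x₂ = (x₁ - t * y₁) * y₂ - (x₂ - t * y₂) * y₁ := by ring
    rw [this]
    exact dvd_sub (hd₁.mul_right _) (hd₂.mul_right _)
  obtain ⟨U, hU⟩ := hU
  obtain ⟨V, hV⟩ := hV
  refine ⟨U, V, hU, hV, ?_⟩
  have : n ^ 2 * (U ^ 2 - (D * V ^ 2 + 1)) = 0 := by
    linear_combination -(x₁ * x₂ - D * (y₁ * y₂) + n * U) * hU + D * (x₁ * y₂ - y₁ * x₂ + n * V) * hV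
      + (x₂ ^ 2 - D * y₂ ^ 2) * h₁ + n * h₂
  rcases mul_eq_zero.1 this with h | h
  · exact absurd h (pow_ne_zero _ hn)
  · linarith

/-- A nontrivial solution of Pell's equation from a pigeonhole on classes of good approximations. -/
theorem exists_pell_log_le {D : ℕ} (hD : ¬ IsSquare D) :
    ∃ u v : ℕ, 1 ≤ u ∧ 1 ≤ v ∧ u ^ 2 = D * v ^ 2 + 1 ∧ Real.log (u + v * √D) ≤
      2 * ((∑ t ∈ Finset.range (2 * D.sqrt + 2), (((t : ℤ) ^ 2 - D).natAbs.divisors.card)) * 2 + 1) *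
        Real.log (2 * D.sqrt + 3) := by
  have hirr : Irrational √(D : ℝ) := irrational_sqrt_natCast_iff.2 hD
  obtain ⟨s, hs⟩ : ∃ s, s = √(D : ℝ) := ⟨_, rfl⟩
  rw [← hs] at hirr ⊢
  have hs0 : 0 ≤ s := hs ▸ Real.sqrt_nonneg _
  have hs2 : s * s = D := hs ▸ Real.mul_self_sqrt (Nat.cast_nonneg _)
  have hsD : s ≤ D.sqrt + 1 := by
    rw [hs]
    exact Real.sqrt_le_iff.2 ⟨by positivity, by exact_mod_cast (Nat.lt_succ_sqrt' D).le⟩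
  obtain ⟨B, hB⟩ : ∃ B, B = 2 * D.sqrt + 3 := ⟨_, rfl⟩
  have hBs : 2 * s + 1 ≤ (B : ℝ) := by
    rw [hB]
    push_cast
    linarith
  have hB1 : (1 : ℝ) ≤ B := by linarith
  have happ : ∀ j : ℕ, ∃ (x : ℤ) (y : ℕ), 1 ≤ y ∧ (y : ℝ) ≤ (B : ℝ) ^ j ∧ IsCoprime x (y : ℤ) ∧
      |x - y * s| * ((B : ℝ) ^ j + 1) ≤ 1 := by
    intro j
    have hBj : 0 < B ^ j := pow_pos (by omega) j
    obtain ⟨q, hq, hqd⟩ := Real.exists_rat_abs_sub_le_and_den_le s hBj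
    refine ⟨q.num, q.den, q.pos, by exact_mod_cast hqd,
      Int.isCoprime_iff_gcd_eq_one.2 q.reduced, ?_⟩
    have hden : (0 : ℝ) < q.den := by exact_mod_cast q.pos
    have h1 : |(q.num : ℝ) - q.den * s| = |s - q| * q.den := by
      rw [abs_sub_comm, ← abs_of_pos hden, ← abs_mul, abs_of_pos hden, sub_mul, ← Rat.cast_natCast,
        ← Rat.cast_mul, Rat.mul_den_eq_num, mul_comm s]
      simp
    rw [h1]
    push_cast at hq
    calc |s - q| * q.den * ((B : ℝ) ^ j + 1)
        ≤ 1 / (((B : ℝ) ^ j + 1) * q.den) * q.den * ((B : ℝ) ^ j + 1) := by gcongr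
      _ = 1 := by field_simp
  choose x y hy1 hyB hcop hα using happ
  have hBj : ∀ j, (1 : ℝ) ≤ (B : ℝ) ^ j := fun j => one_le_pow₀ hB1
  have hα1 : ∀ j, |(x j : ℝ) - y j * s| ≤ 1 := fun j => by
    nlinarith [hα j, hBj j, abs_nonneg ((x j : ℝ) - y j * s)]
  have hα0 : ∀ j, (x j : ℝ) - y j * s ≠ 0 := by
    intro j h0
    have hy : (y j : ℝ) ≠ 0 := by exact_mod_cast (by have := hy1 j; omega : y j ≠ 0)
    refine hirr ⟨(x j : ℚ) / y j, ?_⟩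
    push_cast
    rw [div_eq_iff hy]
    linarith
  have hconj : ∀ j, |(x j : ℝ)| + y j * s ≤ 2 * ((B : ℝ) ^ j * s) + 1 := by
    intro j
    have h1 : |(x j : ℝ)| ≤ |(x j : ℝ) - y j * s| + |y j * s| := by
      have := abs_add_le ((x j : ℝ) - y j * s) (y j * s)
      rwa [sub_add_cancel] at this
    rw [abs_of_nonneg (by positivity : (0 : ℝ) ≤ y j * s)] at h1
    have h2 : y j * s ≤ (B : ℝ) ^ j * s := by gcongr; exact hyB j
    linarith [hα1 j]
  have hconj' : ∀ j, |(x j : ℝ) + y j * s| ≤ 2 * ((B : ℝ) ^ j * s) + 1 := fun j => by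
    refine (abs_add_le _ _).trans ?_
    rw [abs_of_nonneg (by positivity : (0 : ℝ) ≤ y j * s)]
    exact hconj j
  obtain ⟨n, hndef⟩ : ∃ n : ℕ → ℤ, n = fun j => x j ^ 2 - D * (y j : ℤ) ^ 2 := ⟨_, rfl⟩
  have hnr : ∀ j, (n j : ℝ) = (x j - y j * s) * (x j + y j * s) := by
    intro j
    rw [hndef]
    push_cast
    linear_combination (y j : ℝ) ^ 2 * hs2
  have hn0 : ∀ j, n j ≠ 0 := by
    intro j h0
    have h1 := hnr j
    rw [h0, Int.cast_zero, eq_comm] at h1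
    rcases mul_eq_zero.1 h1 with h | h
    · exact hα0 j h
    · have hy : (y j : ℝ) ≠ 0 := by exact_mod_cast (by have := hy1 j; omega : y j ≠ 0)
      refine hirr ⟨-(x j : ℚ) / y j, ?_⟩
      push_cast
      rw [div_eq_iff hy]
      linarith
  have hnB : ∀ j, |n j| ≤ 2 * D.sqrt + 2 := by
    intro j
    have h1 : |(n j : ℝ)| < 2 * D.sqrt + 3 := by
      rw [hnr, abs_mul]
      have h2 : |(x j : ℝ) - y j * s| * |(x j : ℝ) + y j * s| * ((B : ℝ) ^ j + 1) ≤
          2 * ((B : ℝ) ^ j * s) + 1 := by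
        calc _ = (|(x j : ℝ) - y j * s| * ((B : ℝ) ^ j + 1)) * |(x j : ℝ) + y j * s| := by ring
          _ ≤ 1 * (2 * ((B : ℝ) ^ j * s) + 1) :=
            mul_le_mul (hα j) (hconj' j) (abs_nonneg _) zero_le_one
          _ = _ := one_mul _
      have h3 : 2 * ((B : ℝ) ^ j * s) + 1 < (2 * D.sqrt + 3) * ((B : ℝ) ^ j + 1) := by
        have : (B : ℝ) ^ j * s ≤ (B : ℝ) ^ j * (D.sqrt + 1) := by gcongr
        nlinarith [hBj j, Nat.cast_nonneg (α := ℝ) D.sqrt]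
      exact lt_of_mul_lt_mul_right (h2.trans_lt h3) (by linarith [hBj j])
    have h4 : |n j| < 2 * D.sqrt + 3 := by exact_mod_cast h1
    omega
  have hanti : StrictAnti fun j => |(x j : ℝ) - y j * s| := by
    refine strictAnti_nat_of_succ_lt fun j => ?_
    have h1 : (1 : ℝ) ≤ |(x j : ℝ) - y j * s| * |(x j : ℝ) + y j * s| := by
      rw [← abs_mul, ← hnr]
      exact_mod_cast Int.one_le_abs (hn0 j)
    have h2 : (1 : ℝ) ≤ |(x j : ℝ) - y j * s| * (2 * ((B : ℝ) ^ j * s) + 1) :=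
      h1.trans (by gcongr; exact hconj' j)
    have h3 := hα (j + 1)
    have h4 : 2 * ((B : ℝ) ^ j * s) + 1 < (B : ℝ) ^ (j + 1) + 1 := by
      rw [pow_succ]
      nlinarith [hBj j]
    by_contra hcon
    have h5 := not_lt.1 hcon
    have h6 : 0 < |(x j : ℝ) - y j * s| := abs_pos.2 (hα0 j)
    have : |(x j : ℝ) - y j * s| * (2 * ((B : ℝ) ^ j * s) + 1) <
        |(x j : ℝ) - y j * s| * ((B : ℝ) ^ (j + 1) + 1) := by gcongr
    have : |(x j : ℝ) - y j * s| * ((B : ℝ) ^ (j + 1) + 1) ≤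
        |(x (j + 1) : ℝ) - y (j + 1) * s| * ((B : ℝ) ^ (j + 1) + 1) := by gcongr
    linarith
  have hres : ∀ j, ∃ t : ℕ, (t : ℤ) < |n j| ∧ n j ∣ x j - t * y j ∧ n j ∣ (t : ℤ) ^ 2 - D := by
    intro j
    have := exists_residue_of_coprime (D := D) (hcop j) (by have := hn0 j; rwa [hndef] at this)
    rw [hndef]
    exact this
  choose t ht htx htD using hres
  obtain ⟨S, hS⟩ : ∃ S : Finset (Σ _ : ℕ, ℕ), S = (Finset.range (2 * D.sqrt + 2)).sigma
    fun t => ((t : ℤ) ^ 2 - D).natAbs.divisors := ⟨_, rfl⟩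
  have hScard : S.card = ∑ t ∈ Finset.range (2 * D.sqrt + 2),
      (((t : ℤ) ^ 2 - D).natAbs.divisors.card) := by rw [hS, Finset.card_sigma]
  rw [← hScard]
  have hmaps : ∀ j ∈ Finset.range (S.card * 2 + 1),
      ((⟨t j, (n j).natAbs⟩ : Σ _ : ℕ, ℕ), decide (0 < n j)) ∈ S ×ˢ (Finset.univ : Finset Bool) := by
    intro j _
    rw [Finset.mem_product, hS, Finset.mem_sigma, Finset.mem_range, Nat.mem_divisors]
    refine ⟨⟨?_, Int.natAbs_dvd_natAbs.2 (htD j), ?_⟩, Finset.mem_univ _⟩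
    · have h1 := ht j
      have h2 := hnB j
      simp only
      omega
    · intro h0
      refine hD ⟨t j, ?_⟩
      have h1 : ((t j : ℤ) ^ 2 - D) = 0 := Int.natAbs_eq_zero.1 h0
      have h2 : (D : ℤ) = t j * t j := by linarith
      exact_mod_cast h2
  obtain ⟨i, hi, j, hj, hij, heq⟩ := Finset.exists_ne_map_eq_of_card_lt_of_maps_to
    (by rw [Finset.card_product, Finset.card_range]; simp) hmaps
  simp only [Prod.mk.injEq, Sigma.mk.injEq, heq_eq_eq] at heq
  obtain ⟨⟨hteq, hneq⟩, hsign⟩ := heq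
  have hnn : n i = n j := by
    rcases Int.natAbs_eq_natAbs_iff.1 hneq with h | h
    · exact h
    · have h1 := hn0 i
      have h2 := hn0 j
      have h3 : (0 < n i) ↔ (0 < n j) := decide_eq_decide.1 hsign
      omega
  obtain ⟨U, V, hU, hV, hUV⟩ := exists_pell_quotient (x₁ := x i) (y₁ := y i) (x₂ := x j)
    (y₂ := y j) (D := D) (hn0 j) (by rw [← hnn, hndef]) (by rw [hndef]) (t := t j)
    (by rw [← hnn, ← hteq]; exact htx i) (htx j) (htD j)
  have hnj0 : (n j : ℝ) ≠ 0 := by exact_mod_cast hn0 j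
  have hUr : (x i : ℝ) * x j - D * (y i * y j) = n j * U := by exact_mod_cast hU
  have hVr : (x i : ℝ) * y j - y i * x j = n j * V := by exact_mod_cast hV
  have hV0 : V ≠ 0 := by
    rintro rfl
    have hU1 : U = 1 ∨ U = -1 := sq_eq_sq_iff_eq_or_eq_neg.1 (by rw [hUV]; ring)
    have hprod : ((x i : ℝ) - y i * s) * (x j + y j * s) = n j * U := by
      push_cast at hVr
      linear_combination hUr + s * hVr - (y i * y j : ℝ) * hs2
    have hprod' := hnr j
    have hc0 : (x j : ℝ) + y j * s ≠ 0 := by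
      intro h0
      rw [h0, mul_zero] at hprod'
      exact hnj0 hprod'
    have habs : |(x i : ℝ) - y i * s| * |(x j : ℝ) + y j * s| =
        |(x j : ℝ) - y j * s| * |(x j : ℝ) + y j * s| := by
      rw [← abs_mul, ← abs_mul, hprod, ← hprod', abs_mul]
      rcases hU1 with rfl | rfl <;> simp
    exact hij (hanti.injective (mul_right_cancel₀ (abs_ne_zero.2 hc0) habs))
  refine ⟨U.natAbs, V.natAbs, ?_, Int.natAbs_pos.2 hV0, ?_, ?_⟩
  · refine Int.natAbs_pos.2 ?_
    rintro rfl
    have : 0 ≤ (D : ℤ) * V ^ 2 := by positivity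
    linarith
  · zify
    rw [sq_abs, sq_abs]
    exact hUV
  · rw [Nat.cast_natAbs, Nat.cast_natAbs]
    push_cast
    rw [Finset.mem_range] at hi hj
    have hnj1 : (1 : ℝ) ≤ |(n j : ℝ)| := by exact_mod_cast Int.one_le_abs (hn0 j)
    have hsize : ∀ k, k < S.card * 2 + 1 →
        |(x k : ℝ)| + y k * s ≤ (B : ℝ) ^ (S.card * 2 + 1) := by
      intro k hk
      refine (hconj k).trans ?_
      calc 2 * ((B : ℝ) ^ k * s) + 1 ≤ (B : ℝ) ^ k * (2 * s + 1) := by nlinarith [hBj k]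
        _ ≤ (B : ℝ) ^ k * B := by gcongr
        _ = (B : ℝ) ^ (k + 1) := (pow_succ _ _).symm
        _ ≤ _ := pow_le_pow_right₀ hB1 hk
    have hx : |(U : ℝ)| + |(V : ℝ)| * s ≤
        (|(x i : ℝ)| + y i * s) * (|(x j : ℝ)| + y j * s) := by
      have h1 : |(n j : ℝ)| * |(U : ℝ)| ≤ |(x i : ℝ)| * |(x j : ℝ)| + D * (y i * y j) := by
        rw [← abs_mul, ← hUr, ← abs_mul]
        refine (abs_sub _ _).trans (add_le_add le_rfl (le_of_eq (abs_of_nonneg (by positivity))))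
      have h2 : |(n j : ℝ)| * |(V : ℝ)| ≤ |(x i : ℝ)| * y j + y i * |(x j : ℝ)| := by
        rw [← abs_mul, ← hVr]
        refine (abs_sub _ _).trans (le_of_eq ?_)
        rw [abs_mul, abs_mul, Nat.abs_cast, Nat.abs_cast]
      have h3 : |(n j : ℝ)| * |(V : ℝ)| * s ≤ (|(x i : ℝ)| * y j + y i * |(x j : ℝ)|) * s := by
        gcongr
      have h4 : 0 ≤ |(U : ℝ)| + |(V : ℝ)| * s := by positivity
      rw [← hs2] at h1
      nlinarith
    have hle : |(U : ℝ)| + |(V : ℝ)| * s ≤ (B : ℝ) ^ (2 * (S.card * 2 + 1)) := by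
      refine hx.trans ?_
      rw [two_mul, pow_add]
      gcongr
      · exact hsize i hi
      · exact hsize j hj
    have hpos : 0 < |(U : ℝ)| + |(V : ℝ)| * s := by
      refine add_pos_of_pos_of_nonneg (abs_pos.2 ?_) (by positivity)
      intro h0
      have h1 : U = 0 := by exact_mod_cast h0
      rw [h1] at hUV
      have : 0 ≤ (D : ℤ) * V ^ 2 := by positivity
      linarith
    have hlog := Real.log_le_log hpos hle
    rw [Real.log_pow] at hlog
    rw [hB] at hlog
    push_cast at hlog
    exact hlog

/-- A nontrivial solution of Pell's equation whose logarithm is at most about `√D`. -/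
theorem exists_pell_log_le_rpow {δ : ℝ} (hδ : 0 < δ) : ∃ C : ℝ, 1 ≤ C ∧
    ∀ D : ℕ, ¬ IsSquare D → ∃ u v : ℕ, 1 ≤ u ∧ 1 ≤ v ∧ u ^ 2 = D * v ^ 2 + 1 ∧
      Real.log (u + v * √D) ≤ C * (D : ℝ) ^ (1 / 2 + δ) := by
  obtain ⟨C, hC1, hC⟩ := exists_card_divisors_le_rpow (half_pos hδ)
  refine ⟨max 1 (2 * (9 * (C * 9 ^ (δ / 2))) * (5 ^ (δ / 2) / (δ / 2))), le_max_left _ _,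
    fun D hD => ?_⟩
  obtain ⟨u, v, hu, hv, hp, hle⟩ := exists_pell_log_le hD
  refine ⟨u, v, hu, hv, hp, hle.trans ?_⟩
  have hD1 : 1 ≤ D := Nat.one_le_iff_ne_zero.2 fun h => hD (h ▸ IsSquare.zero)
  have hD1' : (1 : ℝ) ≤ D := by exact_mod_cast hD1
  have hs1 : 1 ≤ D.sqrt := Nat.sqrt_pos.2 hD1
  have hsle : D.sqrt * D.sqrt ≤ D := Nat.sqrt_le D
  have hsD : (D.sqrt : ℝ) ≤ (D : ℝ) ^ (1 / 2 : ℝ) := by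
    rw [← Real.sqrt_eq_rpow]
    exact Real.le_sqrt_of_sq_le (by rw [sq]; exact_mod_cast hsle)
  have hterm : ∀ t ∈ Finset.range (2 * D.sqrt + 2),
      (((t : ℤ) ^ 2 - D).natAbs.divisors.card : ℝ) ≤ C * (9 ^ (δ / 2) * (D : ℝ) ^ (δ / 2)) := by
    intro t ht
    rw [Finset.mem_range] at ht
    have h0 : ((t : ℤ) ^ 2 - D).natAbs ≠ 0 := by
      intro h0
      refine hD ⟨t, ?_⟩
      have h1 : ((t : ℤ) ^ 2 - D) = 0 := Int.natAbs_eq_zero.1 h0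
      have h2 : (D : ℤ) = t * t := by linarith
      exact_mod_cast h2
    refine (hC _ h0).trans ?_
    rw [← Real.mul_rpow (by norm_num) (by positivity)]
    have h1 : ((t : ℤ) ^ 2 - D).natAbs ≤ 9 * D := by
      have h2 : t ^ 2 ≤ 9 * D := by
        have h3 : t ≤ 3 * D.sqrt := by omega
        nlinarith [Nat.mul_le_mul h3 h3]
      zify at h2
      have h4 : (0 : ℤ) ≤ (t : ℤ) ^ 2 := by positivity
      omega
    have h1' : (((t : ℤ) ^ 2 - D).natAbs : ℝ) ≤ 9 * D := by exact_mod_cast h1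
    gcongr
  have hsum : (((∑ t ∈ Finset.range (2 * D.sqrt + 2), ((t : ℤ) ^ 2 - D).natAbs.divisors.card : ℕ)) : ℝ) ≤
      4 * (D : ℝ) ^ (1 / 2 : ℝ) * (C * (9 ^ (δ / 2) * (D : ℝ) ^ (δ / 2))) := by
    push_cast
    refine (Finset.sum_le_sum hterm).trans ?_
    rw [Finset.sum_const, Finset.card_range, nsmul_eq_mul]
    have : ((2 * D.sqrt + 2 : ℕ) : ℝ) ≤ 4 * (D : ℝ) ^ (1 / 2 : ℝ) := by
      push_cast
      have : (1 : ℝ) ≤ D.sqrt := by exact_mod_cast hs1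
      linarith
    gcongr
  have hlog : Real.log (2 * D.sqrt + 3) ≤ 5 ^ (δ / 2) / (δ / 2) * (D : ℝ) ^ (δ / 2) := by
    have h1 : (2 * D.sqrt + 3 : ℝ) ≤ 5 * D := by
      have : D.sqrt ≤ D := Nat.sqrt_le_self D
      have : (D.sqrt : ℝ) ≤ D := by exact_mod_cast this
      linarith
    refine (Real.log_le_log (by positivity) h1).trans ?_
    refine (Real.log_le_rpow_div (by positivity) (half_pos hδ)).trans (le_of_eq ?_)
    rw [Real.mul_rpow (by norm_num) (by positivity)]
    ring
  have hlog0 : 0 ≤ Real.log (2 * D.sqrt + 3) :=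
    Real.log_nonneg (by linarith [Nat.cast_nonneg (α := ℝ) D.sqrt])
  have hA1 : 1 ≤ (D : ℝ) ^ (1 / 2 : ℝ) * (C * (9 ^ (δ / 2) * (D : ℝ) ^ (δ / 2))) := by
    have h9 : (1 : ℝ) ≤ 9 ^ (δ / 2) := Real.one_le_rpow (by norm_num) (by positivity)
    exact one_le_mul_of_one_le_of_one_le (Real.one_le_rpow hD1' (by norm_num))
      (one_le_mul_of_one_le_of_one_le hC1
        (one_le_mul_of_one_le_of_one_le h9 (Real.one_le_rpow hD1' (by positivity))))
  calc _ ≤ 2 * (9 * ((D : ℝ) ^ (1 / 2 : ℝ) * (C * (9 ^ (δ / 2) * (D : ℝ) ^ (δ / 2))))) *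
        (5 ^ (δ / 2) / (δ / 2) * (D : ℝ) ^ (δ / 2)) := by
        gcongr
        linarith
    _ = 2 * (9 * (C * 9 ^ (δ / 2))) * (5 ^ (δ / 2) / (δ / 2)) *
        ((D : ℝ) ^ (1 / 2 : ℝ) * (D : ℝ) ^ (δ / 2) * (D : ℝ) ^ (δ / 2)) := by ring
    _ = 2 * (9 * (C * 9 ^ (δ / 2))) * (5 ^ (δ / 2) / (δ / 2)) * (D : ℝ) ^ (1 / 2 + δ) := by
        rw [← Real.rpow_add (by linarith), ← Real.rpow_add (by linarith)]
        ring_nf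
    _ ≤ _ := by
        gcongr
        exact le_max_right _ _

theorem exists_pow_eq_add_mul_sqrt_of_pell {D u v : ℕ} (hp : u ^ 2 = D * v ^ 2 + 1) (p : ℕ) :
    ∃ U V : ℤ, ((u : ℝ) + v * √D) ^ p = U + V * √D ∧ U ^ 2 - D * V ^ 2 = 1 := by
  have hp' : (u : ℤ) ^ 2 = D * (v : ℤ) ^ 2 + 1 := by exact_mod_cast hp
  induction p with
  | zero => exact ⟨1, 0, by simp, by simp⟩
  | succ p ih =>
    obtain ⟨U, V, h, hUV⟩ := ih
    refine ⟨U * u + V * v * D, U * v + V * u, ?_, ?_⟩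
    · rw [pow_succ, h]
      push_cast
      have := Real.mul_self_sqrt (Nat.cast_nonneg (α := ℝ) D)
      linear_combination (V : ℝ) * v * this
    · linear_combination hp' + hUV * (u ^ 2 - D * v ^ 2)

/-- Dividing an element of `ℤ[√D]` by a power of a unit balances its conjugates. -/
theorem exists_eq_pow_mul_of_pell {D u v : ℕ} (hD : 1 ≤ D) (hu : 1 ≤ u) (hv : 1 ≤ v)
    (hp : u ^ 2 = D * v ^ 2 + 1) {a a' c : ℤ} (hc : a ^ 2 - D * a' ^ 2 = c)
    {S : ℝ} (hS : 1 ≤ S) (hSc : |(c : ℝ)| ≤ S ^ 2) (hY : S ≤ a + a' * √D) :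
    ∃ (b : ℕ) (m m' : ℤ), (a : ℝ) + a' * √D = ((u : ℝ) + v * √D) ^ b * (m + m' * √D) ∧
      S ≤ m + m' * √D ∧ m + m' * √D ≤ S * (u + v * √D) ∧ |m - m' * √D| ≤ S := by
  obtain ⟨Y, hYdef⟩ : ∃ Y, Y = a + a' * √D := ⟨_, rfl⟩
  obtain ⟨η, hη⟩ : ∃ η, η = (u : ℝ) + v * √D := ⟨_, rfl⟩
  have hs := Real.mul_self_sqrt (Nat.cast_nonneg (α := ℝ) D)
  have hη1 : 1 < η := by
    have h1 : (1 : ℝ) ≤ √D := Real.one_le_sqrt.2 (by exact_mod_cast hD)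
    have hu' : (1 : ℝ) ≤ u := by exact_mod_cast hu
    have hv' : (1 : ℝ) ≤ v := by exact_mod_cast hv
    rw [hη]
    nlinarith
  rw [← hYdef] at hY ⊢
  have hS0 : 0 < S := by linarith
  obtain ⟨b, hb, hb'⟩ := exists_nat_pow_near ((one_le_div hS0).2 hY) hη1
  obtain ⟨U, V, hUV, hUV1⟩ := exists_pow_eq_add_mul_sqrt_of_pell hp b
  rw [← hη] at hUV ⊢
  have hUV1' : (U : ℝ) ^ 2 - D * V ^ 2 = 1 := by exact_mod_cast hUV1
  have hc' : (a : ℝ) ^ 2 - D * a' ^ 2 = c := by exact_mod_cast hc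
  have hηb : 0 < η ^ b := by positivity
  have hη0 : 0 < η := by linarith
  have hμ : Y = η ^ b * (((a * U - D * a' * V : ℤ) : ℝ) + ((a' * U - a * V : ℤ) : ℝ) * √D) := by
    rw [hUV, hYdef]
    push_cast
    linear_combination -(a + a' * √D) * hUV1' +
      (a * V ^ 2 - a' * V * U) * hs
  have hμ' : Y * (((a * U - D * a' * V : ℤ) : ℝ) - ((a' * U - a * V : ℤ) : ℝ) * √D) =
      c * η ^ b := by
    rw [hUV, hYdef]
    push_cast
    linear_combination (U + V * √D) * hc' + (a * a' * V - a' ^ 2 * U) * hs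
  refine ⟨b, _, _, hμ, ?_, ?_, ?_⟩
  · rw [le_div_iff₀ hS0] at hb
    have h1 : η ^ b * S ≤ η ^ b * (((a * U - D * a' * V : ℤ) : ℝ) +
        ((a' * U - a * V : ℤ) : ℝ) * √D) := by rw [← hμ]; exact hb
    exact le_of_mul_le_mul_left h1 hηb
  · rw [div_lt_iff₀ hS0] at hb'
    have h1 : η ^ b * (((a * U - D * a' * V : ℤ) : ℝ) +
        ((a' * U - a * V : ℤ) : ℝ) * √D) ≤ η ^ b * (S * η) := by
      rw [← hμ]
      refine hb'.le.trans (le_of_eq ?_)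
      ring
    exact le_of_mul_le_mul_left h1 hηb
  · have hY0 : 0 < Y := by linarith
    rw [le_div_iff₀ hS0] at hb
    refine le_of_mul_le_mul_left (a := Y) ?_ hY0
    rw [← abs_of_pos hY0, ← abs_mul, hμ', abs_mul, abs_of_pos hηb, abs_of_pos hY0]
    calc |(c : ℝ)| * η ^ b ≤ S ^ 2 * η ^ b := by gcongr
      _ = (η ^ b * S) * S := by ring
      _ ≤ Y * S := by gcongr

theorem not_isSquare_of_abs_lt {D : ℕ} {a a' : ℕ} {c : ℤ} (hc0 : c ≠ 0)
    (hc : (a : ℤ) ^ 2 - D * (a' : ℤ) ^ 2 = c) (hca : |(c : ℝ)| < a) : ¬ IsSquare D := by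
  rintro ⟨s, rfl⟩
  have h1 : ((a : ℤ) + a' * s) * (a - a' * s) = c := by
    rw [← hc]
    push_cast
    ring
  have h2 : ((a : ℤ) - a' * s) ≠ 0 := by
    intro h
    rw [h, mul_zero] at h1
    exact hc0 h1.symm
  have h3 : |c| < a := by exact_mod_cast hca
  rw [← h1, abs_mul, abs_of_nonneg (by positivity : (0 : ℤ) ≤ a + a' * s)] at h3
  have h4 := Int.one_le_abs h2
  have h5 : (0 : ℤ) ≤ a' * s := by positivity
  have h6 : (0 : ℤ) ≤ a := by positivity
  nlinarith

theorem exists_pell_form {k k' x x' : ℕ} (hk : 1 ≤ k) (hk' : 1 ≤ k') (hx : 1 ≤ x) {c : ℤ} (hc0 : c ≠ 0)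
    (hc : (k' : ℤ) * x ^ 2 - k * x' ^ 2 = c) {G H ℓ : ℝ} (hG : 1 ≤ G) (hℓ : 20 * (2 * G + H) ≤ ℓ)
    (hH0 : 0 ≤ H)
    (hkG : k ≤ Real.exp G) (hk'G : k' ≤ Real.exp G) (hcG : |(c : ℝ)| ≤ Real.exp (2 * G))
    (hxl : Real.exp (ℓ / 4) ≤ x) (hxu : x ≤ Real.exp (ℓ / 4 + G))
    (hxu' : x' ≤ Real.exp (ℓ / 4 + G))
    (hpell : ¬ IsSquare (k * k') → ∃ u v : ℕ, 1 ≤ u ∧ 1 ≤ v ∧ u ^ 2 = (k * k') * v ^ 2 + 1 ∧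
      Real.log (u + v * √(k * k' : ℕ)) ≤ H) :
    ¬ IsSquare (k * k') ∧ ∃ (u v b : ℕ) (m m' : ℤ), 1 ≤ u ∧ 1 ≤ v ∧
      u ^ 2 = (k * k') * v ^ 2 + 1 ∧ Real.log (u + v * √(k * k' : ℕ)) ≤ H ∧
      b * Real.log (u + v * √(k * k' : ℕ)) + Real.log (m + m' * √(k * k' : ℕ)) =
        Real.log (k' * x + x' * √(k * k' : ℕ)) ∧
      ℓ / 5 ≤ b * Real.log (u + v * √(k * k' : ℕ)) ∧
      b * Real.log (u + v * √(k * k' : ℕ)) ≤ ℓ / 2 ∧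
      1 ≤ m + m' * √(k * k' : ℕ) ∧ m + m' * √(k * k' : ℕ) ≤ Real.exp (3 / 2 * G + H) ∧
      |m - m' * √(k * k' : ℕ)| ≤ Real.exp (3 / 2 * G + H) := by
  have hk1 : (1 : ℝ) ≤ k := by exact_mod_cast hk
  have hk1' : (1 : ℝ) ≤ k' := by exact_mod_cast hk'
  have hx1 : (1 : ℝ) ≤ x := by exact_mod_cast hx
  have hnorm : ((k' * x : ℕ) : ℤ) ^ 2 - (k * k' : ℕ) * (x' : ℤ) ^ 2 = k' * c := by
    rw [← hc]
    push_cast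
    ring
  have hnormle : |((k' * c : ℤ) : ℝ)| ≤ Real.exp (3 / 2 * G) ^ 2 := by
    push_cast
    rw [abs_mul, Nat.abs_cast, ← Real.exp_nat_mul]
    calc (k' : ℝ) * |(c : ℝ)| ≤ Real.exp G * Real.exp (2 * G) := by gcongr
      _ = Real.exp ((2 : ℕ) * (3 / 2 * G)) := by rw [← Real.exp_add]; push_cast; ring_nf
  have hxk : (x : ℝ) ≤ k' * x := by nlinarith
  have hns : ¬ IsSquare (k * k') := by
    refine not_isSquare_of_abs_lt (mul_ne_zero (by positivity) hc0) hnorm (hnormle.trans_lt ?_)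
    rw [← Real.exp_nat_mul]
    push_cast
    refine lt_of_lt_of_le (Real.exp_lt_exp.2 ?_) (hxl.trans hxk)
    linarith
  refine ⟨hns, ?_⟩
  obtain ⟨u, v, hu, hv, hp, hle⟩ := hpell hns
  obtain ⟨D, hD⟩ : ∃ D, D = k * k' := ⟨_, rfl⟩
  have hD1 : 1 ≤ D := by rw [hD]; exact Nat.mul_pos hk hk'
  have hDG : √(D : ℝ) ≤ Real.exp G := by
    refine Real.sqrt_le_iff.2 ⟨(Real.exp_pos _).le, ?_⟩
    rw [hD, sq]
    push_cast
    gcongr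
  rw [← hD] at hp hle hnorm ⊢
  have hYx : (x : ℝ) ≤ k' * x + x' * √D := by
    have : 0 ≤ x' * √(D : ℝ) := by positivity
    linarith
  obtain ⟨b, m, m', hY, hm, hmη, hm'⟩ := exists_eq_pow_mul_of_pell hD1 hu hv hp hnorm
    (Real.one_le_exp (by linarith)) hnormle (by
      push_cast
      refine (Real.exp_le_exp.2 ?_).trans (hxl.trans hYx)
      linarith)
  push_cast at hY
  have hη := half_le_log_add_mul_sqrt hD1 hu hv
  obtain ⟨η, hηd⟩ : ∃ η, η = (u : ℝ) + v * √D := ⟨_, rfl⟩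
  rw [← hηd] at hY hη hmη hle
  have hη0 : 0 < η := by
    rw [hηd]
    have : 0 < u := hu
    positivity
  have hμ1 : 1 ≤ m + m' * √D := (Real.one_le_exp (by linarith)).trans hm
  have hμu : m + m' * √D ≤ Real.exp (3 / 2 * G + H) := by
    rw [Real.exp_add]
    refine hmη.trans ?_
    gcongr
    exact (Real.log_le_iff_le_exp hη0).1 hle
  have hlog : b * Real.log η + Real.log (m + m' * √D) = Real.log (k' * x + x' * √D) := by
    rw [hY, Real.log_mul (pow_pos hη0 _).ne' (by linarith), Real.log_pow]
  have hlogμ0 : 0 ≤ Real.log (m + m' * √D) := Real.log_nonneg hμ1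
  have hlogμ : Real.log (m + m' * √D) ≤ 3 / 2 * G + H :=
    (Real.log_le_iff_le_exp (by linarith)).2 hμu
  have hYl : ℓ / 4 ≤ Real.log (k' * x + x' * √D) :=
    (Real.le_log_iff_exp_le (by linarith)).2 (hxl.trans hYx)
  have hYu : Real.log (k' * x + x' * √D) ≤ ℓ / 4 + 3 * G := by
    rw [Real.log_le_iff_le_exp (by linarith)]
    calc (k' * x + x' * √D : ℝ) ≤ Real.exp G * Real.exp (ℓ / 4 + G) +
          Real.exp (ℓ / 4 + G) * Real.exp G := by gcongr
      _ = 2 * Real.exp (ℓ / 4 + 2 * G) := by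
        rw [show ℓ / 4 + 2 * G = G + (ℓ / 4 + G) by ring, Real.exp_add G]
        ring
      _ ≤ Real.exp G * Real.exp (ℓ / 4 + 2 * G) := by
        gcongr
        linarith [Real.add_one_le_exp G]
      _ = _ := by rw [← Real.exp_add]; ring_nf
  refine ⟨u, v, b, m, m', hu, hv, hp, hηd ▸ hle, hηd ▸ hlog, hηd ▸ ?_, hηd ▸ ?_, hμ1, hμu,
    hm'.trans (Real.exp_le_exp.2 (by linarith))⟩
  · linarith
  · linarith

theorem abs_log_sub_log_le {a b B : ℝ} (hB : 0 < B) (ha : B ≤ a) (hb : B ≤ b) :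
    |Real.log a - Real.log b| ≤ |a - b| / B := by
  have key : ∀ a b : ℝ, B ≤ a → B ≤ b → Real.log a - Real.log b ≤ |a - b| / B := by
    intro a b ha hb
    have hb0 : 0 < b := hB.trans_le hb
    rw [← Real.log_div (hB.trans_le ha).ne' hb0.ne']
    calc Real.log (a / b) ≤ a / b - 1 := Real.log_le_sub_one_of_pos (div_pos (hB.trans_le ha) hb0)
      _ = (a - b) / b := by field_simp
      _ ≤ |a - b| / b := by gcongr; exact le_abs_self _
      _ ≤ |a - b| / B := by gcongr
  refine abs_le.2 ⟨?_, key a b ha hb⟩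
  have := key b a hb ha
  rw [abs_sub_comm] at this
  linarith

theorem abs_log_sub_log_pell_le {k₁ k₂ k₃ x₁ x₂ x₃ : ℕ} (hk₁ : 1 ≤ k₁) (hk₂ : 1 ≤ k₂) (hk₃ : 1 ≤ k₃)
    {G ℓ : ℝ} (hℓ : 40 * G ≤ ℓ) (hG : 1 ≤ G) (hk₁G : k₁ ≤ Real.exp G) (hk₂G : k₂ ≤ Real.exp G)
    (hk₃G : k₃ ≤ Real.exp G) (hx₁ : Real.exp (ℓ / 4) ≤ x₁) (hx₂ : Real.exp (ℓ / 4) ≤ x₂)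
    (hc : |(k₃ : ℝ) * x₂ ^ 2 - k₂ * x₃ ^ 2| ≤ Real.exp (2 * G)) :
    |Real.log (k₃ * (k₂ * x₁ + x₂ * √(k₁ * k₂ : ℕ))) -
      Real.log (k₂ * (k₃ * x₁ + x₃ * √(k₁ * k₃ : ℕ)))| ≤ Real.exp (-(ℓ / 3)) := by
  have h1 : (1 : ℝ) ≤ k₁ := by exact_mod_cast hk₁
  have h2 : (1 : ℝ) ≤ k₂ := by exact_mod_cast hk₂
  have h3 : (1 : ℝ) ≤ k₃ := by exact_mod_cast hk₃
  have hx₁0 : (0 : ℝ) ≤ x₁ := Nat.cast_nonneg _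
  push_cast
  rw [Real.sqrt_mul (by linarith), Real.sqrt_mul (by linarith)]
  have hs1 := Real.mul_self_sqrt (Nat.cast_nonneg (α := ℝ) k₁)
  have hs2 := Real.mul_self_sqrt (Nat.cast_nonneg (α := ℝ) k₂)
  have hs3 := Real.mul_self_sqrt (Nat.cast_nonneg (α := ℝ) k₃)
  have hs3' : (1 : ℝ) ≤ √(k₃ : ℝ) := Real.one_le_sqrt.2 h3
  have hsle : ∀ k : ℕ, 1 ≤ k → (k : ℝ) ≤ Real.exp G → √(k : ℝ) ≤ Real.exp (G / 2) := by
    intro k _ hk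
    refine Real.sqrt_le_iff.2 ⟨(Real.exp_pos _).le, hk.trans (le_of_eq ?_)⟩
    rw [← Real.exp_nat_mul]
    push_cast
    ring_nf
  have hpos : 0 < √(k₃ : ℝ) * x₂ + √(k₂ : ℝ) * x₃ := by
    have : 0 < (x₂ : ℝ) := (Real.exp_pos _).trans_le hx₂
    positivity
  have hdiff : |√(k₃ : ℝ) * x₂ - √(k₂ : ℝ) * x₃| ≤ Real.exp (2 * G - ℓ / 4) := by
    have h4 : (√(k₃ : ℝ) * x₂ - √(k₂ : ℝ) * x₃) * (√(k₃ : ℝ) * x₂ + √(k₂ : ℝ) * x₃) =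
        k₃ * x₂ ^ 2 - k₂ * x₃ ^ 2 := by
      linear_combination (x₂ : ℝ) ^ 2 * hs3 - (x₃ : ℝ) ^ 2 * hs2
    rw [← h4, abs_mul, abs_of_pos hpos] at hc
    have h5 : Real.exp (ℓ / 4) ≤ √(k₃ : ℝ) * x₂ + √(k₂ : ℝ) * x₃ := by
      have : 0 ≤ √(k₂ : ℝ) * x₃ := by positivity
      nlinarith [Real.exp_pos (ℓ / 4)]
    rw [Real.exp_sub, le_div_iff₀ (Real.exp_pos _)]
    exact (mul_le_mul_of_nonneg_left h5 (abs_nonneg _)).trans hc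
  refine (abs_log_sub_log_le (Real.exp_pos (ℓ / 4)) ?_ ?_).trans ?_
  · have : 0 ≤ (x₂ : ℝ) * (√k₁ * √k₂) := by positivity
    nlinarith [Real.exp_pos (ℓ / 4), mul_le_mul h3 h2 zero_le_one (by linarith)]
  · have : 0 ≤ (x₃ : ℝ) * (√k₁ * √k₃) := by positivity
    nlinarith [Real.exp_pos (ℓ / 4), mul_le_mul h2 h3 zero_le_one (by linarith)]
  · have h6 : (k₃ * (k₂ * x₁ + x₂ * (√k₁ * √k₂)) - k₂ * (k₃ * x₁ + x₃ * (√k₁ * √k₃)) : ℝ) =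
        √k₁ * √k₂ * √k₃ * (√k₃ * x₂ - √k₂ * x₃) := by
      linear_combination -(√k₁ * √k₂ * x₂ : ℝ) * hs3 + (√k₁ * √k₃ * x₃ : ℝ) * hs2
    rw [h6, abs_mul, abs_of_nonneg (by positivity), div_le_iff₀ (Real.exp_pos _), ← Real.exp_add]
    calc _ ≤ Real.exp (G / 2) * Real.exp (G / 2) * Real.exp (G / 2) * Real.exp (2 * G - ℓ / 4) := by
          gcongr
          · exact hsle _ hk₁ hk₁G
          · exact hsle _ hk₂ hk₂G
          · exact hsle _ hk₃ hk₃G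
      _ = Real.exp (7 / 2 * G - ℓ / 4) := by
          rw [← Real.exp_add, ← Real.exp_add, ← Real.exp_add]
          ring_nf
      _ ≤ _ := Real.exp_le_exp.2 (by linarith)

theorem not_isSquare_mul_mul {k a b : ℕ} (hk : 1 ≤ k) (h : ¬ IsSquare (a * b)) :
    ¬ IsSquare ((k * a) * (k * b)) := by
  rintro ⟨s, hs⟩
  have h1 : k ^ 2 * (a * b) = s ^ 2 := by
    rw [sq s, ← hs]
    ring
  obtain ⟨t, rfl⟩ := (Nat.pow_dvd_pow_iff two_ne_zero).1 (Dvd.intro _ h1)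
  refine h ⟨t, Nat.eq_of_mul_eq_mul_left (pow_pos hk 2) ?_⟩
  rw [h1]
  ring

/-- Three large solutions of `kⱼ xᵢ² - kᵢ xⱼ² = cᵢⱼ ≠ 0` with all `kᵢ`, `cᵢⱼ` small cannot coexist. -/
theorem false_of_three_points {k x : Fin 3 → ℕ} (hk : ∀ i, 1 ≤ k i) (hx : ∀ i, 1 ≤ x i)
    {G H ℓ : ℝ} (hG : 1 ≤ G) (hH0 : 0 ≤ H) (hℓ : 20 * (2 * G + H) ≤ ℓ)
    (hkG : ∀ i, k i ≤ Real.exp G) (hxl : ∀ i, Real.exp (ℓ / 4) ≤ x i)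
    (hxu : ∀ i, x i ≤ Real.exp (ℓ / 4 + G))
    (hc0 : ∀ i j, i ≠ j → (k j : ℤ) * x i ^ 2 - k i * x j ^ 2 ≠ 0)
    (hc : ∀ i j, i ≠ j → |(k j : ℝ) * x i ^ 2 - k i * x j ^ 2| ≤ Real.exp (2 * G))
    (hpell : ∀ i j, ¬ IsSquare (k i * k j) → ∃ u v : ℕ, 1 ≤ u ∧ 1 ≤ v ∧
      u ^ 2 = (k i * k j) * v ^ 2 + 1 ∧ Real.log (u + v * √(k i * k j : ℕ)) ≤ H)
    {T P : ℕ} (hT1 : 1 ≤ T) (hT : 300 * Real.log ℓ ≤ T) (hP : 8 * 10 ^ 7 * (T : ℝ) ^ 3 * H ≤ P)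
    (hPℓ : 10 ^ 7 * (T : ℝ) ^ 3 * (7 * (P * H) * (2 * (2 * G + H) + 7 * (P * H))) ≤ ℓ / 2) :
    False := by
  have hform := fun (i j : Fin 3) (hij : i ≠ j) => exists_pell_form (hk i) (hk j) (hx i) (hc0 i j hij)
    rfl hG hℓ hH0 (hkG i) (hkG j) (by push_cast; exact hc i j hij) (hxl i) (hxu i) (hxu j) (hpell i j)
  obtain ⟨hD₁, u₁, v₁, b₁, m₁, m₁', hu₁, hv₁, hp₁, hH₁, hlog₁, hb₁, hb₁', hm₁, hm₁u, hm₁c⟩ :=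
    hform 0 1 (by decide)
  obtain ⟨hD₂, u₂, v₂, b₂, m₂, m₂', hu₂, hv₂, hp₂, hH₂, hlog₂, hb₂, hb₂', hm₂, hm₂u, hm₂c⟩ :=
    hform 0 2 (by decide)
  obtain ⟨hD₃, -⟩ := hform 1 2 (by decide)
  have hkr : ∀ i, (1 : ℝ) ≤ k i := fun i => by exact_mod_cast hk i
  have hx0 : ∀ i, (0 : ℝ) < x i := fun i => (Real.exp_pos _).trans_le (hxl i)
  have hexp : ∀ i (t : ℝ), |t| ≤ Real.exp (3 / 2 * G + H) →
      |k i * t| ≤ Real.exp (2 * (2 * G + H)) := by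
    intro i t ht
    rw [abs_mul, Nat.abs_cast]
    calc (k i : ℝ) * |t| ≤ Real.exp G * Real.exp (3 / 2 * G + H) := by gcongr; exact hkG i
      _ = Real.exp (5 / 2 * G + H) := by rw [← Real.exp_add]; ring_nf
      _ ≤ _ := Real.exp_le_exp.2 (by linarith)
  have hΛ := abs_log_sub_log_pell_le (hk 0) (hk 1) (hk 2) (by linarith) hG (hkG 0) (hkG 1) (hkG 2)
    (hxl 0) (hxl 1) (hc 1 2 (by decide))
  have hY : ∀ i j, (0 : ℝ) < k j * x 0 + x j * √(k i * k j : ℕ) := by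
    intro i j
    have h1 := hx0 0
    have h2 := hx0 j
    have h3 := hkr j
    have : (0 : ℝ) ≤ x j * √(k i * k j : ℕ) := by positivity
    nlinarith
  rw [Real.log_mul (by linarith [hkr 2]) (hY 0 1).ne', Real.log_mul (by linarith [hkr 1]) (hY 0 2).ne',
    ← hlog₁, ← hlog₂] at hΛ
  have hadd : ∀ (i : Fin 3) (m m' : ℤ) (s : ℝ),
      ((k i * m : ℤ) : ℝ) + ((k i * m' : ℤ) : ℝ) * s = k i * (m + m' * s) := by
    intro i m m' s; push_cast; ring
  have hsub : ∀ (i : Fin 3) (m m' : ℤ) (s : ℝ),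
      ((k i * m : ℤ) : ℝ) - ((k i * m' : ℤ) : ℝ) * s = k i * (m - m' * s) := by
    intro i m m' s; push_cast; ring
  refine false_of_pell_logs (m₁ := k 2 * m₁) (m₁' := k 2 * m₁') (m₂ := k 1 * m₂) (m₂' := k 1 * m₂')
    hD₁ hD₂ (not_isSquare_mul_mul (hk 0) hD₃) hu₁ hv₁ hu₂ hv₂ hp₁ hp₂ ?_ ?_ ?_ ?_ ?_ ?_ hH₁ hH₂
    hb₁ hb₁' hb₂ hb₂' ?_ hT1 hT hP hPℓ
  · rw [hadd]
    exact one_le_mul_of_one_le_of_one_le (hkr 2) hm₁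
  · rw [hadd]
    exact one_le_mul_of_one_le_of_one_le (hkr 1) hm₂
  · rw [hadd]
    exact hexp _ _ (by rwa [abs_of_nonneg (by linarith)])
  · rw [hsub]
    exact hexp _ _ hm₁c
  · rw [hadd]
    exact hexp _ _ (by rwa [abs_of_nonneg (by linarith)])
  · rw [hsub]
    exact hexp _ _ hm₂c
  · rw [hadd, hadd, Real.log_mul (by linarith [hkr 2]) (by linarith),
      Real.log_mul (by linarith [hkr 1]) (by linarith)]
    refine le_of_eq_of_le ?_ hΛ
    congr 1
    ring

theorem exists_three_mul_ne {K : Finset ℕ} (hK : 5 ≤ K.card) (hK1 : ∀ k ∈ K, 1 ≤ k) (q : ℤ) :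
    ∃ k : Fin 3 → ℕ, Function.Injective k ∧ (∀ i, k i ∈ K) ∧
      ∀ i j, i ≠ j → (k i : ℤ) * k j + q ≠ 0 := by
  have hremove : ∀ (L : Finset ℕ) (a : ℕ), 1 ≤ a →
      L.card ≤ (L.filter fun b => b ≠ a ∧ (a : ℤ) * b + q ≠ 0).card + 2 := by
    intro L a ha
    have h1 : (L.filter fun b => ¬ (b ≠ a ∧ (a : ℤ) * b + q ≠ 0)).card ≤ 2 := by
      have hsub : (L.filter fun b => ¬ (b ≠ a ∧ (a : ℤ) * b + q ≠ 0)) ⊆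
          {a} ∪ L.filter fun b : ℕ => (a : ℤ) * b + q = 0 := by
        intro b
        simp only [Finset.mem_filter, Finset.mem_union, Finset.mem_singleton]
        tauto
      refine (Finset.card_le_card hsub).trans ((Finset.card_union_le _ _).trans ?_)
      have : (L.filter fun b : ℕ => (a : ℤ) * b + q = 0).card ≤ 1 := by
        refine Finset.card_le_one.2 fun b hb c hc => ?_
        rw [Finset.mem_filter] at hb hc
        have h2 : (a : ℤ) * b = a * c := by linarith [hb.2, hc.2]
        have h3 : (a : ℤ) ≠ 0 := by positivity
        exact_mod_cast mul_left_cancel₀ h3 h2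
      rw [Finset.card_singleton]
      omega
    have := Finset.card_filter_add_card_filter_not (s := L)
      (fun b => b ≠ a ∧ (a : ℤ) * b + q ≠ 0)
    omega
  obtain ⟨a, ha⟩ := Finset.card_pos.1 (by omega : 0 < K.card)
  have hL := hremove K a (hK1 a ha)
  obtain ⟨L, hLdef⟩ : ∃ L, L = K.filter fun b => b ≠ a ∧ (a : ℤ) * b + q ≠ 0 := ⟨_, rfl⟩
  rw [← hLdef] at hL
  obtain ⟨b, hb⟩ := Finset.card_pos.1 (by omega : 0 < L.card)
  have hb' := hb
  rw [hLdef, Finset.mem_filter] at hb'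
  have hM := hremove L b (hK1 b hb'.1)
  obtain ⟨c, hc⟩ := Finset.card_pos.1
    (by omega : 0 < (L.filter fun c => c ≠ b ∧ (b : ℤ) * c + q ≠ 0).card)
  rw [Finset.mem_filter, hLdef, Finset.mem_filter] at hc
  obtain ⟨⟨hcK, hca, hac⟩, hcb, hbc⟩ := hc
  obtain ⟨hbK, hba, hab⟩ := hb'
  refine ⟨![a, b, c], ?_, ?_, ?_⟩
  · intro i j hij
    fin_cases i <;> fin_cases j <;> simp_all
  · intro i
    fin_cases i <;> simp_all
  · intro i j hij
    fin_cases i <;> fin_cases j <;> simp_all [mul_comm]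

/-- More than twenty lattice points on a hyperbola arc yield three compatible abscissas. -/
theorem exists_three_points_of_lt_encard {N R : ℕ} {r : ℤ} (hr : (N : ℤ) = R ^ 2 + r)
    (hrR : |r| < 2 * R - 1) {B : ℝ}
    (hcard : 20 < {x : ℤ × ℤ | x.1 ^ 2 - x.2 ^ 2 = (N : ℤ) ∧ (|x.2| : ℝ) ≤ B}.encard) :
    ∃ k x : Fin 3 → ℕ, Function.Injective k ∧ (∀ i, 1 ≤ k i) ∧
      (∀ i, (x i : ℤ) ^ 2 = 2 * R * k i + k i ^ 2 - r) ∧ (∀ i, (x i : ℝ) ≤ B) ∧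
      ∀ i j, i ≠ j → (k i : ℤ) * k j + r ≠ 0 := by
  obtain ⟨t, htS, htc⟩ := Set.exists_subset_encard_eq
    (Order.add_one_le_of_lt hcard)
  have htf : t.Finite := Set.finite_of_encard_eq_coe (k := 21) (by rw [htc]; rfl)
  obtain ⟨s, rfl⟩ := htf.exists_finset_coe
  have hs : s.card = 21 := by
    rw [Set.encard_coe_eq_coe_finsetCard] at htc
    have h1 : (s.card : ℕ∞) = (21 : ℕ) := by rw [htc]; rfl
    exact_mod_cast h1
  have hmem : ∀ p ∈ s, p.1 ^ 2 - p.2 ^ 2 = (N : ℤ) ∧ (|p.2| : ℝ) ≤ B := fun p hp => htS hp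
  have himage : s.card ≤ 4 * (s.image fun p => p.1.natAbs).card := by
    refine Finset.card_le_mul_card_image s 4 fun a ha => ?_
    obtain ⟨p, hp, hpa⟩ := Finset.mem_image.1 ha
    have hsub : (s.filter fun q => q.1.natAbs = a) ⊆
        {(p.1, p.2), (p.1, -p.2), (-p.1, p.2), (-p.1, -p.2)} := by
      intro q hq
      rw [Finset.mem_filter] at hq
      have h1 : q.1 = p.1 ∨ q.1 = -p.1 := Int.natAbs_eq_natAbs_iff.1 (hq.2.trans hpa.symm)
      have h2 : q.2 ^ 2 = p.2 ^ 2 := by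
        have h3 := (hmem p hp).1
        have h4 := (hmem q hq.1).1
        have h5 : q.1 ^ 2 = p.1 ^ 2 := sq_eq_sq_iff_eq_or_eq_neg.2 h1
        linarith
      have h2' := sq_eq_sq_iff_eq_or_eq_neg.1 h2
      simp only [Finset.mem_insert, Finset.mem_singleton, Prod.ext_iff]
      tauto
    exact (Finset.card_le_card hsub).trans Finset.card_le_four
  have habs : ∀ p ∈ s, R ≤ p.1.natAbs := by
    intro p hp
    by_contra hlt
    have h1 : |p.1| ≤ R - 1 := by rw [Int.abs_eq_natAbs]; omega
    have h2 := (hmem p hp).1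
    have h3 : p.1 ^ 2 ≤ (R - 1 : ℤ) ^ 2 := by
      rw [← sq_abs p.1]
      exact pow_le_pow_left₀ (abs_nonneg _) h1 2
    nlinarith [neg_abs_le r, sq_nonneg p.2]
  obtain ⟨K, hK⟩ : ∃ K, K = ((s.image fun p => p.1.natAbs).erase R).image (· - R) := ⟨_, rfl⟩
  have hKc : 5 ≤ K.card := by
    rw [hK, Finset.card_image_of_injOn]
    · have := Finset.pred_card_le_card_erase (s := s.image fun p => p.1.natAbs) (a := R)
      omega
    · intro a ha b hb hab
      simp only [Finset.coe_erase, Finset.coe_image, Set.mem_sdiff, Set.mem_image,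
        Finset.mem_coe] at ha hb
      obtain ⟨⟨p, hp, rfl⟩, -⟩ := ha
      obtain ⟨⟨q, hq, rfl⟩, -⟩ := hb
      have h1 := habs p hp
      have h2 := habs q hq
      simp only at hab
      omega
  have hKmem : ∀ k ∈ K, 1 ≤ k ∧ ∃ x : ℕ, (x : ℤ) ^ 2 = 2 * R * k + k ^ 2 - r ∧ (x : ℝ) ≤ B := by
    intro k hk
    simp only [hK, Finset.mem_image, Finset.mem_erase] at hk
    obtain ⟨a, ⟨haR, p, hp, rfl⟩, rfl⟩ := hk
    have h1 := habs p hp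
    have h2 := hmem p hp
    refine ⟨by omega, p.2.natAbs, ?_, ?_⟩
    · rw [Int.natAbs_sq, Nat.cast_sub h1]
      have h3 : ((p.1.natAbs : ℕ) : ℤ) ^ 2 = p.1 ^ 2 := Int.natAbs_sq _
      linear_combination -h3 - h2.1 - hr
    · rw [Nat.cast_natAbs]
      exact_mod_cast h2.2
  obtain ⟨k, hinj, hkK, hkr⟩ := exists_three_mul_ne hKc (fun k hk => (hKmem k hk).1) r
  choose x hx hxB using fun i => (hKmem (k i) (hkK i)).2
  exact ⟨k, x, hinj, fun i => (hKmem _ (hkK i)).1, hx, hxB, hkr⟩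

open Filter Asymptotics in
theorem eventually_mul_rpow_le {a b : ℝ} (hab : a < b) (C : ℝ) :
    ∀ᶠ ℓ : ℝ in atTop, C * ℓ ^ a ≤ ℓ ^ b := by
  have h1 := (tendsto_rpow_atTop (sub_pos.2 hab)).eventually_ge_atTop C
  filter_upwards [h1, eventually_gt_atTop 0] with ℓ h hℓ
  calc C * ℓ ^ a ≤ ℓ ^ (b - a) * ℓ ^ a := by gcongr
    _ = ℓ ^ b := by rw [← Real.rpow_add hℓ]; ring_nf

open Filter in
/-- Existence of admissible parameters for `false_of_three_points`. -/
theorem eventually_exists_parameters {ε : ℝ} (hε0 : 0 < ε) (hε1 : ε < 1 / 100) {C : ℝ} (hC : 1 ≤ C) :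
    ∀ᶠ ℓ : ℝ in atTop, ∃ G H : ℝ, G = 3 * ℓ ^ (1 / 2 - ε) ∧
      H = C * ℓ ^ ((1 / 2 - ε) / 2 + ε / 13) ∧ 1 ≤ G ∧ 0 ≤ H ∧ 20 * (2 * G + H) ≤ ℓ ∧
      ∃ T P : ℕ, 1 ≤ T ∧ 300 * Real.log ℓ ≤ T ∧ 8 * 10 ^ 7 * (T : ℝ) ^ 3 * H ≤ P ∧
        10 ^ 7 * (T : ℝ) ^ 3 * (7 * (P * H) * (2 * (2 * G + H) + 7 * (P * H))) ≤ ℓ / 2 := by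
  obtain ⟨κ, hκ⟩ : ∃ κ, κ = 1 / 2 - ε := ⟨_, rfl⟩
  obtain ⟨δ, hδ⟩ : ∃ δ, δ = ε / 13 := ⟨_, rfl⟩
  have hδ0 : 0 < δ := by rw [hδ]; positivity
  rw [← hκ, ← hδ]
  have hlog : ∀ᶠ ℓ : ℝ in atTop, 300 * Real.log ℓ ≤ ℓ ^ (δ / 2) := by
    have := (isLittleO_log_rpow_atTop (half_pos hδ0)).def (by norm_num : (0 : ℝ) < 1 / 300)
    filter_upwards [this, eventually_ge_atTop 1] with ℓ h h1
    rw [Real.norm_of_nonneg (Real.log_nonneg h1), Real.norm_of_nonneg (by positivity)] at h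
    linarith
  filter_upwards [hlog, eventually_mul_rpow_le (half_lt_self hδ0) 3,
    eventually_mul_rpow_le (by linarith : κ < 1) (20 * (6 + C)),
    eventually_mul_rpow_le (by linarith : 2 * κ + 13 * δ < 1)
      (2 * 10 ^ 7 * (7 * (9 * 10 ^ 7 * C ^ 2) * (2 * (6 + C) + 7 * (9 * 10 ^ 7 * C ^ 2)))),
    eventually_ge_atTop 1] with ℓ hlog hT h20 hmain hℓ
  have hℓ0 : 0 < ℓ := by linarith
  rw [Real.rpow_one] at h20 hmain
  have hκ1 : 1 ≤ ℓ ^ κ := Real.one_le_rpow hℓ (by linarith)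
  have hδ1 : 1 ≤ ℓ ^ (δ / 2) := Real.one_le_rpow hℓ (by linarith)
  have hH1 : 1 ≤ ℓ ^ (κ / 2 + δ) := Real.one_le_rpow hℓ (by linarith)
  have hHκ : C * ℓ ^ (κ / 2 + δ) ≤ C * ℓ ^ κ := by
    gcongr
    linarith
  refine ⟨_, _, rfl, rfl, by linarith, by positivity, by linarith,
    ⌈300 * Real.log ℓ⌉₊ + 1, ⌈8 * 10 ^ 7 * ((⌈300 * Real.log ℓ⌉₊ + 1 : ℕ) : ℝ) ^ 3 *
      (C * ℓ ^ (κ / 2 + δ))⌉₊, by omega, ?_, Nat.le_ceil _, ?_⟩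
  · push_cast
    linarith [Nat.le_ceil (300 * Real.log ℓ)]
  obtain ⟨T, hTdef⟩ : ∃ T, T = ⌈300 * Real.log ℓ⌉₊ + 1 := ⟨_, rfl⟩
  rw [← hTdef]
  obtain ⟨H, hH⟩ : ∃ H, H = C * ℓ ^ (κ / 2 + δ) := ⟨_, rfl⟩
  rw [← hH] at hHκ ⊢
  have hHge : 1 ≤ H := by rw [hH]; exact one_le_mul_of_one_le_of_one_le hC hH1
  obtain ⟨P, hP⟩ : ∃ P, P = ⌈8 * 10 ^ 7 * (T : ℝ) ^ 3 * H⌉₊ := ⟨_, rfl⟩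
  rw [← hP]
  have hT1 : (1 : ℝ) ≤ T := by rw [hTdef]; push_cast; linarith [Nat.cast_nonneg (α := ℝ) ⌈300 * Real.log ℓ⌉₊]
  have hTle : (T : ℝ) ≤ ℓ ^ δ := by
    have := Nat.ceil_lt_add_one (a := 300 * Real.log ℓ) (by linarith [Real.log_nonneg hℓ])
    rw [hTdef]
    push_cast
    linarith
  have hT3 : (T : ℝ) ^ 3 ≤ ℓ ^ (3 * δ) := by
    calc (T : ℝ) ^ 3 ≤ (ℓ ^ δ) ^ 3 := by gcongr
      _ = ℓ ^ (3 * δ) := by rw [← Real.rpow_natCast, ← Real.rpow_mul hℓ0.le]; push_cast; ring_nf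
  have hPle : (P : ℝ) ≤ 9 * 10 ^ 7 * ℓ ^ (3 * δ) * H := by
    have h1 := Nat.ceil_lt_add_one (a := 8 * 10 ^ 7 * (T : ℝ) ^ 3 * H) (by positivity)
    rw [← hP] at h1
    have h2 : (T : ℝ) ^ 3 * H ≤ ℓ ^ (3 * δ) * H := by gcongr
    have h3 : 1 ≤ (T : ℝ) ^ 3 * H := one_le_mul_of_one_le_of_one_le (one_le_pow₀ hT1) hHge
    nlinarith
  have hPH : P * H ≤ 9 * 10 ^ 7 * C ^ 2 * ℓ ^ (κ + 5 * δ) := by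
    calc P * H ≤ 9 * 10 ^ 7 * ℓ ^ (3 * δ) * H * H := by gcongr
      _ = 9 * 10 ^ 7 * C ^ 2 * (ℓ ^ (3 * δ) * (ℓ ^ (κ / 2 + δ) * ℓ ^ (κ / 2 + δ))) := by
        rw [hH]; ring
      _ = _ := by rw [← Real.rpow_add hℓ0, ← Real.rpow_add hℓ0]; ring_nf
  have hκle : ℓ ^ κ ≤ ℓ ^ (κ + 5 * δ) := Real.rpow_le_rpow_of_exponent_le hℓ (by linarith)
  have hsum : 2 * (2 * (3 * ℓ ^ κ) + H) + 7 * (P * H) ≤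
      (2 * (6 + C) + 7 * (9 * 10 ^ 7 * C ^ 2)) * ℓ ^ (κ + 5 * δ) := by
    have : C * ℓ ^ κ ≤ C * ℓ ^ (κ + 5 * δ) := by gcongr
    linarith
  calc 10 ^ 7 * (T : ℝ) ^ 3 * (7 * (P * H) * (2 * (2 * (3 * ℓ ^ κ) + H) + 7 * (P * H)))
      ≤ 10 ^ 7 * ℓ ^ (3 * δ) * (7 * (9 * 10 ^ 7 * C ^ 2 * ℓ ^ (κ + 5 * δ)) *
        ((2 * (6 + C) + 7 * (9 * 10 ^ 7 * C ^ 2)) * ℓ ^ (κ + 5 * δ))) := by gcongr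
    _ = 10 ^ 7 * (7 * (9 * 10 ^ 7 * C ^ 2) * (2 * (6 + C) + 7 * (9 * 10 ^ 7 * C ^ 2))) *
        (ℓ ^ (3 * δ) * (ℓ ^ (κ + 5 * δ) * ℓ ^ (κ + 5 * δ))) := by ring
    _ = 10 ^ 7 * (7 * (9 * 10 ^ 7 * C ^ 2) * (2 * (6 + C) + 7 * (9 * 10 ^ 7 * C ^ 2))) *
        ℓ ^ (2 * κ + 13 * δ) := by
      rw [← Real.rpow_add hℓ0, ← Real.rpow_add hℓ0]
      ring_nf
    _ ≤ ℓ / 2 := by linarith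

theorem abs_sub_mul_mul_add_le {k k' K r E : ℝ} (hk0 : 0 ≤ k) (hk0' : 0 ≤ k') (hk : k ≤ K) (hk' : k' ≤ K)
    (hr : |r| ≤ E) : |(k - k') * (k * k' + r)| ≤ K * (K ^ 2 + E) := by
  rw [abs_mul]
  have h1 : |k - k'| ≤ K := abs_le.2 ⟨by linarith, by linarith⟩
  have h2 : |k * k' + r| ≤ K ^ 2 + E := by
    refine (abs_add_le _ _).trans ?_
    rw [abs_of_nonneg (mul_nonneg hk0 hk0'), sq]
    gcongr
    linarith
  gcongr
  linarith

/-- Elementary comparisons between `s`, playing the role of `(log N) ^ (κ / 2)`, and exponentials. -/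
theorem le_exp_of_forty_le {s : ℝ} (hs : 40 ≤ s) :
    21 * s ≤ Real.exp (3 * s ^ 2) ∧
      21 * s * ((21 * s) ^ 2 + 16 * Real.exp (2 * s ^ 2)) ≤ Real.exp (2 * (3 * s ^ 2)) := by
  have h1 := Real.pow_div_factorial_le_exp (s ^ 2) (by positivity) 3
  have h6 : (s ^ 2) ^ 3 / (Nat.factorial 3 : ℝ) = s ^ 3 * s ^ 3 / 6 := by
    norm_num [Nat.factorial]
    ring
  rw [h6] at h1
  have hs3 : (64000 : ℝ) ≤ s ^ 3 := by
    calc (64000 : ℝ) = 40 ^ 3 := by norm_num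
      _ ≤ s ^ 3 := by gcongr
  have h2 : 9261 * s ^ 3 ≤ Real.exp (s ^ 2) := by nlinarith
  have h3 : 400 * s ≤ s ^ 3 := by nlinarith
  obtain ⟨e, he⟩ : ∃ e, e = Real.exp (s ^ 2) := ⟨_, rfl⟩
  have he2 : Real.exp (2 * s ^ 2) = e ^ 2 := by rw [he, ← Real.exp_nat_mul]; norm_num
  have he3 : Real.exp (3 * s ^ 2) = e ^ 3 := by rw [he, ← Real.exp_nat_mul]; norm_num
  have he6 : Real.exp (2 * (3 * s ^ 2)) = e ^ 6 := by
    rw [he, ← Real.exp_nat_mul]; push_cast; ring_nf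
  rw [he2, he3, he6]
  rw [← he] at h2
  have he1 : 2 ≤ e := by linarith
  have hee : e ≤ e ^ 3 := le_self_pow₀ (by linarith) (by norm_num)
  have hee' : 2 * e ^ 3 ≤ e ^ 6 := by
    have : 2 ≤ e ^ 3 := by linarith
    nlinarith
  refine ⟨by linarith, ?_⟩
  have h5 : 336 * s * e ^ 2 ≤ e * e ^ 2 := by
    gcongr
    linarith
  nlinarith

theorem natCast_mem_bounds_of_sq_eq {R k x : ℕ} {r w s q : ℝ} (hw : 10 ≤ w) (hk : 1 ≤ k)
    (hRw : 0.9 * w ^ 2 ≤ R) (hr : |r| ≤ w) (hq : q ^ 2 = s) (hs : 40 ≤ s)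
    (hx : (x : ℝ) ^ 2 = 2 * R * k + k ^ 2 - r) (hxB : (x : ℝ) ≤ 6 * w * q) :
    (k : ℝ) ≤ 21 * s ∧ w ≤ x := by
  have hk1 : (1 : ℝ) ≤ k := by exact_mod_cast hk
  have hww : 10 * w ≤ w ^ 2 := by nlinarith
  have hrr := le_abs_self r
  have hkk := sq_nonneg (k : ℝ)
  constructor
  · have h1 : (x : ℝ) ^ 2 ≤ (6 * w * q) ^ 2 := pow_le_pow_left₀ (Nat.cast_nonneg _) hxB 2
    have h2 : (6 * w * q) ^ 2 = 36 * w ^ 2 * s := by rw [← hq]; ring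
    rw [hx, h2] at h1
    have h3 : 0.9 * w ^ 2 * k ≤ R * k := by gcongr
    have h4 : w ^ 2 * (1.8 * k) ≤ w ^ 2 * (36 * s + 1) := by linarith
    have h5 := le_of_mul_le_mul_left h4 (by positivity)
    linarith
  · refine le_of_sq_le_sq ?_ (Nat.cast_nonneg _)
    rw [hx]
    have h3 : (0.9 * w ^ 2) * 1 ≤ R * k := by gcongr
    linarith

/-- The counting bound, for given auxiliary parameters. -/
theorem encard_le_twenty {N R : ℕ} {ℓ G H s q w : ℝ} (hw : w = Real.exp (ℓ / 4)) (hw10 : 10 ≤ w)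
    (hNw : (N : ℝ) = w ^ 4) (hs : 40 ≤ s) (hq : 1 ≤ q) (hqs : q ^ 2 = s) (hG : G = 3 * s ^ 2)
    (hG1 : 1 ≤ G) (hH0 : 0 ≤ H) (h20 : 20 * (2 * G + H) ≤ ℓ)
    (hR : |(N : ℝ) - (R : ℝ) ^ 2| ≤ 16 * Real.exp (2 * s ^ 2))
    (hE : 16 * Real.exp (2 * s ^ 2) ≤ w)
    (hpell : ∀ D : ℕ, ¬ IsSquare D → (D : ℝ) ≤ 441 * s ^ 2 → ∃ u v : ℕ, 1 ≤ u ∧ 1 ≤ v ∧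
      u ^ 2 = D * v ^ 2 + 1 ∧ Real.log (u + v * √D) ≤ H)
    {T P : ℕ} (hT1 : 1 ≤ T) (hT : 300 * Real.log ℓ ≤ T) (hP : 8 * 10 ^ 7 * (T : ℝ) ^ 3 * H ≤ P)
    (hPℓ : 10 ^ 7 * (T : ℝ) ^ 3 * (7 * (P * H) * (2 * (2 * G + H) + 7 * (P * H))) ≤ ℓ / 2) :
    {x : ℤ × ℤ | x.1 ^ 2 - x.2 ^ 2 = (N : ℤ) ∧ (|x.2| : ℝ) ≤ 6 * w * q}.encard ≤ 20 := by
  obtain ⟨hexp1, hexp2⟩ := le_exp_of_forty_le hs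
  rw [← hG] at hexp1 hexp2
  obtain ⟨r, hr⟩ : ∃ r : ℤ, r = N - R ^ 2 := ⟨_, rfl⟩
  have hrr : (r : ℝ) = N - R ^ 2 := by rw [hr]; push_cast; ring
  rw [← hrr] at hR
  have hrw : |(r : ℝ)| ≤ w := hR.trans hE
  have hRw : 0.9 * w ^ 2 ≤ R := by
    refine le_of_sq_le_sq ?_ (Nat.cast_nonneg _)
    have h1 : (R : ℝ) ^ 2 = w ^ 4 - r := by rw [hrr, hNw]; ring
    have h2 : 1000 * w ≤ w ^ 4 := by
      have : (10 : ℝ) ^ 3 ≤ w ^ 3 := by gcongr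
      nlinarith
    rw [h1]
    nlinarith [le_abs_self (r : ℝ)]
  have hww : 10 * w ≤ w ^ 2 := by nlinarith
  have hrR : |r| < 2 * R - 1 := by
    have : |(r : ℝ)| < 2 * R - 1 := by linarith
    exact_mod_cast this
  by_contra hcard
  obtain ⟨k, x, hinj, hk1, hx, hxB, hkr⟩ := exists_three_points_of_lt_encard (r := r)
    (by rw [hr]; ring) hrR (not_le.1 hcard)
  have hxr : ∀ i, (x i : ℝ) ^ 2 = 2 * R * k i + k i ^ 2 - r := fun i => by exact_mod_cast hx i
  have hbounds := fun i => natCast_mem_bounds_of_sq_eq hw10 (hk1 i) hRw hrw hqs hs (hxr i) (hxB i)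
  have hks : ∀ i, (k i : ℝ) ≤ 21 * s := fun i => (hbounds i).1
  have hxw : ∀ i, w ≤ x i := fun i => (hbounds i).2
  have hcr : ∀ i j, (k j : ℝ) * x i ^ 2 - k i * x j ^ 2 = (k i - k j) * (k i * k j + r) := by
    intro i j
    rw [hxr, hxr]
    ring
  refine false_of_three_points (k := k) (x := x) hk1 (fun i => ?_) hG1 hH0 h20
    (fun i => (hks i).trans hexp1) (fun i => hw ▸ hxw i) (fun i => ?_) (fun i j hij => ?_)
    (fun i j _ => ?_) (fun i j hD => ?_) hT1 hT hP hPℓ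
  · have : (1 : ℝ) ≤ x i := by linarith [hxw i]
    exact_mod_cast this
  · rw [Real.exp_add, ← hw]
    calc (x i : ℝ) ≤ 6 * w * q := hxB i
      _ = w * (6 * q) := by ring
      _ ≤ w * Real.exp G := by
        gcongr
        nlinarith
  · have h1 : (k j : ℤ) * x i ^ 2 - k i * x j ^ 2 = (k i - k j) * (k i * k j + r) := by
      exact_mod_cast hcr i j
    rw [h1]
    refine mul_ne_zero (sub_ne_zero.2 ?_) (hkr i j hij)
    exact_mod_cast hinj.ne hij
  · rw [hcr]
    refine (abs_sub_mul_mul_add_le (Nat.cast_nonneg _) (Nat.cast_nonneg _) (hks i) (hks j) hR).trans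
      ?_
    exact hexp2
  · refine hpell _ hD ?_
    push_cast
    calc (k i : ℝ) * k j ≤ (21 * s) * (21 * s) := by
          gcongr
          · exact hks i
          · exact hks j
      _ = 441 * s ^ 2 := by ring

/-- For `κ = 1/2 - ε`, `0 < ε < 10⁻²`, and `N` large (depending only on `ε`)
with `|N - R²| ≤ 16·e^(2 (log N)^κ)` for some `R ∈ ℕ`, the hyperbola `m² - n² = N`
contains at most 20 lattice points with `|n| ≤ 6 N^(1/4) (log N)^(κ/4)`. -/
theorem stmt_7 (ε : ℝ) (hε0 : 0 < ε) (hε1 : ε < 1 / 100) :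
    ∃ N₀ : ℕ, ∀ N : ℕ, N₀ ≤ N →
      (∃ R : ℕ, |(N : ℝ) - (R : ℝ) ^ 2| ≤
          16 * Real.exp (2 * Real.log N ^ ((1 : ℝ) / 2 - ε))) →
      {x : ℤ × ℤ | x.1 ^ 2 - x.2 ^ 2 = (N : ℤ) ∧
          (|x.2| : ℝ) ≤ 6 * (N : ℝ) ^ ((1 : ℝ) / 4) *
            Real.log N ^ (((1 : ℝ) / 2 - ε) / 4)}.encard ≤ 20 := by
  obtain ⟨κ, hκ⟩ : ∃ κ, κ = 1 / 2 - ε := ⟨_, rfl⟩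
  obtain ⟨C, hC1, hC⟩ := exists_pell_log_le_rpow (δ := ε / 13) (by positivity)
  have hev : ∀ᶠ ℓ : ℝ in Filter.atTop, 40 * ℓ ^ (0 : ℝ) ≤ ℓ ^ (κ / 2) :=
    eventually_mul_rpow_le (by linarith) _
  have hev' : ∀ᶠ ℓ : ℝ in Filter.atTop, 20 * ℓ ^ κ ≤ ℓ ^ (1 : ℝ) :=
    eventually_mul_rpow_le (by linarith) _
  have hall := (((eventually_exists_parameters hε0 hε1
    (C := C * 441) (by linarith)).and hev).and hev').and (Filter.eventually_ge_atTop (60 : ℝ))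
  have hN := (Real.tendsto_log_atTop.comp tendsto_natCast_atTop_atTop).eventually hall
  obtain ⟨N₀, hN₀⟩ := Filter.eventually_atTop.1 hN
  refine ⟨N₀, fun N hNN hR => ?_⟩
  obtain ⟨R, hR⟩ := hR
  obtain ⟨⟨⟨⟨G, H, hG, hH, hG1, hH0, h20, T, P, hT1, hT, hP, hPℓ⟩, hs⟩, hκℓ⟩, hℓ⟩ := hN₀ N hNN
  rw [← hκ] at hG hH hR ⊢
  simp only [Function.comp_apply] at hG hH h20 hT hPℓ hs hκℓ hℓ
  obtain ⟨ℓ, hℓdef⟩ : ∃ ℓ, ℓ = Real.log N := ⟨_, rfl⟩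
  rw [← hℓdef] at hG hH h20 hT hPℓ hs hκℓ hℓ hR ⊢
  rw [Real.rpow_zero, mul_one] at hs
  rw [Real.rpow_one] at hκℓ
  have hℓ0 : 0 < ℓ := by linarith
  obtain ⟨s, hsdef⟩ : ∃ s, s = ℓ ^ (κ / 2) := ⟨_, rfl⟩
  rw [← hsdef] at hs
  have hs2 : ℓ ^ κ = s ^ 2 := by
    rw [hsdef, ← Real.rpow_natCast, ← Real.rpow_mul hℓ0.le]; push_cast; ring_nf
  have hq : 1 ≤ ℓ ^ (κ / 4) := Real.one_le_rpow (by linarith) (by linarith)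
  have hqs : (ℓ ^ (κ / 4)) ^ 2 = s := by
    rw [hsdef, ← Real.rpow_natCast, ← Real.rpow_mul hℓ0.le]; push_cast; ring_nf
  obtain ⟨q, hqdef⟩ : ∃ q, q = ℓ ^ (κ / 4) := ⟨_, rfl⟩
  rw [← hqdef] at hq hqs ⊢
  rw [hs2] at hG hκℓ hR
  obtain ⟨w, hw⟩ : ∃ w, w = Real.exp (ℓ / 4) := ⟨_, rfl⟩
  have hw10 : 10 ≤ w := by rw [hw]; linarith [Real.add_one_le_exp (ℓ / 4)]
  have hN0 : (0 : ℝ) < N := by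
    rcases Nat.eq_zero_or_pos N with h | h
    · rw [h] at hℓdef
      simp at hℓdef
      linarith
    · exact_mod_cast h
  have hNw : (N : ℝ) = w ^ 4 := by
    rw [hw, ← Real.exp_nat_mul, ← Real.exp_log hN0, ← hℓdef]
    push_cast
    ring_nf
  have hNq : (N : ℝ) ^ ((1 : ℝ) / 4) = w := by
    rw [hNw, ← Real.rpow_natCast, ← Real.rpow_mul (by linarith)]
    norm_num
  rw [hNq]
  have hE : 16 * Real.exp (2 * s ^ 2) ≤ w := by
    have h1 : (16 : ℝ) ≤ Real.exp 3 := by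
      have h2 : Real.exp 3 = Real.exp 1 ^ 3 := by rw [← Real.exp_nat_mul]; norm_num
      rw [h2]
      calc (16 : ℝ) ≤ 2.7 ^ 3 := by norm_num
        _ ≤ Real.exp 1 ^ 3 := by gcongr; linarith [Real.exp_one_gt_d9]
    calc 16 * Real.exp (2 * s ^ 2) ≤ Real.exp 3 * Real.exp (2 * s ^ 2) := by gcongr
      _ = Real.exp (3 + 2 * s ^ 2) := by rw [← Real.exp_add]
      _ ≤ w := by rw [hw]; exact Real.exp_le_exp.2 (by linarith)
  refine encard_le_twenty hw hw10 hNw hs hq hqs hG hG1 hH0 h20 hR hE (fun D hD hDs => ?_) hT1 hT hP hPℓ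
  obtain ⟨u, v, hu, hv, hp, hle⟩ := hC _ hD
  refine ⟨u, v, hu, hv, hp, hle.trans ?_⟩
  rw [← hs2] at hDs
  calc C * (D : ℝ) ^ (1 / 2 + ε / 13)
      ≤ C * (441 * ℓ ^ κ) ^ (1 / 2 + ε / 13) := by gcongr
    _ = C * 441 ^ (1 / 2 + ε / 13) * ℓ ^ (κ * (1 / 2 + ε / 13)) := by
      rw [Real.mul_rpow (by norm_num) (by positivity), ← Real.rpow_mul hℓ0.le]
      ring
    _ ≤ C * 441 * ℓ ^ (κ / 2 + ε / 13) := by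
      gcongr
      · exact Real.rpow_le_self_of_one_le (by norm_num) (by linarith)
      · linarith
      · nlinarith
    _ = H := hH.symm
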